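/- Fix an integer d ≥ 1, m > 0 and x, y ∈ ℝ^d with x ≠ y. Let A_1, …, A_n ⊆ ℝ^d be bounded open boxes (products of bounded open intervals) such that for all i ≠ j the intersection ∂A_i ∩ ∂A_j is contained in a finite union of affine subspaces of dimension at most d − 2 (the bounding hyperplane faces of distinct boxes never overlap), and assume x ∈ A_1 and y ∈ A_n ∖ closure(A_{n−1}). Then the boundary in Ω̄(x,y) of the closed set Z̄(A_1,…,A_n) has V_{x,y}-measure zero, and consequently lim V_{x,y,a}( Z̄(A_1,…,A_n) ) = (m²/2) · V_{x,y}( Z̄(A_1,…,A_n) ) as a → 0⁺ along values with x − y ∈ aℤ^d. -/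

import Mathlib

open MeasureTheory Filter Topology Real Set
open scoped RealInnerProductSpace ENNReal unitInterval

noncomputable section

/-- `ℝ^d` as a Euclidean space. -/
abbrev Ed (d : ℕ) := EuclideanSpace ℝ (Fin d)

/-- The space of continuous paths `[0,1] → ℝ^d`, with the uniform metric. -/
abbrev PathSp (d : ℕ) := C(unitInterval, Ed d)

instance (d : ℕ) : MeasurableSpace (PathSp d) := borel _
instance (d : ℕ) : BorelSpace (PathSp d) := ⟨rfl⟩

/-- Evaluation of a path at a real time, clamped to `[0,1]`. -/
def evalAt {d : ℕ} (ω : PathSp d) (t : ℝ) : Ed d := ω (Set.projIcc 0 1 zero_le_one t)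

/-- `Ω(x)`: continuous paths starting at `x`. -/
abbrev Omega1 {d : ℕ} (x : Ed d) := {ω : PathSp d // ω 0 = x}

/-- `Ω(x,y)`: continuous paths from `x` to `y`. -/
abbrev Omega2 {d : ℕ} (x y : Ed d) := {ω : PathSp d // ω 0 = x ∧ ω 1 = y}

/-- clamp a real number to `[0,1]`. -/
def clamp01 (r : ℝ) : ℝ := min 1 (max 0 r)

lemma clamp01_of_nonpos {r : ℝ} (h : r ≤ 0) : clamp01 r = 0 := by
  rw [clamp01, max_eq_left h, min_eq_right zero_le_one]

lemma clamp01_of_one_le {r : ℝ} (h : 1 ≤ r) : clamp01 r = 1 := by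
  rw [clamp01, max_eq_right (zero_le_one.trans h), min_eq_left h]

lemma clamp01_continuous : Continuous clamp01 :=
  continuous_const.min (continuous_const.max continuous_id)

/-- The piecewise linear path starting at `x` with `N` steps given by the increments `v i`,
the `i`-th step being linearly parametrized by `[i/N, (i+1)/N]`. -/
def pwLinE {d : ℕ} (x : Ed d) (N : ℕ) (v : Fin N → Ed d) : PathSp d :=
  ⟨fun t => x + ∑ i : Fin N, clamp01 ((N : ℝ) * (t : ℝ) - ((i : ℕ) : ℝ)) • v i, by
    refine continuous_const.add (continuous_finset_sum _ fun i _ => ?_)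
    exact ((clamp01_continuous.comp
      ((continuous_const.mul continuous_subtype_val).sub continuous_const)).smul
      continuous_const)⟩

lemma pwLinE_zero {d : ℕ} (x : Ed d) (N : ℕ) (v : Fin N → Ed d) :
    pwLinE x N v 0 = x := by
  show x + ∑ i : Fin N, clamp01 ((N : ℝ) * ((0 : unitInterval) : ℝ) - ((i : ℕ) : ℝ)) • v i = x
  have h : ∀ i : Fin N, clamp01 ((N : ℝ) * ((0 : unitInterval) : ℝ) - ((i : ℕ) : ℝ)) = 0 := by
    intro i
    apply clamp01_of_nonpos
    have h0 : ((0 : unitInterval) : ℝ) = 0 := rfl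
    rw [h0, mul_zero, zero_sub]
    exact neg_nonpos.mpr (Nat.cast_nonneg (i : ℕ))
  simp only [h, zero_smul, Finset.sum_const_zero, add_zero]

lemma pwLinE_one {d : ℕ} (x : Ed d) (N : ℕ) (v : Fin N → Ed d) :
    pwLinE x N v 1 = x + ∑ i : Fin N, v i := by
  show x + ∑ i : Fin N, clamp01 ((N : ℝ) * ((1 : unitInterval) : ℝ) - ((i : ℕ) : ℝ)) • v i
      = x + ∑ i : Fin N, v i
  have h : ∀ i : Fin N, clamp01 ((N : ℝ) * ((1 : unitInterval) : ℝ) - ((i : ℕ) : ℝ)) = 1 := by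
    intro i
    apply clamp01_of_one_le
    have h1 : ((1 : unitInterval) : ℝ) = 1 := rfl
    have h2 : ((i : ℕ) : ℝ) + 1 ≤ (N : ℝ) := by
      exact_mod_cast Nat.succ_le_of_lt i.isLt
    rw [h1, mul_one]; linarith
  simp only [h, one_smul]

/-- Piecewise linear element of `Ω(x)` with increments `v`. -/
def pwLin1 {d : ℕ} (x : Ed d) (N : ℕ) (v : Fin N → Ed d) : Omega1 x :=
  ⟨pwLinE x N v, pwLinE_zero x N v⟩

/-- Piecewise linear element of `Ω(x,y)` with increments `v` summing to `y - x`. -/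
def pwLin2 {d : ℕ} (x y : Ed d) (N : ℕ) (v : Fin N → Ed d)
    (h : x + ∑ i : Fin N, v i = y) : Omega2 x y :=
  ⟨pwLinE x N v, pwLinE_zero x N v, by rw [pwLinE_one, h]⟩

/-- the point preceding `x_i` in the list `x, x_1, …, x_N`. -/
def prevPt {d : ℕ} (x : Ed d) {N : ℕ} (xs : Fin N → Ed d) (i : Fin N) : Ed d :=
  if (i : ℕ) = 0 then x else xs ⟨(i : ℕ) - 1, lt_of_le_of_lt (Nat.pred_le _) i.isLt⟩

/-- The discrete measure `W_{x,a,N}`, i.e. the measure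
`∏_{i=1}^N (2πa²)^{-d/2} exp(-|x_i - x_{i-1}|²/(2a²)) dx_1 … dx_N` (with `x_0 = x`)
on `N`-step piecewise linear paths, placed on `{a²N} × Ω(x) ⊆ ℝ × Ω(x)`.
For `N = 0` this is the Dirac measure at `(0, constant path at x)`. -/
def WxaN {d : ℕ} (x : Ed d) (a : ℝ) (N : ℕ) : Measure (ℝ × Omega1 x) :=
  Measure.map
    (fun xs : Fin N → Ed d =>
      ((a ^ 2 * N : ℝ), pwLin1 x N fun i => xs i - prevPt x xs i))
    (volume.withDensity fun xs : Fin N → Ed d =>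
      ENNReal.ofReal (∏ i : Fin N,
        (2 * π * a ^ 2) ^ (-(d : ℝ) / 2) *
          Real.exp (-‖xs i - prevPt x xs i‖ ^ 2 / (2 * a ^ 2))))

/-- The approximating probability measure
`W_{x,a} = (1 - e^{-m²a²/2}) Σ_{N=0}^∞ e^{-m²a²N/2} W_{x,a,N}`. -/
def Wxa {d : ℕ} (x : Ed d) (m a : ℝ) : Measure (ℝ × Omega1 x) :=
  ENNReal.ofReal (1 - Real.exp (-m ^ 2 * a ^ 2 / 2)) •
    Measure.sum fun N : ℕ =>
      ENNReal.ofReal (Real.exp (-m ^ 2 * a ^ 2 * N / 2)) • WxaN x a N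

/-- The lattice step of length `a` in direction `p.1`, forwards or backwards
according to `p.2`. -/
def stepVec {d : ℕ} (a : ℝ) (p : Fin d × Bool) : Ed d :=
  (if p.2 then a else -a) • EuclideanSpace.single p.1 (1 : ℝ)

/-- The normalized counting measure `V'_{x,a,N}` giving mass `(2d)^{-N}` to each
(piecewise linearly parametrized) `N`-step nearest-neighbour lattice path in `x + aℤ^d`
starting at `x`.  For `N = 0` it is the Dirac measure at the constant path. -/
def VxaN {d : ℕ} (x : Ed d) (a : ℝ) (N : ℕ) : Measure (Omega1 x) :=
  Measure.sum fun s : Fin N → Fin d × Bool =>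
    (((2 * d : ℕ) : ℝ≥0∞) ^ N)⁻¹ •
      Measure.dirac (pwLin1 x N fun i => stepVec a (s i))

/-- The approximating probability measure
`V'_{x,a} = (1 - e^{-m²a²/(2d)}) Σ_{N=0}^∞ e^{-m²a²N/(2d)} V'_{x,a,N}`. -/
def Vxa {d : ℕ} (x : Ed d) (m a : ℝ) : Measure (Omega1 x) :=
  ENNReal.ofReal (1 - Real.exp (-m ^ 2 * a ^ 2 / (2 * d))) •
    Measure.sum fun N : ℕ =>
      ENNReal.ofReal (Real.exp (-m ^ 2 * a ^ 2 * N / (2 * d))) • VxaN x a N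

/-- `Wt` is the family of Wiener measures `(W_x^t)_{t>0}` on `Ω(x)`:
each `W_x^t` is a Borel probability measure, characterized by the characteristic
functions of its finite dimensional distributions
`∫ exp(i Σ_j ξ_j·ω(t_j)) dW_x^t = exp(-(t/2) Σ_j (t_j - t_{j-1}) |ξ_j + ⋯ + ξ_n|²
+ i x·(ξ_1 + ⋯ + ξ_n))` for all `0 = t_0 < t_1 < ⋯ < t_n ≤ 1`. -/
def IsWienerFamily {d : ℕ} (x : Ed d) (Wt : ℝ → Measure (Omega1 x)) : Prop :=
  ∀ t : ℝ, 0 < t → (IsProbabilityMeasure (Wt t) ∧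
    ∀ (n : ℕ) (ts : ℕ → ℝ), ts 0 = 0 → (∀ i < n, ts i < ts (i + 1)) → ts n ≤ 1 →
      ∀ ξ : Fin n → Ed d,
        (∫ ω : Omega1 x, Complex.exp (Complex.I *
            ((∑ i : Fin n, ⟪ξ i, evalAt ω.1 (ts ((i : ℕ) + 1))⟫ : ℝ) : ℂ)) ∂(Wt t))
          = Complex.exp
              (((-(t / 2) * ∑ i : Fin n,
                  (ts ((i : ℕ) + 1) - ts (i : ℕ)) * ‖∑ j ∈ Finset.Ici i, ξ j‖ ^ 2 : ℝ) : ℂ)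
                + Complex.I * ((⟪∑ j, ξ j, x⟫ : ℝ) : ℂ)))


/-- the sequence of points `x, vs 0, …, vs (N-1), y` (with value `y` from index `N+1` on). -/
def pinPts {d : ℕ} (x y : Ed d) {N : ℕ} (vs : Fin N → Ed d) (j : ℕ) : Ed d :=
  if h0 : j = 0 then x else if h : j ≤ N then vs ⟨j - 1, by omega⟩ else y

lemma pinPts_zero {d : ℕ} (x y : Ed d) {N : ℕ} (vs : Fin N → Ed d) :
    pinPts x y vs 0 = x := by simp [pinPts]

lemma pinPts_last {d : ℕ} (x y : Ed d) {N : ℕ} (vs : Fin N → Ed d) :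
    pinPts x y vs (N + 1) = y := by
  have h1 : ¬(N + 1 = 0) := Nat.succ_ne_zero N
  have h2 : ¬(N + 1 ≤ N) := by omega
  simp [pinPts, h1, h2]

lemma pin_telescope {d : ℕ} (x y : Ed d) {N : ℕ} (vs : Fin N → Ed d) :
    x + ∑ i : Fin (N + 1), (pinPts x y vs ((i : ℕ) + 1) - pinPts x y vs (i : ℕ)) = y := by
  rw [Fin.sum_univ_eq_sum_range (fun j => pinPts x y vs (j + 1) - pinPts x y vs j) (N + 1)]
  rw [Finset.sum_range_sub (fun j => pinPts x y vs j) (N + 1)]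
  rw [pinPts_zero, pinPts_last]
  abel

/-- The discrete measure `W_{x,y,a,N+1}`, i.e. the measure
`∏_{i=1}^{N+1} (2πa²)^{-d/2} exp(-|x_i - x_{i-1}|²/(2a²)) dx_1 … dx_N`
(with `x_0 = x`, `x_{N+1} = y`) on `(N+1)`-step piecewise linear paths from `x` to `y`,
placed on `{a²(N+1)} × Ω(x,y) ⊆ ℝ × Ω(x,y)`.  For `N = 0` this is the point mass of
weight `(2πa²)^{-d/2} e^{-|x-y|²/(2a²)}` at `(a², linear path from x to y)`. -/
def WxyaN {d : ℕ} (x y : Ed d) (a : ℝ) (N : ℕ) : Measure (ℝ × Omega2 x y) :=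
  Measure.map
    (fun vs : Fin N → Ed d =>
      ((a ^ 2 * (N + 1) : ℝ),
        pwLin2 x y (N + 1) (fun i => pinPts x y vs ((i : ℕ) + 1) - pinPts x y vs (i : ℕ))
          (pin_telescope x y vs)))
    (volume.withDensity fun vs : Fin N → Ed d =>
      ENNReal.ofReal (∏ i : Fin (N + 1),
        (2 * π * a ^ 2) ^ (-(d : ℝ) / 2) *
          Real.exp (-‖pinPts x y vs ((i : ℕ) + 1) - pinPts x y vs (i : ℕ)‖ ^ 2 /
            (2 * a ^ 2))))

/-- The approximating measure
`W_{x,y,a} = (1 - e^{-m²a²/2}) Σ_{N=1}^∞ e^{-m²a²N/2} W_{x,y,a,N}`. -/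
def Wxya {d : ℕ} (x y : Ed d) (m a : ℝ) : Measure (ℝ × Omega2 x y) :=
  ENNReal.ofReal (1 - Real.exp (-m ^ 2 * a ^ 2 / 2)) •
    Measure.sum fun N : ℕ =>
      ENNReal.ofReal (Real.exp (-m ^ 2 * a ^ 2 * (N + 1) / 2)) • WxyaN x y a N

/-- The measure `V'_{x,y,a,N}` giving mass `a^{-d} (2d)^{-N}` to each
(piecewise linearly parametrized) `N`-step nearest-neighbour lattice path
in `x + aℤ^d` from `x` to `y`. -/
def VxyaN {d : ℕ} (x y : Ed d) (a : ℝ) (N : ℕ) : Measure (Omega2 x y) :=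
  Measure.sum fun s : {s : Fin N → Fin d × Bool // x + ∑ i, stepVec a (s i) = y} =>
    (ENNReal.ofReal (a ^ (-(d : ℝ))) * (((2 * d : ℕ) : ℝ≥0∞) ^ N)⁻¹) •
      Measure.dirac (pwLin2 x y N (fun i => stepVec a (s.1 i)) s.2)

/-- The approximating measure
`V'_{x,y,a} = (1 - e^{-m²a²/(2d)}) Σ_{N=1}^∞ e^{-m²a²N/(2d)} V'_{x,y,a,N}`. -/
def Vxya {d : ℕ} (x y : Ed d) (m a : ℝ) : Measure (Omega2 x y) :=
  ENNReal.ofReal (1 - Real.exp (-m ^ 2 * a ^ 2 / (2 * d))) •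
    Measure.sum fun N : ℕ =>
      ENNReal.ofReal (Real.exp (-m ^ 2 * a ^ 2 * (N + 1) / (2 * d))) • VxyaN x y a (N + 1)

/-- `Wt` is the family of pinned Wiener measures `(W_{x,y}^t)_{t>0}` on `Ω(x,y)`:
finite Borel measures characterized by the characteristic functions of their finite
dimensional distributions: for `0 = t_0 < t_1 < ⋯ < t_n < 1`, with `η_i = ξ_i + ⋯ + ξ_n`,
`∫ exp(i Σ_j ξ_j·ω(t_j)) dW_{x,y}^t = (2πt)^{-d/2} e^{-|x-y|²/(2t)} ·
exp(-(t/2)(Σ_j (t_j - t_{j-1})|η_j|² - |Σ_j t_j ξ_j|²) + i Σ_j ((1-t_j)x + t_j y)·ξ_j)`;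
in particular (`n = 0`) the total mass is the heat kernel `(2πt)^{-d/2} e^{-|x-y|²/(2t)}`. -/
def IsPinnedWienerFamily {d : ℕ} (x y : Ed d) (Wt : ℝ → Measure (Omega2 x y)) : Prop :=
  ∀ t : ℝ, 0 < t → (IsFiniteMeasure (Wt t) ∧
    ∀ (n : ℕ) (ts : ℕ → ℝ), ts 0 = 0 → (∀ i < n, ts i < ts (i + 1)) → ts n < 1 →
      ∀ ξ : Fin n → Ed d,
        (∫ ω : Omega2 x y, Complex.exp (Complex.I *
            ((∑ i : Fin n, ⟪ξ i, evalAt ω.1 (ts ((i : ℕ) + 1))⟫ : ℝ) : ℂ)) ∂(Wt t))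
          = (((2 * π * t) ^ (-(d : ℝ) / 2) * Real.exp (-‖x - y‖ ^ 2 / (2 * t)) : ℝ) : ℂ) *
            Complex.exp
              (((-(t / 2) *
                  ((∑ i : Fin n,
                      (ts ((i : ℕ) + 1) - ts (i : ℕ)) * ‖∑ j ∈ Finset.Ici i, ξ j‖ ^ 2)
                    - ‖∑ i : Fin n, ts ((i : ℕ) + 1) • ξ i‖ ^ 2) : ℝ) : ℂ)
                + Complex.I *
                  ((∑ i : Fin n,
                    ⟪ξ i, (1 - ts ((i : ℕ) + 1)) • x + ts ((i : ℕ) + 1) • y⟫ : ℝ) : ℂ)))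

/-- The reparametrization pseudo-distance
`d̄(ω,ω') = inf { d(ω, ω'∘φ) : φ an increasing homeomorphism of [0,1] }`. -/
def quotDist {d : ℕ} (ω ω' : PathSp d) : ℝ :=
  ⨅ φ : {φ : unitInterval ≃ₜ unitInterval // Monotone ⇑φ},
    dist ω (ω'.comp ⟨⇑φ.1, φ.1.continuous⟩)

open scoped Classical in
/-- The escape time `sup {t ∈ [t₀,1] : f([t₀,t]) ⊆ A}`, with the convention
`sup ∅ = 1`. -/
def escTime {d : ℕ} (f : ℝ → Ed d) (A : Set (Ed d)) (t0 : ℝ) : ℝ :=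
  if ({t | t ∈ Set.Icc t0 1 ∧ ∀ u ∈ Set.Icc t0 t, f u ∈ A}).Nonempty then
    sSup {t | t ∈ Set.Icc t0 1 ∧ ∀ u ∈ Set.Icc t0 t, f u ∈ A}
  else 1

/-- The sequence of successive escape times `τ_0 = 0`,
`τ_{i+1} = sup {t ≥ τ_i : f([τ_i,t]) ⊆ A_{i+1}}` (`A` being indexed from `0` here). -/
def tauSeq {d : ℕ} (f : ℝ → Ed d) (A : ℕ → Set (Ed d)) : ℕ → ℝ
  | 0 => 0
  | i + 1 => escTime f (A i) (tauSeq f A i)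

/-- The defining property of `Z(A_1,…,A_n)` for a parametrized path `ω`:
the successive escape times satisfy `τ_1 < τ_2 < ⋯ < τ_{n-1} < τ_n = 1`. -/
def ZcondPath {d : ℕ} {x y : Ed d} (ω : Omega2 x y) {n : ℕ}
    (A : Fin n → Set (Ed d)) : Prop :=
  (∀ i : ℕ, 1 ≤ i → i < n →
      tauSeq (evalAt ω.1) (fun j => if h : j < n then A ⟨j, h⟩ else ∅) i <
        tauSeq (evalAt ω.1) (fun j => if h : j < n then A ⟨j, h⟩ else ∅) (i + 1))
    ∧ tauSeq (evalAt ω.1) (fun j => if h : j < n then A ⟨j, h⟩ else ∅) n = 1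

/-- The set `Z(A_1,…,A_n)` of geometric (unparametrized) paths from `x` to `y`,
as a subset of the quotient space realized by `pr : Ω(x,y) → Q`. -/
def Zset {d : ℕ} {x y : Ed d} {Q : Type*} (pr : Omega2 x y → Q) {n : ℕ}
    (A : Fin n → Set (Ed d)) : Set Q :=
  {q | ∃ ω : Omega2 x y, pr ω = q ∧ ZcondPath ω A}

section EscapeTimes

variable {d : ℕ}

lemma continuous_evalAt_uncurry : Continuous fun p : PathSp d × ℝ => evalAt p.1 p.2 := by
  unfold evalAt
  exact continuous_eval.comp
    (continuous_fst.prodMk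
      ((continuous_projIcc (a := (0 : ℝ)) (b := 1) (h := zero_le_one)).comp continuous_snd))

lemma continuous_evalAt (ω : PathSp d) : Continuous (evalAt ω) :=
  continuous_evalAt_uncurry.comp (Continuous.prodMk_right ω)

lemma evalAt_coe (ω : PathSp d) (t : unitInterval) : evalAt ω t = ω t := by
  simp [evalAt]

lemma escTime_le_one (f : ℝ → Ed d) (A : Set (Ed d)) (s : ℝ) : escTime f A s ≤ 1 := by
  unfold escTime
  split_ifs with h
  · exact csSup_le h fun t ht => ht.1.2
  · exact le_rfl

lemma bddAbove_escTime_set (f : ℝ → Ed d) (A : Set (Ed d)) (s : ℝ) :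
    BddAbove {t | t ∈ Set.Icc s 1 ∧ ∀ u ∈ Set.Icc s t, f u ∈ A} :=
  ⟨1, fun _ ht => ht.1.2⟩

lemma escTime_of_notMem {f : ℝ → Ed d} {A : Set (Ed d)} {s : ℝ} (h : f s ∉ A) :
    escTime f A s = 1 := by
  unfold escTime
  rw [if_neg]
  rintro ⟨t, ht, hu⟩
  exact h (hu s ⟨le_rfl, ht.1⟩)

lemma escTime_eq_sSup {f : ℝ → Ed d} {A : Set (Ed d)} {s : ℝ} (hs : s ≤ 1) (h : f s ∈ A) :
    escTime f A s = sSup {t | t ∈ Set.Icc s 1 ∧ ∀ u ∈ Set.Icc s t, f u ∈ A} := by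
  unfold escTime
  rw [if_pos]
  exact ⟨s, ⟨le_rfl, hs⟩, fun u hu => by rwa [le_antisymm hu.2 hu.1]⟩

lemma le_escTime_of_forall_mem {f : ℝ → Ed d} {A : Set (Ed d)} {s t : ℝ} (hst : s ≤ t)
    (ht : t ≤ 1) (h : ∀ u ∈ Set.Icc s t, f u ∈ A) : t ≤ escTime f A s := by
  rw [escTime_eq_sSup (hst.trans ht) (h s ⟨le_rfl, hst⟩)]
  exact le_csSup (bddAbove_escTime_set f A s) ⟨⟨hst, ht⟩, h⟩

lemma le_escTime {f : ℝ → Ed d} {A : Set (Ed d)} {s : ℝ} (hs : s ≤ 1) :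
    s ≤ escTime f A s := by
  by_cases h : f s ∈ A
  · exact le_escTime_of_forall_mem le_rfl hs fun u hu => by rwa [le_antisymm hu.2 hu.1]
  · rwa [escTime_of_notMem h]

lemma mem_of_lt_escTime {f : ℝ → Ed d} {A : Set (Ed d)} {s u : ℝ} (hs : s ≤ 1) (h : f s ∈ A)
    (hu : s ≤ u) (hu' : u < escTime f A s) : f u ∈ A := by
  rw [escTime_eq_sSup hs h] at hu'
  have hne : ({t | t ∈ Set.Icc s 1 ∧ ∀ u ∈ Set.Icc s t, f u ∈ A}).Nonempty :=
    ⟨s, ⟨le_rfl, hs⟩, fun u hu => by rwa [le_antisymm hu.2 hu.1]⟩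
  obtain ⟨t, ht, hut⟩ := exists_lt_of_lt_csSup hne hu'
  exact ht.2 u ⟨hu, hut.le⟩

lemma escTime_le_of_notMem {f : ℝ → Ed d} {A : Set (Ed d)} {s u : ℝ} (hs : s ≤ 1) (h : f s ∈ A)
    (hu : s ≤ u) (hfu : f u ∉ A) : escTime f A s ≤ u := by
  by_contra! hlt
  exact hfu (mem_of_lt_escTime hs h hu hlt)

lemma mem_of_escTime_lt_one {f : ℝ → Ed d} {A : Set (Ed d)} {s : ℝ}
    (h : escTime f A s < 1) : f s ∈ A := by
  by_contra hs
  rw [escTime_of_notMem hs] at h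
  exact lt_irrefl _ h

lemma notMem_escTime {f : ℝ → Ed d} (hf : Continuous f) {A : Set (Ed d)} (hA : IsOpen A) {s : ℝ}
    (hs : s ≤ 1) (h : escTime f A s < 1) : f (escTime f A s) ∉ A := by
  intro hmem
  have hsA := mem_of_escTime_lt_one h
  set T := escTime f A s with hT
  obtain ⟨δ, hδ, hball⟩ := Metric.isOpen_iff.1 (hA.preimage hf) T hmem
  set t := min (T + δ / 2) 1 with ht
  have hTt : T < t := lt_min (by linarith) h
  have : t ≤ T := by
    refine le_escTime_of_forall_mem ((le_escTime hs).trans hTt.le) (min_le_right _ _) fun u hu => ?_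
    rcases lt_or_ge u T with hu' | hu'
    · exact mem_of_lt_escTime hs hsA hu.1 hu'
    · apply hball
      rw [Metric.mem_ball, Real.dist_eq, abs_of_nonneg (by linarith)]
      have := hu.2.trans (min_le_left _ _)
      linarith
  linarith

lemma lt_escTime {f : ℝ → Ed d} (hf : Continuous f) {A : Set (Ed d)} (hA : IsOpen A) {s : ℝ}
    (hs : s < 1) (h : f s ∈ A) : s < escTime f A s := by
  refine lt_of_le_of_ne (le_escTime hs.le) fun he => ?_
  have := notMem_escTime hf hA hs.le (he ▸ hs)
  rw [← he] at this
  exact this h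

lemma escTime_mem_closure {f : ℝ → Ed d} (hf : Continuous f) {A : Set (Ed d)} (hA : IsOpen A)
    {s : ℝ} (hs : s < 1) (h : f s ∈ A) : f (escTime f A s) ∈ closure A := by
  have hlt := lt_escTime hf hA hs h
  have h1 : escTime f A s ∈ closure (Set.Ico s (escTime f A s)) := by
    rw [closure_Ico hlt.ne]; exact ⟨hlt.le, le_rfl⟩
  exact closure_mono (Set.image_subset_iff.2 fun u hu => mem_of_lt_escTime hs.le h hu.1 hu.2)
    (image_closure_subset_closure_image hf ⟨_, h1, rfl⟩)

lemma tauSeq_mem_Icc (f : ℝ → Ed d) (A : ℕ → Set (Ed d)) (i : ℕ) :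
    tauSeq f A i ∈ Set.Icc (0 : ℝ) 1 := by
  induction i with
  | zero => exact ⟨le_rfl, zero_le_one⟩
  | succ i ih => exact ⟨ih.1.trans (le_escTime ih.2), escTime_le_one _ _ _⟩

lemma tauSeq_mono (f : ℝ → Ed d) (A : ℕ → Set (Ed d)) : Monotone (tauSeq f A) :=
  monotone_nat_of_le_succ fun i => le_escTime (tauSeq_mem_Icc f A i).2

end EscapeTimes

section Continuity

variable {d : ℕ} {x y : Ed d}

lemma eventually_evalAt_mem {A : Set (Ed d)} (hA : IsOpen A) {ω : Omega2 x y} {u : ℝ}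
    (h : evalAt ω.1 u ∈ A) {s : Omega2 x y → ℝ} (hs : Tendsto s (𝓝 ω) (𝓝 u)) :
    ∀ᶠ ω' in 𝓝 ω, evalAt ω'.1 (s ω') ∈ A := by
  have h1 : Tendsto (fun ω' : Omega2 x y => ((ω'.1, s ω') : PathSp d × ℝ)) (𝓝 ω)
      (𝓝 (ω.1, u)) :=
    (continuous_subtype_val.tendsto ω).prodMk_nhds hs
  exact ((continuous_evalAt_uncurry.tendsto _).comp h1) (hA.mem_nhds h)

lemma eventually_forall_evalAt_mem {A : Set (Ed d)} (hA : IsOpen A) {ω : Omega2 x y} {K : Set ℝ}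
    (hK : IsCompact K) (h : ∀ u ∈ K, evalAt ω.1 u ∈ A) :
    ∀ᶠ ω' : Omega2 x y in 𝓝 ω, ∀ u ∈ K, evalAt ω'.1 u ∈ A := by
  refine hK.eventually_forall_of_forall_eventually fun u hu => ?_
  have hc : Continuous fun p : Omega2 x y × ℝ => evalAt p.1.1 p.2 :=
    continuous_evalAt_uncurry.comp
      ((continuous_subtype_val.comp continuous_fst).prodMk continuous_snd)
  exact (hc.tendsto (ω, u)) (hA.mem_nhds (h u hu))

/-- The escape time from an open set depends continuously on the path, at paths leaving the closure
of the set immediately after the escape time. -/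
lemma tendsto_escTime {A : Set (Ed d)} (hA : IsOpen A) {ω : Omega2 x y} {s : Omega2 x y → ℝ}
    (hs : Tendsto s (𝓝 ω) (𝓝 (s ω))) (hs1 : ∀ ω', s ω' ≤ 1) (hlt : s ω < 1)
    (hmem : evalAt ω.1 (s ω) ∈ A)
    (hG : escTime (evalAt ω.1) A (s ω) < 1 → ∀ ε > 0,
      ∃ u ∈ Set.Ioo (escTime (evalAt ω.1) A (s ω)) (escTime (evalAt ω.1) A (s ω) + ε),
        evalAt ω.1 u ∉ closure A) :
    Tendsto (fun ω' : Omega2 x y => escTime (evalAt ω'.1) A (s ω')) (𝓝 ω)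
      (𝓝 (escTime (evalAt ω.1) A (s ω))) := by
  set T := escTime (evalAt ω.1) A (s ω) with hT
  have hTgt : s ω < T := lt_escTime (continuous_evalAt _) hA hlt hmem
  refine tendsto_order.2 ⟨fun b hb => ?_, fun b hb => ?_⟩
  · obtain ⟨b', hb1, hb2⟩ := exists_between (max_lt hb hTgt)
    obtain ⟨δ, hδ, hball⟩ :=
      Metric.isOpen_iff.1 (hA.preimage (continuous_evalAt ω.1)) (s ω) hmem
    have hK : ∀ u ∈ Set.Icc (s ω - δ / 2) b', evalAt ω.1 u ∈ A := by
      intro u hu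
      rcases lt_or_ge u (s ω) with h | h
      · apply hball
        rw [Metric.mem_ball, Real.dist_eq, abs_of_nonpos (by linarith)]
        linarith [hu.1]
      · exact mem_of_lt_escTime hlt.le hmem h (hu.2.trans_lt hb2)
    filter_upwards [eventually_forall_evalAt_mem hA isCompact_Icc hK,
      hs (Ioi_mem_nhds (show s ω - δ / 2 < s ω by linarith)),
      hs (Iio_mem_nhds ((le_max_right _ _).trans_lt hb1))] with ω' h1 h2 h3
    refine ((le_max_left _ _).trans_lt hb1).trans_le
      (le_escTime_of_forall_mem (le_of_lt h3) (hb2.le.trans (escTime_le_one _ _ _))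
        fun u hu => h1 u ⟨(le_of_lt h2).trans hu.1, hu.2⟩)
  · rcases (escTime_le_one (evalAt ω.1) A (s ω)).lt_or_eq with h1 | h1
    · obtain ⟨u, hu, hfu⟩ := hG h1 (b - T) (by linarith)
      have hu2 : u < b := by linarith [hu.2]
      filter_upwards [eventually_evalAt_mem (isClosed_closure (s := A)).isOpen_compl hfu
        (tendsto_const_nhds (x := u)), eventually_evalAt_mem hA hmem hs,
        hs (Iio_mem_nhds (hTgt.trans hu.1))] with ω' h2 h3 h4
      exact (escTime_le_of_notMem (hs1 ω') h3 (le_of_lt h4)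
        fun h => h2 (subset_closure h)).trans_lt hu2
    · filter_upwards with ω'
      exact (escTime_le_one _ _ _).trans_lt (by rw [hT, h1] at hb; exact hb)

end Continuity

section LocallyConstant

variable {d n : ℕ} {x y : Ed d}

/-- Extension of a finite family of sets to all natural numbers by empty sets. -/
def extFam (A : Fin n → Set (Ed d)) (j : ℕ) : Set (Ed d) := if h : j < n then A ⟨j, h⟩ else ∅

lemma isOpen_extFam {A : Fin n → Set (Ed d)} (hA : ∀ i, IsOpen (A i)) (j : ℕ) :
    IsOpen (extFam A j) := by
  unfold extFam
  split_ifs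
  · exact hA _
  · exact isOpen_empty

/-- A path is regular for the family `A` if, whenever it escapes from some `A i`, it leaves
`closure (A i)` immediately afterwards and does so away from the frontiers of the other sets. -/
def RegularPath (f : ℝ → Ed d) (A : Fin n → Set (Ed d)) : Prop :=
  ∀ (i : Fin n) (s τ : ℝ), 0 < s → s < τ → τ < 1 → (∀ u ∈ Set.Ico s τ, f u ∈ A i) →
    f τ ∉ A i →
      (∀ ε > 0, ∃ u ∈ Set.Ioo τ (τ + ε), f u ∉ closure (A i)) ∧
        ∀ j, j ≠ i → f τ ∉ frontier (A j)

/-- All of the first `i + 1` sets have been entered strictly before time one. -/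
def AliveAt (ω : Omega2 x y) (A : Fin n → Set (Ed d)) (i : ℕ) : Prop :=
  ∀ j ≤ i, tauSeq (evalAt ω.1) (extFam A) j < 1 ∧
    evalAt ω.1 (tauSeq (evalAt ω.1) (extFam A) j) ∈ extFam A j

lemma AliveAt.lt_succ {A : Fin n → Set (Ed d)} (hA : ∀ i, IsOpen (A i)) {ω : Omega2 x y} {i j : ℕ}
    (h : AliveAt ω A i) (hj : j ≤ i) :
    tauSeq (evalAt ω.1) (extFam A) j < tauSeq (evalAt ω.1) (extFam A) (j + 1) :=
  lt_escTime (continuous_evalAt _) (isOpen_extFam hA j) (h j hj).1 (h j hj).2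

lemma AliveAt.lt {A : Fin n → Set (Ed d)} {ω : Omega2 x y} {i : ℕ} (h : AliveAt ω A i) : i < n := by
  by_contra hn
  have := (h i le_rfl).2
  simp [extFam, hn] at this

lemma RegularPath.escape {A : Fin n → Set (Ed d)} (hA : ∀ i, IsOpen (A i)) {ω : Omega2 x y} {i : ℕ}
    (hω : RegularPath (evalAt ω.1) A) (h : AliveAt ω A i)
    (hlt : tauSeq (evalAt ω.1) (extFam A) (i + 1) < 1) :
    (∀ ε > 0, ∃ u ∈ Set.Ioo (tauSeq (evalAt ω.1) (extFam A) (i + 1))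
        (tauSeq (evalAt ω.1) (extFam A) (i + 1) + ε), evalAt ω.1 u ∉ closure (extFam A i)) ∧
      ∀ j : ℕ, j ≠ i →
        evalAt ω.1 (tauSeq (evalAt ω.1) (extFam A) (i + 1)) ∉ frontier (extFam A j) := by
  have hi := h.lt
  have hlt' := h.lt_succ hA le_rfl
  have hB : extFam A i = A ⟨i, hi⟩ := by simp [extFam, hi]
  have h0 := (tauSeq_mem_Icc (evalAt ω.1) (extFam A) i).1
  obtain ⟨s, hs1, hs2⟩ := exists_between hlt'
  obtain ⟨h1, h2⟩ := hω ⟨i, hi⟩ s _ (h0.trans_lt hs1) hs2 hlt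
    (fun u hu => hB ▸ mem_of_lt_escTime (h i le_rfl).1.le (h i le_rfl).2 (hs1.le.trans hu.1) hu.2)
    (hB ▸ notMem_escTime (continuous_evalAt _) (isOpen_extFam hA i) (h i le_rfl).1.le hlt)
  refine ⟨hB ▸ h1, fun j hj => ?_⟩
  by_cases hjn : j < n
  · have := h2 ⟨j, hjn⟩ (by simpa using hj)
    simpa [extFam, hjn] using this
  · simp [extFam, hjn]

lemma tendsto_tauSeq {A : Fin n → Set (Ed d)} (hA : ∀ i, IsOpen (A i)) {ω : Omega2 x y}
    (hω : RegularPath (evalAt ω.1) A) {i : ℕ} (h : AliveAt ω A i) (j : ℕ) (hj : j ≤ i + 1) :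
    Tendsto (fun ω' : Omega2 x y => tauSeq (evalAt ω'.1) (extFam A) j) (𝓝 ω)
      (𝓝 (tauSeq (evalAt ω.1) (extFam A) j)) := by
  induction j with
  | zero => exact tendsto_const_nhds
  | succ j ih =>
    have hj' : j ≤ i := by omega
    refine tendsto_escTime (isOpen_extFam hA j)
      (s := fun ω' : Omega2 x y => tauSeq (evalAt ω'.1) (extFam A) j)
      (ih (by omega)) (fun ω' => (tauSeq_mem_Icc _ _ _).2) (h j hj').1 (h j hj').2 fun hlt => ?_
    exact (hω.escape hA (fun k hk => h k (hk.trans hj')) hlt).1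

lemma eventually_aliveAt {A : Fin n → Set (Ed d)} (hA : ∀ i, IsOpen (A i)) {ω : Omega2 x y}
    (hω : RegularPath (evalAt ω.1) A) {i : ℕ} (h : AliveAt ω A i) :
    ∀ᶠ ω' in 𝓝 ω, AliveAt ω' A i := by
  have : ∀ j ∈ Finset.range (i + 1), ∀ᶠ ω' : Omega2 x y in 𝓝 ω,
      tauSeq (evalAt ω'.1) (extFam A) j < 1 ∧
        evalAt ω'.1 (tauSeq (evalAt ω'.1) (extFam A) j) ∈ extFam A j := by
    intro j hj
    have hj' : j ≤ i := by simpa [Nat.lt_succ_iff] using hj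
    have ht := tendsto_tauSeq hA hω h j (by omega)
    exact (ht.eventually_lt_const (h j hj').1).and
      (eventually_evalAt_mem (isOpen_extFam hA j) (h j hj').2 ht)
  filter_upwards [(Finset.eventually_all _).2 this] with ω' h' j hj
  exact h' j (by simpa [Nat.lt_succ_iff] using hj)

lemma zcondPath_iff_of_aliveAt {A : Fin n → Set (Ed d)} (hA : ∀ i, IsOpen (A i)) {ω : Omega2 x y}
    (h : AliveAt ω A (n - 1)) : ZcondPath ω A ↔ tauSeq (evalAt ω.1) (extFam A) n = 1 :=
  ⟨fun hz => hz.2, fun h1 => ⟨fun _ _ hi => h.lt_succ hA (by omega), h1⟩⟩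

lemma ZcondPath.mem_closure {A : Fin n → Set (Ed d)} (hA : ∀ i, IsOpen (A i)) (hn : 2 ≤ n)
    {ω : Omega2 x y} (hx : x ∈ A ⟨0, by omega⟩) (h : ZcondPath ω A) :
    evalAt ω.1 (tauSeq (evalAt ω.1) (extFam A) (n - 1)) ∈ closure (A ⟨n - 2, by omega⟩) := by
  obtain ⟨k, rfl⟩ : ∃ k, n = k + 2 := ⟨n - 2, by omega⟩
  have hlt : tauSeq (evalAt ω.1) (extFam A) (k + 1) < 1 :=
    (h.1 (k + 1) (by omega) (by omega)).trans_le (tauSeq_mem_Icc _ _ _).2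
  have hB : extFam A k = A ⟨k, by omega⟩ := by simp [extFam]
  have hk : tauSeq (evalAt ω.1) (extFam A) k < 1 := (tauSeq_mono _ _ (Nat.le_succ k)).trans_lt hlt
  have := escTime_mem_closure (continuous_evalAt ω.1) (isOpen_extFam hA k) hk
    (mem_of_escTime_lt_one hlt)
  rw [hB] at this
  simpa [tauSeq, hB] using this

/-- Membership in the cylinder set is locally constant at regular paths. -/
theorem eventually_zcondPath_iff {A : Fin n → Set (Ed d)} (hA : ∀ i, IsOpen (A i)) (hn : 2 ≤ n)
    (hx : x ∈ A ⟨0, by omega⟩) (hy : y ∈ A ⟨n - 1, by omega⟩ \ closure (A ⟨n - 2, by omega⟩))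
    {ω : Omega2 x y} (hω : RegularPath (evalAt ω.1) A) :
    ∀ᶠ ω' in 𝓝 ω, (ZcondPath ω' A ↔ ZcondPath ω A) := by
  classical
  have hev1 : ∀ ω' : Omega2 x y, evalAt ω'.1 1 = y := fun ω' => by
    have := evalAt_coe ω'.1 1
    rw [ω'.2.2] at this
    simpa using this
  have h0 : AliveAt ω A 0 := by
    intro j hj
    obtain rfl : j = 0 := by omega
    refine ⟨zero_lt_one, ?_⟩
    have h := evalAt_coe ω.1 0
    rw [ω.2.1] at h
    have h' : evalAt ω.1 0 = x := by simpa using h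
    have h0n : 0 < n := by omega
    simpa [tauSeq, h', extFam, h0n] using hx
  by_cases hlast : AliveAt ω A (n - 1)
  · have hz := zcondPath_iff_of_aliveAt hA hlast
    have hev := eventually_aliveAt hA hω hlast
    have hn1 : n - 1 + 1 = n := by omega
    by_cases h1 : tauSeq (evalAt ω.1) (extFam A) n = 1
    · have hB : extFam A (n - 1) = A ⟨n - 1, by omega⟩ := by
        unfold extFam; rw [dif_pos (by omega)]
      obtain ⟨hlt, hmem⟩ := hlast (n - 1) le_rfl
      set τ := tauSeq (evalAt ω.1) (extFam A) (n - 1) with hτ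
      have h1' : escTime (evalAt ω.1) (extFam A (n - 1)) τ = 1 := by
        have h2 : tauSeq (evalAt ω.1) (extFam A) (n - 1 + 1) = 1 := by rw [hn1, h1]
        exact h2
      obtain ⟨δ, hδ, hball⟩ := Metric.isOpen_iff.1
        ((isOpen_extFam hA (n - 1)).preimage (continuous_evalAt ω.1)) τ hmem
      have hK : ∀ u ∈ Set.Icc (τ - δ / 2) 1, evalAt ω.1 u ∈ extFam A (n - 1) := by
        intro u hu
        rcases lt_or_ge u τ with h | h
        · apply hball
          rw [Metric.mem_ball, Real.dist_eq, abs_of_nonpos (by linarith)]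
          linarith [hu.1]
        · rcases hu.2.lt_or_eq with h' | h'
          · exact mem_of_lt_escTime hlt.le hmem h (by rw [h1']; exact h')
          · rw [h', hev1, hB]; exact hy.1
      filter_upwards [hev, eventually_forall_evalAt_mem (isOpen_extFam hA _) isCompact_Icc hK,
        tendsto_tauSeq hA hω hlast (n - 1) (by omega)
          (Ioi_mem_nhds (show τ - δ / 2 < τ by linarith))] with ω' ha hK' hτ'
      rw [zcondPath_iff_of_aliveAt hA ha, hz]
      refine iff_of_true (le_antisymm (tauSeq_mem_Icc _ _ _).2 ?_) h1
      have h2 : (1 : ℝ) ≤ tauSeq (evalAt ω'.1) (extFam A) (n - 1 + 1) :=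
        le_escTime_of_forall_mem (tauSeq_mem_Icc _ _ _).2 le_rfl
          fun u hu => hK' u ⟨(le_of_lt hτ').trans hu.1, hu.2⟩
      rwa [hn1] at h2
    · have hlt := lt_of_le_of_ne (tauSeq_mem_Icc (evalAt ω.1) (extFam A) n).2 h1
      filter_upwards [hev, tendsto_tauSeq hA hω hlast n (by omega) (Iio_mem_nhds hlt)]
        with ω' ha hτ'
      rw [zcondPath_iff_of_aliveAt hA ha, hz]
      exact iff_of_false (ne_of_lt hτ') h1
  · have hex : ∃ i, ¬ AliveAt ω A i := ⟨_, hlast⟩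
    obtain ⟨i, hi⟩ : ∃ i, Nat.find hex = i + 1 := by
      refine Nat.exists_eq_succ_of_ne_zero fun h => ?_
      exact Nat.find_spec hex (h ▸ h0)
    have hle : i + 1 ≤ n - 1 := hi ▸ Nat.find_min' hex hlast
    have hai : AliveAt ω A i := by
      by_contra h
      have := Nat.find_min' hex h
      omega
    have hnot : ¬ (tauSeq (evalAt ω.1) (extFam A) (i + 1) < 1 ∧
        evalAt ω.1 (tauSeq (evalAt ω.1) (extFam A) (i + 1)) ∈ extFam A (i + 1)) := by
      intro h
      apply Nat.find_spec hex
      rw [hi]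
      intro j hj
      rcases Nat.lt_or_ge j (i + 1) with h' | h'
      · exact hai j (by omega)
      · obtain rfl : j = i + 1 := by omega
        exact h
    have hai' := eventually_aliveAt hA hω hai
    have htau := tendsto_tauSeq hA hω hai (i + 1) le_rfl
    rcases (tauSeq_mem_Icc (evalAt ω.1) (extFam A) (i + 1)).2.lt_or_eq with hlt | h1
    · have hnm : evalAt ω.1 (tauSeq (evalAt ω.1) (extFam A) (i + 1)) ∉
          closure (extFam A (i + 1)) := by
        intro hc
        have hfr := (hω.escape hA hai hlt).2 (i + 1) (by omega)
        rw [(isOpen_extFam hA (i + 1)).frontier_eq] at hfr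
        exact hnot ⟨hlt, by_contra fun h => hfr ⟨hc, h⟩⟩
      have key : ∀ ω' : Omega2 x y, AliveAt ω' A i → tauSeq (evalAt ω'.1) (extFam A) (i + 1) < 1 →
          evalAt ω'.1 (tauSeq (evalAt ω'.1) (extFam A) (i + 1)) ∉ closure (extFam A (i + 1)) →
          (ZcondPath ω' A ↔ i + 2 = n) := by
        intro ω' ha hl hc
        have h2 : tauSeq (evalAt ω'.1) (extFam A) (i + 2) = 1 :=
          escTime_of_notMem fun h => hc (subset_closure h)
        constructor
        · intro hz
          by_contra hne
          have h3 := hz.1 (i + 2) (by omega) (by omega)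
          have h4 := (tauSeq_mem_Icc (evalAt ω'.1) (extFam A) (i + 2 + 1)).2
          change tauSeq (evalAt ω'.1) (extFam A) (i + 2) <
            tauSeq (evalAt ω'.1) (extFam A) (i + 2 + 1) at h3
          linarith
        · intro hin
          refine ⟨fun j hj1 hj2 => ?_, ?_⟩
          · rcases Nat.lt_or_ge j (i + 1) with h' | h'
            · exact ha.lt_succ hA (by omega)
            · obtain rfl : j = i + 1 := by omega
              exact hl.trans_eq h2.symm
          · exact (congrArg (tauSeq (evalAt ω'.1) (extFam A)) hin).symm.trans h2
      filter_upwards [hai', htau (Iio_mem_nhds hlt),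
        eventually_evalAt_mem isClosed_closure.isOpen_compl hnm htau] with ω' ha hl hc
      rw [key ω' ha hl hc, key ω hai hlt hnm]
    · have hnz : ¬ ZcondPath ω A := by
        intro hz
        have h3 := hz.1 (i + 1) (by omega) (by omega)
        have h4 := (tauSeq_mem_Icc (evalAt ω.1) (extFam A) (i + 1 + 1)).2
        change tauSeq (evalAt ω.1) (extFam A) (i + 1) <
          tauSeq (evalAt ω.1) (extFam A) (i + 1 + 1) at h3
        linarith
      have hyc : evalAt ω.1 1 ∈ (closure (A ⟨n - 2, by omega⟩))ᶜ := by rw [hev1]; exact hy.2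
      obtain ⟨δ, hδ, hball⟩ := Metric.isOpen_iff.1
        ((isClosed_closure (s := A ⟨n - 2, by omega⟩)).isOpen_compl.preimage
          (continuous_evalAt ω.1)) 1 hyc
      have hK : ∀ u ∈ Set.Icc (1 - δ / 2) 1,
          evalAt ω.1 u ∈ (closure (A ⟨n - 2, by omega⟩))ᶜ := by
        intro u hu
        apply hball
        rw [Metric.mem_ball, Real.dist_eq, abs_of_nonpos (by linarith [hu.2])]
        linarith [hu.1]
      filter_upwards [eventually_forall_evalAt_mem isClosed_closure.isOpen_compl isCompact_Icc hK,
        htau (Ioi_mem_nhds (show 1 - δ / 2 < _ by rw [h1]; linarith))] with ω' hK' hτ'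
      refine iff_of_false (fun hz => ?_) hnz
      exact hK' _ ⟨(le_of_lt hτ').trans (tauSeq_mono _ _ hle), (tauSeq_mem_Icc _ _ _).2⟩
        (hz.mem_closure hA hn hx)

end LocallyConstant

section Reparametrization

variable {d n : ℕ} {x y : Ed d}

/-- The extension to the real line of a self-map of the unit interval. -/
def extUnit (φ : unitInterval ≃ₜ unitInterval) (t : ℝ) : ℝ :=
  φ (Set.projIcc 0 1 zero_le_one t)

lemma continuous_extUnit (φ : unitInterval ≃ₜ unitInterval) : Continuous (extUnit φ) :=
  continuous_subtype_val.comp (φ.continuous.comp continuous_projIcc)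

lemma monotone_extUnit {φ : unitInterval ≃ₜ unitInterval} (hφ : Monotone φ) :
    Monotone (extUnit φ) := fun _ _ h => hφ (Set.monotone_projIcc _ h)

lemma extUnit_coe (φ : unitInterval ≃ₜ unitInterval) (t : unitInterval) :
    extUnit φ t = φ t := by simp [extUnit]

lemma extUnit_mem (φ : unitInterval ≃ₜ unitInterval) (t : ℝ) : extUnit φ t ∈ Set.Icc (0 : ℝ) 1 :=
  (φ _).2

lemma map_zero_of_monotone {φ : unitInterval ≃ₜ unitInterval} (hφ : Monotone φ) : φ 0 = 0 := by
  obtain ⟨t, ht⟩ := φ.surjective 0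
  have h : φ 0 ≤ φ t := hφ t.2.1
  rw [ht] at h
  exact le_antisymm h (φ 0).2.1

lemma map_one_of_monotone {φ : unitInterval ≃ₜ unitInterval} (hφ : Monotone φ) : φ 1 = 1 := by
  obtain ⟨t, ht⟩ := φ.surjective 1
  have h : φ t ≤ φ 1 := hφ t.2.2
  rw [ht] at h
  exact le_antisymm (φ 1).2.2 h

lemma lt_iff_of_monotone {φ : unitInterval ≃ₜ unitInterval} (hφ : Monotone φ)
    (s t : unitInterval) : φ s < φ t ↔ s < t :=
  (hφ.strictMono_of_injective φ.injective).lt_iff_lt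

lemma extUnit_lt_iff {φ : unitInterval ≃ₜ unitInterval} (hφ : Monotone φ) {s t : ℝ}
    (hs : s ∈ Set.Icc (0 : ℝ) 1) (ht : t ∈ Set.Icc (0 : ℝ) 1) :
    extUnit φ s < extUnit φ t ↔ s < t := by
  lift s to unitInterval using hs
  lift t to unitInterval using ht
  rw [extUnit_coe, extUnit_coe]
  exact lt_iff_of_monotone hφ s t

lemma extUnit_le_iff {φ : unitInterval ≃ₜ unitInterval} (hφ : Monotone φ) {s t : ℝ}
    (hs : s ∈ Set.Icc (0 : ℝ) 1) (ht : t ∈ Set.Icc (0 : ℝ) 1) :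
    extUnit φ s ≤ extUnit φ t ↔ s ≤ t := by
  rw [← not_lt, extUnit_lt_iff hφ ht hs, not_lt]

lemma exists_extUnit_eq (φ : unitInterval ≃ₜ unitInterval) {t : ℝ}
    (ht : t ∈ Set.Icc (0 : ℝ) 1) : ∃ s ∈ Set.Icc (0 : ℝ) 1, extUnit φ s = t := by
  obtain ⟨s, hs⟩ := φ.surjective ⟨t, ht⟩
  exact ⟨s, s.2, by rw [extUnit_coe, hs]⟩

lemma extUnit_one {φ : unitInterval ≃ₜ unitInterval} (hφ : Monotone φ) : extUnit φ 1 = 1 := by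
  have := extUnit_coe φ 1
  rw [map_one_of_monotone hφ] at this
  simpa using this

lemma extUnit_zero {φ : unitInterval ≃ₜ unitInterval} (hφ : Monotone φ) : extUnit φ 0 = 0 := by
  have := extUnit_coe φ 0
  rw [map_zero_of_monotone hφ] at this
  simpa using this

lemma escTime_extUnit {φ : unitInterval ≃ₜ unitInterval} (hφ : Monotone φ) (f : ℝ → Ed d)
    (A : Set (Ed d)) {s : ℝ} (hs : s ∈ Set.Icc (0 : ℝ) 1) :
    escTime f A (extUnit φ s) = extUnit φ (escTime (fun t => f (extUnit φ t)) A s) := by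
  by_cases h : f (extUnit φ s) ∈ A
  · have hne : ({t | t ∈ Set.Icc s 1 ∧ ∀ u ∈ Set.Icc s t, f (extUnit φ u) ∈ A}).Nonempty :=
      ⟨s, ⟨le_rfl, hs.2⟩, fun u hu => by rwa [le_antisymm hu.2 hu.1]⟩
    rw [escTime_eq_sSup (extUnit_mem φ s).2 h, escTime_eq_sSup hs.2 h,
      (monotone_extUnit hφ).map_csSup_of_continuousAt (continuous_extUnit φ).continuousAt
        hne (bddAbove_escTime_set _ _ _)]
    congr 1
    ext t
    constructor
    · rintro ⟨ht, hu⟩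
      obtain ⟨t, htI, rfl⟩ := exists_extUnit_eq φ ⟨(extUnit_mem φ s).1.trans ht.1, ht.2⟩
      refine ⟨t, ⟨⟨(extUnit_le_iff hφ hs htI).1 ht.1, htI.2⟩, fun u hu' => hu _ ?_⟩, rfl⟩
      exact ⟨monotone_extUnit hφ hu'.1, monotone_extUnit hφ hu'.2⟩
    · rintro ⟨t, ⟨ht, hu⟩, rfl⟩
      refine ⟨⟨monotone_extUnit hφ ht.1, (extUnit_mem φ t).2⟩, fun u hu' => ?_⟩
      have htI : t ∈ Set.Icc (0 : ℝ) 1 := ⟨hs.1.trans ht.1, ht.2⟩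
      obtain ⟨u, huI, rfl⟩ := exists_extUnit_eq φ
        ⟨(extUnit_mem φ s).1.trans hu'.1, hu'.2.trans (extUnit_mem φ t).2⟩
      exact hu u ⟨(extUnit_le_iff hφ hs huI).1 hu'.1, (extUnit_le_iff hφ huI htI).1 hu'.2⟩
  · rw [escTime_of_notMem h, escTime_of_notMem (f := fun t => f (extUnit φ t)) h, extUnit_one hφ]

lemma tauSeq_extUnit {φ : unitInterval ≃ₜ unitInterval} (hφ : Monotone φ) (f : ℝ → Ed d)
    (A : ℕ → Set (Ed d)) (i : ℕ) :
    tauSeq f A i = extUnit φ (tauSeq (fun t => f (extUnit φ t)) A i) := by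
  induction i with
  | zero => exact (extUnit_zero hφ).symm
  | succ i ih =>
    rw [tauSeq, tauSeq, ih]
    exact escTime_extUnit hφ f (A i) (tauSeq_mem_Icc _ _ _)

/-- The reparametrization of a path from `x` to `y`. -/
def reparam (ω : Omega2 x y) (φ : {φ : unitInterval ≃ₜ unitInterval // Monotone ⇑φ}) :
    Omega2 x y :=
  ⟨ω.1.comp ⟨⇑φ.1, φ.1.continuous⟩, by
    simp [map_zero_of_monotone φ.2, ω.2.1], by simp [map_one_of_monotone φ.2, ω.2.2]⟩

lemma evalAt_reparam (ω : Omega2 x y) (φ : {φ : unitInterval ≃ₜ unitInterval // Monotone ⇑φ}) :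
    evalAt (reparam ω φ).1 = fun t => evalAt ω.1 (extUnit φ.1 t) := by
  funext t
  simp [evalAt, reparam, extUnit]

lemma zcondPath_reparam (ω : Omega2 x y)
    (φ : {φ : unitInterval ≃ₜ unitInterval // Monotone ⇑φ}) (A : Fin n → Set (Ed d)) :
    ZcondPath (reparam ω φ) A ↔ ZcondPath ω A := by
  unfold ZcondPath
  rw [evalAt_reparam]
  have h := tauSeq_extUnit φ.2 (evalAt ω.1) (extFam A)
  have hI := tauSeq_mem_Icc (fun t => evalAt ω.1 (extUnit φ.1 t)) (extFam A)
  have h1 : ∀ i, tauSeq (evalAt ω.1) (extFam A) i < tauSeq (evalAt ω.1) (extFam A) (i + 1) ↔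
      tauSeq (fun t => evalAt ω.1 (extUnit φ.1 t)) (extFam A) i <
        tauSeq (fun t => evalAt ω.1 (extUnit φ.1 t)) (extFam A) (i + 1) := fun i => by
    rw [h i, h (i + 1), extUnit_lt_iff φ.2 (hI i) (hI (i + 1))]
  have h2 : tauSeq (evalAt ω.1) (extFam A) n = 1 ↔
      tauSeq (fun t => evalAt ω.1 (extUnit φ.1 t)) (extFam A) n = 1 := by
    rw [h n, ← not_iff_not, ← ne_eq, ← ne_eq, ← (extUnit_mem _ _).2.lt_iff_ne,
      ← (hI n).2.lt_iff_ne, ← extUnit_lt_iff φ.2 (hI n) ⟨zero_le_one, le_rfl⟩, extUnit_one φ.2]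
  exact (and_congr (forall_congr' fun i => imp_congr_right fun _ => imp_congr_right fun _ => h1 i)
    h2).symm

end Reparametrization

section Quotient

variable {d n : ℕ} {x y : Ed d} {Q : Type*} [MetricSpace Q] {pr : Omega2 x y → Q}

instance : Nonempty {φ : unitInterval ≃ₜ unitInterval // Monotone ⇑φ} :=
  ⟨⟨Homeomorph.refl _, monotone_id⟩⟩

lemma quotDist_le_dist (ω ω' : PathSp d) : quotDist ω ω' ≤ dist ω ω' := by
  refine (ciInf_le ⟨0, ?_⟩ ⟨Homeomorph.refl _, monotone_id⟩).trans_eq ?_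
  · rintro _ ⟨φ, rfl⟩
    exact dist_nonneg
  · congr 1

lemma lipschitzWith_pr (hdist : ∀ ω ω' : Omega2 x y, dist (pr ω) (pr ω') = quotDist ω.1 ω'.1) :
    LipschitzWith 1 pr :=
  LipschitzWith.of_dist_le_mul fun ω ω' => by
    rw [NNReal.coe_one, one_mul, hdist]
    exact quotDist_le_dist _ _

lemma exists_reparam_of_dist_lt
    (hdist : ∀ ω ω' : Omega2 x y, dist (pr ω) (pr ω') = quotDist ω.1 ω'.1)
    {ω ω' : Omega2 x y} {ε : ℝ} (h : dist (pr ω) (pr ω') < ε) :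
    ∃ φ, dist ω (reparam ω' φ) < ε := by
  rw [hdist] at h
  exact exists_lt_of_ciInf_lt h

/-- The boundary of the closed cylinder set lifts to a set of irregular paths. -/
theorem not_regularPath_of_mem_frontier (hsurj : Function.Surjective pr)
    (hdist : ∀ ω ω' : Omega2 x y, dist (pr ω) (pr ω') = quotDist ω.1 ω'.1)
    {A : Fin n → Set (Ed d)} (hA : ∀ i, IsOpen (A i)) (hn : 2 ≤ n)
    (hx : x ∈ A ⟨0, by omega⟩) (hy : y ∈ A ⟨n - 1, by omega⟩ \ closure (A ⟨n - 2, by omega⟩))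
    {ω : Omega2 x y} (hω : pr ω ∈ frontier (closure (Zset pr A))) :
    ¬ RegularPath (evalAt ω.1) A := by
  intro hreg
  obtain ⟨ε, hε, hball⟩ := Metric.eventually_nhds_iff.1
    (eventually_zcondPath_iff hA hn hx hy hreg)
  have key : ∀ ω' : Omega2 x y, dist (pr ω') (pr ω) < ε → (ZcondPath ω' A ↔ ZcondPath ω A) := by
    intro ω' h
    obtain ⟨φ, hφ⟩ := exists_reparam_of_dist_lt hdist (dist_comm (pr ω) _ ▸ h)
    rw [← hball (dist_comm ω _ ▸ hφ), zcondPath_reparam]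
  by_cases hz : ZcondPath ω A
  · refine hω.2 (mem_interior_iff_mem_nhds.2 (Metric.mem_nhds_iff.2 ⟨ε, hε, fun q hq => ?_⟩))
    obtain ⟨ω', rfl⟩ := hsurj q
    exact subset_closure ⟨ω', rfl, (key ω' hq).2 hz⟩
  · have h1 : pr ω ∈ closure (Zset pr A) := by
      have := hω.1
      rwa [closure_closure] at this
    obtain ⟨q, ⟨ω', rfl, hω'⟩, hq⟩ := Metric.mem_closure_iff.1 h1 ε hε
    exact hz ((key ω' (dist_comm (pr ω) _ ▸ hq)).1 hω')

end Quotient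

section Bridge

variable {d : ℕ} {x y : Ed d}

/-- A Brownian bridge of variance `t` from `x` to `y`, described by the characteristic functions of
its marginals at arbitrary finite families of times. -/
structure IsBridge (x y : Ed d) (t : ℝ) (μ : Measure (Omega2 x y)) : Prop where
  prob : IsProbabilityMeasure μ
  charFun : ∀ (ι : Type) [Fintype ι] (u : ι → ℝ) (_ : ∀ j, u j ∈ Set.Ioo (0 : ℝ) 1)
    (ξ : ι → Ed d),
    ∫ ω : Omega2 x y, Complex.exp (Complex.I * ((∑ j, ⟪ξ j, evalAt ω.1 (u j)⟫ : ℝ) : ℂ)) ∂μ =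
      Complex.exp (((-(t / 2) * ∑ j, ∑ l, (min (u j) (u l) - u j * u l) * ⟪ξ j, ξ l⟫ : ℝ) : ℂ) +
        Complex.I * ((∑ j, ⟪ξ j, (1 - u j) • x + u j • y⟫ : ℝ) : ℂ))

lemma sum_range_ite_le_sub (ts : ℕ → ℝ) {n m : ℕ} (hm : m < n) :
    ∑ i : Fin n, (if (i : ℕ) ≤ m then ts ((i : ℕ) + 1) - ts i else 0) = ts (m + 1) - ts 0 := by
  rw [Fin.sum_univ_eq_sum_range (fun i => if i ≤ m then ts (i + 1) - ts i else 0) n,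
    ← Finset.sum_filter, ← Finset.sum_range_sub]
  congr 1
  ext i
  simp
  omega

lemma sum_increments_mul_norm_sq (n : ℕ) (ts : ℕ → ℝ) (h0 : ts 0 = 0)
    (hts : ∀ i < n, ts i < ts (i + 1)) (ξ : Fin n → Ed d) :
    ∑ i : Fin n, (ts ((i : ℕ) + 1) - ts (i : ℕ)) * ‖∑ j ∈ Finset.Ici i, ξ j‖ ^ 2 =
      ∑ j : Fin n, ∑ l : Fin n, min (ts ((j : ℕ) + 1)) (ts ((l : ℕ) + 1)) * ⟪ξ j, ξ l⟫ := by
  have hmono : ∀ j l : ℕ, j ≤ l → l ≤ n → ts j ≤ ts l := by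
    intro j l hjl
    induction l, hjl using Nat.le_induction with
    | base => exact fun _ => le_rfl
    | succ l hl ih => exact fun h => (ih (by omega)).trans (hts l (by omega)).le
  have h1 : ∀ i : Fin n, ‖∑ j ∈ Finset.Ici i, ξ j‖ ^ 2 =
      ∑ j, ∑ l, if i ≤ j ∧ i ≤ l then ⟪ξ j, ξ l⟫ else 0 := by
    intro i
    have : ∑ j ∈ Finset.Ici i, ξ j = ∑ j, if i ≤ j then ξ j else 0 := by
      rw [← Finset.sum_filter]; congr 1; ext j; simp
    rw [this, ← real_inner_self_eq_norm_sq, sum_inner]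
    refine Finset.sum_congr rfl fun j _ => ?_
    rw [inner_sum]
    refine Finset.sum_congr rfl fun l _ => ?_
    by_cases hj : i ≤ j <;> by_cases hl : i ≤ l <;> simp [hj, hl]
  simp_rw [h1, Finset.mul_sum]
  rw [Finset.sum_comm]
  refine Finset.sum_congr rfl fun j _ => ?_
  rw [Finset.sum_comm]
  refine Finset.sum_congr rfl fun l _ => ?_
  have h2 : min (ts ((j : ℕ) + 1)) (ts ((l : ℕ) + 1)) = ts (min (j : ℕ) l + 1) - ts 0 := by
    rw [h0, sub_zero]
    rcases le_total (j : ℕ) l with h | h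
    · rw [min_eq_left h, min_eq_left (hmono _ _ (by omega) (by omega))]
    · rw [min_eq_right h, min_eq_right (hmono _ _ (by omega) (by omega))]
  rw [h2, ← sum_range_ite_le_sub ts (n := n) (by omega), Finset.sum_mul]
  refine Finset.sum_congr rfl fun i _ => ?_
  by_cases hj : i ≤ j <;> by_cases hl : i ≤ l <;> simp [hj, hl]

lemma isBridge_of_isPinnedWienerFamily {Wt : ℝ → Measure (Omega2 x y)}
    (hWt : IsPinnedWienerFamily x y Wt) {t : ℝ} (ht : 0 < t) :
    (Wt t).real univ = (2 * π * t) ^ (-(d : ℝ) / 2) * Real.exp (-‖x - y‖ ^ 2 / (2 * t)) ∧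
    IsFiniteMeasure (Wt t) ∧ IsBridge x y t ((Wt t univ)⁻¹ • Wt t) := by
  classical
  obtain ⟨hfin, hW⟩ := hWt t ht
  set M := (2 * π * t) ^ (-(d : ℝ) / 2) * Real.exp (-‖x - y‖ ^ 2 / (2 * t)) with hM
  have hMpos : 0 < M := by positivity
  have hmass : (Wt t).real univ = M := by
    have := hW 0 (fun _ => 0) rfl (by simp) (by simp) Fin.elim0
    simp at this
    exact_mod_cast this
  have h0 : Wt t univ ≠ 0 := fun h => by
    rw [Measure.real, h] at hmass
    simp at hmass
    exact hMpos.ne hmass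
  have : NeZero (Wt t) := ⟨fun h => h0 (by simp [h])⟩
  refine ⟨hmass, hfin, ⟨inferInstance, fun ι _ u hu ξ => ?_⟩⟩
  set T := Finset.univ.image u with hT
  set n := T.card with hn
  let e := T.orderEmbOfFin hn.symm
  have heT : ∀ k, e k ∈ T := fun k => T.orderEmbOfFin_mem hn.symm k
  have hemem : ∀ k, e k ∈ Set.Ioo (0 : ℝ) 1 := fun k => by
    obtain ⟨j, -, hj⟩ := Finset.mem_image.1 (heT k)
    rw [← hj]; exact hu j
  have hg : ∀ j, ∃ k, e k = u j := fun j => by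
    have : u j ∈ Set.range e := by
      rw [Finset.range_orderEmbOfFin]
      exact Finset.mem_coe.2 (Finset.mem_image_of_mem _ (Finset.mem_univ j))
    exact this
  choose g hg using hg
  let ts : ℕ → ℝ := fun k => if h : 1 ≤ k ∧ k ≤ n then e ⟨k - 1, by omega⟩ else 0
  have hts : ∀ k : Fin n, ts ((k : ℕ) + 1) = e k := fun k => by
    have : 1 ≤ (k : ℕ) + 1 ∧ (k : ℕ) + 1 ≤ n := ⟨by omega, by omega⟩
    simp [ts]
  have hts0 : ts 0 = 0 := by simp [ts]
  have hinc : ∀ i < n, ts i < ts (i + 1) := by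
    intro i hi
    rw [hts ⟨i, hi⟩]
    rcases i with _ | i
    · rw [hts0]; exact (hemem _).1
    · rw [hts ⟨i, by omega⟩]
      exact e.strictMono (by simp)
  have htsn : ts n < 1 := by
    rcases Nat.eq_zero_or_pos n with h | h
    · rw [h, hts0]; exact zero_lt_one
    · have := hts ⟨n - 1, by omega⟩
      have h' : n - 1 + 1 = n := by omega
      simp only [h'] at this
      rw [this]; exact (hemem _).2
  have hsum : ∀ h : Fin n → Ed d,
      ∑ k, ⟪∑ j with g j = k, ξ j, h k⟫ = ∑ j, ⟪ξ j, h (g j)⟫ := by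
    intro h
    rw [← Finset.sum_fiberwise Finset.univ g]
    refine Finset.sum_congr rfl fun k _ => ?_
    rw [sum_inner]
    refine Finset.sum_congr rfl fun j hj => ?_
    rw [(Finset.mem_filter.1 hj).2]
  have key := hW n ts hts0 hinc htsn fun k => ∑ j with g j = k, ξ j
  rw [sum_increments_mul_norm_sq n ts hts0 hinc] at key
  simp only [hts] at key
  simp_rw [hsum (fun k => (1 - e k) • x + e k • y), hg] at key
  have hev : ∀ ω : Omega2 x y, ∑ k, ⟪∑ j with g j = k, ξ j, evalAt ω.1 (e k)⟫ =
      ∑ j, ⟪ξ j, evalAt ω.1 (u j)⟫ := fun ω => by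
    rw [hsum fun k => evalAt ω.1 (e k)]
    simp_rw [hg]
  simp_rw [hev] at key
  have hq1 : ∑ k, ∑ l, min (e k) (e l) * ⟪∑ j with g j = k, ξ j, ∑ j with g j = l, ξ j⟫ =
      ∑ j, ∑ l, min (u j) (u l) * ⟪ξ j, ξ l⟫ := by
    have h1 : ∀ k, ∑ l, min (e k) (e l) * ⟪∑ j with g j = k, ξ j, ∑ j with g j = l, ξ j⟫ =
        ⟪∑ j with g j = k, ξ j, ∑ l, min (e k) (u l) • ξ l⟫ := fun k => by
      rw [inner_sum, ← Finset.sum_fiberwise Finset.univ g]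
      refine Finset.sum_congr rfl fun l _ => ?_
      rw [inner_sum, Finset.mul_sum]
      refine Finset.sum_congr rfl fun j hj => ?_
      rw [inner_smul_right, ← hg j, (Finset.mem_filter.1 hj).2]
    simp_rw [h1]
    rw [hsum fun k => ∑ l, min (e k) (u l) • ξ l]
    simp_rw [inner_sum, inner_smul_right, hg]
  have hq2 : ∑ k, e k • ∑ j with g j = k, ξ j = ∑ j, u j • ξ j := by
    rw [← Finset.sum_fiberwise Finset.univ g]
    refine Finset.sum_congr rfl fun k _ => ?_
    rw [Finset.smul_sum]
    refine Finset.sum_congr rfl fun j hj => ?_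
    rw [← hg j, (Finset.mem_filter.1 hj).2]
  have hq3 : ‖∑ j, u j • ξ j‖ ^ 2 = ∑ j, ∑ l, u j * u l * ⟪ξ j, ξ l⟫ := by
    rw [← real_inner_self_eq_norm_sq, sum_inner]
    refine Finset.sum_congr rfl fun j _ => ?_
    rw [inner_sum]
    refine Finset.sum_congr rfl fun l _ => ?_
    rw [inner_smul_left, inner_smul_right]
    simp; ring
  rw [hq1, hq2, hq3] at key
  rw [integral_smul_measure, key, ENNReal.toReal_inv]
  change ((Wt t).real univ)⁻¹ • _ = _
  rw [hmass, Complex.real_smul, ← mul_assoc, ← Complex.ofReal_mul, inv_mul_cancel₀ hMpos.ne',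
    Complex.ofReal_one, one_mul]
  simp_rw [sub_mul, Finset.sum_sub_distrib]

end Bridge

section Independence

variable {d : ℕ} {x y : Ed d} {t : ℝ} {μ : Measure (Omega2 x y)}

lemma measurable_inner_evalAt (v : Ed d) (u : ℝ) :
    Measurable fun ω : Omega2 x y => ⟪v, evalAt ω.1 u⟫ := by
  have h : Continuous fun ω : Omega2 x y => evalAt ω.1 u :=
    continuous_evalAt_uncurry.comp (continuous_subtype_val.prodMk continuous_const)
  exact (continuous_const.inner h).measurable

lemma IsBridge.integral_cexp_residual (hμ : IsBridge x y t μ) {R : Type} [Fintype R] {u : R → ℝ}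
    (hu : ∀ i, u i ∈ Set.Ioo (0 : ℝ) 1) {w : ℝ} (hw : w ∈ Set.Ioo (0 : ℝ) 1) {e v : Ed d}
    {ρ : R → ℝ} (hρ : ∀ i, (min (u i) w - u i * w) * ⟪e, v⟫ = ρ i * ((w - w * w) * ‖v‖ ^ 2))
    (θ : R → ℝ) (s : ℝ) :
    ∫ ω : Omega2 x y, Complex.exp (Complex.I * ((∑ i, θ i * (⟪e, evalAt ω.1 (u i)⟫ -
      ρ i * ⟪v, evalAt ω.1 w⟫) + s * ⟪v, evalAt ω.1 w⟫ : ℝ) : ℂ)) ∂μ =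
    Complex.exp (((-(t / 2) * (∑ i, ∑ j, (min (u i) (u j) - u i * u j) * (θ i * θ j * ‖e‖ ^ 2)
        - (∑ i, θ i * ρ i) ^ 2 * ((w - w * w) * ‖v‖ ^ 2)) : ℝ) : ℂ) +
      Complex.I * ((∑ i, θ i * (⟪e, (1 - u i) • x + u i • y⟫ -
        ρ i * ⟪v, (1 - w) • x + w • y⟫) : ℝ) : ℂ)) *
    Complex.exp (((-(t / 2) * (s ^ 2 * ((w - w * w) * ‖v‖ ^ 2)) : ℝ) : ℂ) +
      Complex.I * ((s * ⟪v, (1 - w) • x + w • y⟫ : ℝ) : ℂ)) := by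
  have key := hμ.charFun (Option R) (fun o => o.elim w u) (by rintro (_ | i); exacts [hw, hu i])
    (fun o => o.elim ((s - ∑ i, θ i * ρ i) • v) fun i => θ i • e)
  have hlin : ∀ (p : Ed d) (P : R → Ed d), ∑ i, θ i * (⟪e, P i⟫ - ρ i * ⟪v, p⟫) + s * ⟪v, p⟫ =
      ∑ o : Option R, ⟪(o.elim ((s - ∑ i, θ i * ρ i) • v) fun i => θ i • e : Ed d),
        (o.elim p P : Ed d)⟫ := by
    intro p P
    rw [Fintype.sum_option]
    have h : ∑ i, θ i * (ρ i * ⟪v, p⟫) = (∑ i, θ i * ρ i) * ⟪v, p⟫ := by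
      rw [Finset.sum_mul]
      exact Finset.sum_congr rfl fun i _ => by ring
    simp only [Option.elim, inner_smul_left, mul_sub, Finset.sum_sub_distrib, conj_trivial]
    rw [h]
    ring
  have e1 : ∀ ω : Omega2 x y, ∑ i, θ i * (⟪e, evalAt ω.1 (u i)⟫ -
      ρ i * ⟪v, evalAt ω.1 w⟫) + s * ⟪v, evalAt ω.1 w⟫ = ∑ o : Option R,
      ⟪(o.elim ((s - ∑ i, θ i * ρ i) • v) fun i => θ i • e : Ed d),
        evalAt ω.1 (o.elim w u)⟫ := by
    intro ω
    rw [hlin (evalAt ω.1 w) fun i => evalAt ω.1 (u i)]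
    simp only [Fintype.sum_option, Option.elim]
  have e2 : ∑ i, θ i * (⟪e, (1 - u i) • x + u i • y⟫ - ρ i * ⟪v, (1 - w) • x + w • y⟫) +
      s * ⟪v, (1 - w) • x + w • y⟫ = ∑ o : Option R,
      ⟪(o.elim ((s - ∑ i, θ i * ρ i) • v) fun i => θ i • e : Ed d),
        (1 - o.elim w u) • x + o.elim w u • y⟫ := by
    rw [hlin ((1 - w) • x + w • y) fun i => (1 - u i) • x + u i • y]
    simp only [Fintype.sum_option, Option.elim]
  simp_rw [e1]
  rw [key, ← Complex.exp_add, ← e2]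
  congr 1
  have hcross : ∑ i, (min (u i) w - u i * w) * (θ i * ⟪e, v⟫) =
      (∑ i, θ i * ρ i) * ((w - w * w) * ‖v‖ ^ 2) := by
    rw [Finset.sum_mul]
    refine Finset.sum_congr rfl fun i _ => ?_
    linear_combination θ i * hρ i
  have hquad : ∑ o : Option R, ∑ o' : Option R,
      (min (o.elim w u) (o'.elim w u) - o.elim w u * o'.elim w u) *
        ⟪(o.elim ((s - ∑ i, θ i * ρ i) • v) fun i => θ i • e : Ed d),
          (o'.elim ((s - ∑ i, θ i * ρ i) • v) fun i => θ i • e : Ed d)⟫ =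
      ∑ i, ∑ j, (min (u i) (u j) - u i * u j) * (θ i * θ j * ‖e‖ ^ 2) -
        (∑ i, θ i * ρ i) ^ 2 * ((w - w * w) * ‖v‖ ^ 2) + s ^ 2 * ((w - w * w) * ‖v‖ ^ 2) := by
    simp only [Fintype.sum_option, Option.elim, inner_smul_left, inner_smul_right,
      Finset.sum_add_distrib, real_inner_self_eq_norm_sq, conj_trivial, min_self]
    have h1 : ∑ i, (min w (u i) - w * u i) * (θ i * ((s - ∑ i, θ i * ρ i) * ⟪v, e⟫)) =
        (s - ∑ i, θ i * ρ i) * ((∑ i, θ i * ρ i) * ((w - w * w) * ‖v‖ ^ 2)) := by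
      rw [← hcross, Finset.mul_sum]
      refine Finset.sum_congr rfl fun i _ => ?_
      rw [min_comm, real_inner_comm]; ring
    have h2 : ∑ i, (min (u i) w - u i * w) * ((s - ∑ i, θ i * ρ i) * (θ i * ⟪e, v⟫)) =
        (s - ∑ i, θ i * ρ i) * ((∑ i, θ i * ρ i) * ((w - w * w) * ‖v‖ ^ 2)) := by
      rw [← hcross, Finset.mul_sum]
      refine Finset.sum_congr rfl fun i _ => ?_
      ring
    have h3 : ∑ i, ∑ j, (min (u i) (u j) - u i * u j) * (θ j * (θ i * ‖e‖ ^ 2)) =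
        ∑ i, ∑ j, (min (u i) (u j) - u i * u j) * (θ i * θ j * ‖e‖ ^ 2) :=
      Finset.sum_congr rfl fun i _ => Finset.sum_congr rfl fun j _ => by ring
    rw [h1, h2, h3]
    ring
  rw [hquad]
  push_cast
  ring

/-- The residual process `⟪e, ω(u i)⟫ - ρ i ⟪v, ω(w)⟫` is independent of `⟪v, ω(w)⟫` as soon as
it is uncorrelated with it. -/
lemma IsBridge.indepFun_residual (hμ : IsBridge x y t μ) {S : Type} {u : S → ℝ}
    (hu : ∀ i, u i ∈ Set.Ioo (0 : ℝ) 1) {w : ℝ} (hw : w ∈ Set.Ioo (0 : ℝ) 1) {e v : Ed d}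
    {ρ : S → ℝ} (hρ : ∀ i, (min (u i) w - u i * w) * ⟪e, v⟫ = ρ i * ((w - w * w) * ‖v‖ ^ 2)) :
    ProbabilityTheory.IndepFun
      (fun (ω : Omega2 x y) i => ⟪e, evalAt ω.1 (u i)⟫ - ρ i * ⟪v, evalAt ω.1 w⟫)
      (fun ω : Omega2 x y => ⟪v, evalAt ω.1 w⟫) μ := by
  have := hμ.prob
  have hmeas : ∀ i, Measurable fun ω : Omega2 x y =>
      ⟪e, evalAt ω.1 (u i)⟫ - ρ i * ⟪v, evalAt ω.1 w⟫ := fun i =>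
    (measurable_inner_evalAt e (u i)).sub ((measurable_inner_evalAt v w).const_mul _)
  refine ProbabilityTheory.IndepFun.process_indepFun
    (X := fun i (ω : Omega2 x y) => ⟪e, evalAt ω.1 (u i)⟫ - ρ i * ⟪v, evalAt ω.1 w⟫)
    hmeas (measurable_inner_evalAt v w) fun J => ?_
  let F : Omega2 x y → EuclideanSpace ℝ J := fun ω => WithLp.toLp 2 fun i : J =>
    ⟪e, evalAt ω.1 (u i)⟫ - ρ i * ⟪v, evalAt ω.1 w⟫
  have hF : Measurable F := by
    refine (WithLp.measurable_toLp 2 _).comp (measurable_pi_lambda _ fun i => hmeas i)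
  suffices h : ProbabilityTheory.IndepFun F (fun ω : Omega2 x y => ⟪v, evalAt ω.1 w⟫) μ from
    h.comp (WithLp.measurable_ofLp 2 _) measurable_id
  have hG := measurable_inner_evalAt (x := x) (y := y) v w
  rw [ProbabilityTheory.indepFun_iff_charFun_prod hF.aemeasurable hG.aemeasurable]
  intro p
  obtain ⟨θ, s⟩ := p
  have key := fun θ s => hμ.integral_cexp_residual (R := J) (u := fun i => u i)
    (fun i => hu i) hw (e := e) (v := v) (ρ := fun i => ρ i) (fun i => hρ i) θ s
  simp only [charFun_apply]
  rw [integral_map, integral_map, integral_map]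
  · have e1 : ∀ ω,
        ((inner ℝ (WithLp.toLp 2 (F ω, ⟪v, evalAt ω.1 w⟫)) (WithLp.toLp 2 (θ, s)) : ℝ) : ℂ)
        * Complex.I = Complex.I * ((∑ i, θ i * (⟪e, evalAt ω.1 (u i)⟫ -
      ρ i * ⟪v, evalAt ω.1 w⟫) + s * ⟪v, evalAt ω.1 w⟫ : ℝ) : ℂ) := fun ω => by
      rw [mul_comm]
      simp [WithLp.prod_inner_apply, PiLp.inner_apply, F]
    have e2 : ∀ ω, ((inner ℝ (F ω) θ : ℝ) : ℂ)
        * Complex.I = Complex.I * ((∑ i, θ i * (⟪e, evalAt ω.1 (u i)⟫ -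
      ρ i * ⟪v, evalAt ω.1 w⟫) + 0 * ⟪v, evalAt ω.1 w⟫ : ℝ) : ℂ) := fun ω => by
      rw [mul_comm]
      simp [PiLp.inner_apply, F]
    have e3 : ∀ ω : Omega2 x y, ((inner ℝ ⟪v, evalAt ω.1 w⟫ s : ℝ) : ℂ)
        * Complex.I = Complex.I * ((∑ i : J, (0 : ℝ) * (⟪e, evalAt ω.1 (u i)⟫ -
      ρ i * ⟪v, evalAt ω.1 w⟫) + s * ⟪v, evalAt ω.1 w⟫ : ℝ) : ℂ) := fun ω => by
      rw [mul_comm]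
      simp
    simp_rw [e1, e2, e3]
    have k1 := key θ s
    have k2 := key θ 0
    have k3 := key 0 s
    simp only [Pi.zero_apply] at k3
    rw [k1, k2, k3]
    simp
  · exact hG.aemeasurable
  · fun_prop
  · exact hF.aemeasurable
  · fun_prop
  · exact ((WithLp.measurable_toLp 2 _).comp (hF.prodMk hG)).aemeasurable
  · fun_prop

lemma IsBridge.map_inner_evalAt (hμ : IsBridge x y t μ) (ht : 0 < t) {w : ℝ}
    (hw : w ∈ Set.Ioo (0 : ℝ) 1) (v : Ed d) :
    μ.map (fun ω : Omega2 x y => ⟪v, evalAt ω.1 w⟫) =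
      ProbabilityTheory.gaussianReal ⟪v, (1 - w) • x + w • y⟫
        (t * (w - w * w) * ‖v‖ ^ 2).toNNReal := by
  have := hμ.prob
  have hG := measurable_inner_evalAt (x := x) (y := y) v w
  have := Measure.isProbabilityMeasure_map (μ := μ) hG.aemeasurable
  refine Measure.ext_of_charFun (funext fun s => ?_)
  rw [ProbabilityTheory.charFun_gaussianReal, charFun_apply, integral_map hG.aemeasurable
    (by fun_prop)]
  have key := hμ.integral_cexp_residual (R := Empty) (u := Empty.elim) (fun i => i.elim) hw (e := 0)
    (v := v) (ρ := Empty.elim) (fun i => i.elim) Empty.elim s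
  have e3 : ∀ ω : Omega2 x y, ((inner ℝ ⟪v, evalAt ω.1 w⟫ s : ℝ) : ℂ)
        * Complex.I = Complex.I * ((s * ⟪v, evalAt ω.1 w⟫ : ℝ) : ℂ) := fun ω => by
      rw [mul_comm]
      simp
  simp_rw [e3]
  simp only [Finset.univ_eq_empty, Finset.sum_empty, zero_add] at key
  rw [key]
  have hv : 0 ≤ t * (w - w * w) * ‖v‖ ^ 2 := by
    have : 0 ≤ w - w * w := by nlinarith [hw.1, hw.2]
    positivity
  simp only [← Complex.exp_add]
  congr 1
  rw [Real.coe_toNNReal _ hv]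
  push_cast
  ring

lemma gaussianReal_le_volume {m : ℝ} {v : NNReal} (hv : v ≠ 0) (s : Set ℝ) :
    ProbabilityTheory.gaussianReal m v s ≤ ENNReal.ofReal (√(2 * π * v))⁻¹ * volume s := by
  rw [ProbabilityTheory.gaussianReal_apply m hv]
  calc ∫⁻ z in s, ProbabilityTheory.gaussianPDF m v z
      ≤ ∫⁻ _ in s, ENNReal.ofReal (√(2 * π * v))⁻¹ := by
        refine lintegral_mono fun z => ENNReal.ofReal_le_ofReal ?_
        rw [ProbabilityTheory.gaussianPDFReal]
        refine mul_le_of_le_one_right (by positivity) (Real.exp_le_one_iff.2 ?_)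
        exact div_nonpos_of_nonpos_of_nonneg (by nlinarith [sq_nonneg (z - m)]) (by positivity)
    _ = _ := by simp

/-- Uniform bound on the densities of the marginals of a bridge away from its end points. -/
lemma IsBridge.exists_map_le_volume (hμ : IsBridge x y t μ) (ht : 0 < t) {q r : ℝ} (hq : 0 < q)
    (hr : r < 1) {v : Ed d} (hv : v ≠ 0) :
    ∃ C : ℝ, 0 ≤ C ∧ ∀ w ∈ Set.Icc q r, ∀ s : Set ℝ,
      μ.map (fun ω : Omega2 x y => ⟪v, evalAt ω.1 w⟫) s ≤ ENNReal.ofReal C * volume s := by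
  have hv' : 0 < ‖v‖ := norm_pos_iff.2 hv
  refine ⟨(√(2 * π * (t * (q * (1 - r)) * ‖v‖ ^ 2)))⁻¹, by positivity, fun w hw s => ?_⟩
  rw [hμ.map_inner_evalAt ht ⟨hq.trans_le hw.1, hw.2.trans_lt hr⟩]
  have h1 : q * (1 - r) ≤ w - w * w := by
    have := mul_le_mul hw.1 (show 1 - r ≤ 1 - w by linarith [hw.2]) (by linarith)
      (hq.le.trans hw.1)
    linarith
  have h2 : 0 < q * (1 - r) := mul_pos hq (by linarith)
  have h3 : t * (q * (1 - r)) * ‖v‖ ^ 2 ≤ t * (w - w * w) * ‖v‖ ^ 2 := by gcongr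
  have h4 : 0 < t * (q * (1 - r)) * ‖v‖ ^ 2 := by positivity
  refine (gaussianReal_le_volume (by simpa using h4.trans_le h3) s).trans ?_
  gcongr
  exact h3.trans (Real.le_coe_toNNReal _)

end Independence

section AlmostSureRegularity

variable {d : ℕ} {x y : Ed d} {t : ℝ} {μ : Measure (Omega2 x y)}

lemma continuous_inner_evalAt (v : Ed d) (ω : Omega2 x y) :
    Continuous fun u => ⟪v, evalAt ω.1 u⟫ :=
  continuous_const.inner (continuous_evalAt_uncurry.comp
    (continuous_const.prodMk continuous_id))

lemma exists_rat_mem_Icc_lt {f : ℝ → ℝ} (hf : Continuous f) {q r τ : ℝ} (hqr : q < r)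
    (hτ : τ ∈ Set.Icc q r) {c : ℝ} (hc : c < f τ) :
    ∃ u : ℚ, (u : ℝ) ∈ Set.Icc q r ∧ c < f u := by
  have h1 : τ ∈ closure (Set.Ioo q r) := by rwa [closure_Ioo hqr.ne]
  obtain ⟨p, hp, hp'⟩ := mem_closure_iff.1 h1 (f ⁻¹' Set.Ioi c) (isOpen_Ioi.preimage hf) hc
  obtain ⟨u, hu, hu'⟩ := Rat.denseRange_cast.exists_mem_open
    ((isOpen_Ioi.preimage hf).inter isOpen_Ioo) ⟨p, hp, hp'⟩ |>.imp fun u hu => hu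
  exact ⟨u, ⟨hu'.1.le, hu'.2.le⟩, hu⟩

/-- Almost surely a linear functional of a bridge has no prescribed maximum over an interval. -/
lemma IsBridge.measure_max_eq (hμ : IsBridge x y t μ) (ht : 0 < t) {q r : ℝ} (hq : 0 < q)
    (hqr : q < r) (hr : r < 1) {e : Ed d} (he : e ≠ 0) (c : ℝ) :
    μ {ω | (∀ u ∈ Set.Icc q r, ⟪e, evalAt ω.1 u⟫ ≤ c) ∧
      ∃ τ ∈ Set.Icc q r, ⟪e, evalAt ω.1 τ⟫ = c} = 0 := by
  have := hμ.prob
  obtain ⟨C, hC0, hC⟩ := hμ.exists_map_le_volume ht hq hr he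
  let S := {u : ℚ // (u : ℝ) ∈ Set.Icc q r}
  let ρ : S → ℝ := fun u => (1 - (u.1 : ℝ)) / (1 - q)
  have hq1 : 0 < 1 - q := by linarith
  have hr1 : 0 < 1 - r := by linarith
  let G : Omega2 x y → ℝ := fun ω => ⟪e, evalAt ω.1 q⟫
  let F : Omega2 x y → S → ℝ := fun ω u => ⟪e, evalAt ω.1 (u.1 : ℝ)⟫ - ρ u * ⟪e, evalAt ω.1 q⟫
  have hG : Measurable G := measurable_inner_evalAt e q
  have hF : Measurable F := measurable_pi_lambda _ fun u =>
    (measurable_inner_evalAt e _).sub ((measurable_inner_evalAt e q).const_mul _)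
  have hind : ProbabilityTheory.IndepFun F G μ := by
    refine hμ.indepFun_residual (u := fun u : S => (u.1 : ℝ))
      (fun u => ⟨hq.trans_le u.2.1, u.2.2.trans_lt hr⟩) ⟨hq, hqr.trans hr⟩ (ρ := ρ) fun u => ?_
    rw [min_eq_right u.2.1, real_inner_self_eq_norm_sq]
    simp only [ρ]
    field_simp
  have key : ∀ ε : ℝ, 0 < ε → μ {ω | (∀ u ∈ Set.Icc q r, ⟪e, evalAt ω.1 u⟫ ≤ c) ∧
      ∃ τ ∈ Set.Icc q r, ⟪e, evalAt ω.1 τ⟫ = c} ≤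
      ENNReal.ofReal (C * ((1 - q) / (1 - r))) * ENNReal.ofReal ε := by
    intro ε hε
    let T : Set ((S → ℝ) × ℝ) := {p | (∀ u, p.1 u + ρ u * p.2 ≤ c) ∧ ∃ u, c - ε < p.1 u + ρ u * p.2}
    have hTm : MeasurableSet T := by
      have hm : ∀ u, Measurable fun p : (S → ℝ) × ℝ => p.1 u + ρ u * p.2 := fun u =>
        ((measurable_pi_apply u).comp measurable_fst).add (measurable_snd.const_mul _)
      have : T = (⋂ u, {p | p.1 u + ρ u * p.2 ≤ c}) ∩ ⋃ u, {p | c - ε < p.1 u + ρ u * p.2} := by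
        ext p; simp [T]
      rw [this]
      exact (MeasurableSet.iInter fun u => measurableSet_le (hm u) measurable_const).inter
        (MeasurableSet.iUnion fun u => measurableSet_lt measurable_const (hm u))
    have hsub : {ω : Omega2 x y | (∀ u ∈ Set.Icc q r, ⟪e, evalAt ω.1 u⟫ ≤ c) ∧
        ∃ τ ∈ Set.Icc q r, ⟪e, evalAt ω.1 τ⟫ = c} ⊆ (fun ω => (F ω, G ω)) ⁻¹' T := by
      rintro ω ⟨h1, τ, hτ, h2⟩
      obtain ⟨u, hu, hu'⟩ := exists_rat_mem_Icc_lt (continuous_inner_evalAt e ω) hqr hτ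
        (c := c - ε) (by linarith)
      refine ⟨fun u => ?_, ⟨u, hu⟩, ?_⟩
      · simpa [F, G] using h1 u.1 u.2
      · simpa [F, G] using hu'
    have hmap := (ProbabilityTheory.indepFun_iff_map_prod_eq_prod_map_map hF.aemeasurable
      hG.aemeasurable).1 hind
    have := Measure.isProbabilityMeasure_map (μ := μ) hF.aemeasurable
    have := Measure.isProbabilityMeasure_map (μ := μ) hG.aemeasurable
    calc _ ≤ μ ((fun ω => (F ω, G ω)) ⁻¹' T) := measure_mono hsub
      _ = (μ.map F).prod (μ.map G) T := by
        rw [← hmap, Measure.map_apply (hF.prodMk hG) hTm]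
      _ = ∫⁻ h, μ.map G (Prod.mk h ⁻¹' T) ∂(μ.map F) := Measure.prod_apply hTm
      _ ≤ ∫⁻ _, ENNReal.ofReal (C * ((1 - q) / (1 - r))) * ENNReal.ofReal ε ∂(μ.map F) := by
        refine lintegral_mono fun h => (hC q ⟨le_rfl, hqr.le⟩ _).trans ?_
        rw [ENNReal.ofReal_mul hC0, mul_assoc]
        gcongr
        refine (Real.volume_le_diam _).trans ?_
        rw [← ENNReal.ofReal_mul (by positivity)]
        have hlt : ∀ g ∈ Prod.mk h ⁻¹' T, ∀ g' ∈ Prod.mk h ⁻¹' T,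
            g' - g ≤ (1 - q) / (1 - r) * ε := by
          rintro g ⟨-, u, hu⟩ g' ⟨hg', -⟩
          have h1 := hg' u
          have h2 : ρ u * (g' - g) ≤ ε := by simp only at hu h1; linarith
          by_cases hgg : g' - g ≤ 0
          · exact hgg.trans (by positivity)
          push Not at hgg
          have h3 : (1 - r) / (1 - q) ≤ ρ u := by
            simp only [ρ]; gcongr; exact u.2.2
          have h4 : (1 - r) / (1 - q) * (g' - g) ≤ ε :=
            (mul_le_mul_of_nonneg_right h3 hgg.le).trans h2
          calc g' - g = (1 - q) / (1 - r) * ((1 - r) / (1 - q) * (g' - g)) := by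
                field_simp
            _ ≤ _ := by gcongr
        refine Metric.ediam_le fun g hg g' hg' => ?_
        rw [edist_dist, Real.dist_eq]
        exact ENNReal.ofReal_le_ofReal (abs_sub_le_iff.2 ⟨hlt _ hg' _ hg, hlt _ hg _ hg'⟩)
      _ = _ := by simp
  refine le_antisymm (ge_of_tendsto (f := fun ε : ℝ =>
    ENNReal.ofReal (C * ((1 - q) / (1 - r))) * ENNReal.ofReal ε) (x := 𝓝[>] 0) ?_
    (eventually_nhdsWithin_of_forall key)) zero_le
  have h0 : Tendsto (fun ε : ℝ => ENNReal.ofReal ε) (𝓝[>] 0) (𝓝 0) := by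
    have := (ENNReal.continuous_ofReal.tendsto 0).mono_left (nhdsWithin_le_nhds (s := Set.Ioi 0))
    simpa using this
  simpa using ENNReal.Tendsto.const_mul h0 (Or.inr ENNReal.ofReal_ne_top)


/-- To show that a set of paths is null one may restrict to paths with a given modulus of
continuity, provided the bounds are uniform in the modulus. -/
lemma measure_eq_zero_of_modulus_bound (v : Ed d) {E : Set (Omega2 x y)} {K : ℝ≥0∞} (hK : K ≠ ⊤)
    (h : ∀ ε : ℝ, 0 < ε → ∀ N : ℕ, μ (E ∩ {ω | ∀ s ∈ Set.Icc (0 : ℝ) 1, ∀ u ∈ Set.Icc (0 : ℝ) 1,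
      |s - u| ≤ 1 / (N + 1) → |⟪v, evalAt ω.1 s⟫ - ⟪v, evalAt ω.1 u⟫| < ε}) ≤
      K * ENNReal.ofReal ε) : μ E = 0 := by
  have key : ∀ ε : ℝ, 0 < ε → μ E ≤ K * ENNReal.ofReal ε := by
    intro ε hε
    let M : ℕ → Set (Omega2 x y) := fun N => E ∩ {ω | ∀ s ∈ Set.Icc (0 : ℝ) 1,
      ∀ u ∈ Set.Icc (0 : ℝ) 1,
      |s - u| ≤ 1 / (N + 1) → |⟪v, evalAt ω.1 s⟫ - ⟪v, evalAt ω.1 u⟫| < ε}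
    have hM : Monotone M := fun N N' hN ω hω => ⟨hω.1, fun s hs u hu hsu => hω.2 s hs u hu
      (hsu.trans (by gcongr))⟩
    have hU : E ⊆ ⋃ N, M N := by
      intro ω hω
      have huc := isCompact_Icc.uniformContinuousOn_of_continuous
        (continuous_inner_evalAt v ω).continuousOn (s := Set.Icc (0 : ℝ) 1)
      obtain ⟨δ, hδ, hδ'⟩ := Metric.uniformContinuousOn_iff.1 huc ε hε
      obtain ⟨N, hN⟩ := exists_nat_one_div_lt hδ
      exact Set.mem_iUnion.2 ⟨N, hω, fun s hs u hu hsu => hδ' s hs u hu (hsu.trans_lt hN)⟩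
    calc μ E ≤ μ (⋃ N, M N) := measure_mono hU
      _ = ⨆ N, μ (M N) := hM.measure_iUnion
      _ ≤ _ := iSup_le fun N => h ε hε N
  refine le_antisymm (ge_of_tendsto (f := fun ε : ℝ => K * ENNReal.ofReal ε) (x := 𝓝[>] 0) ?_
    (eventually_nhdsWithin_of_forall key)) zero_le
  have h0 : Tendsto (fun ε : ℝ => ENNReal.ofReal ε) (𝓝[>] 0) (𝓝 0) := by
    have := (ENNReal.continuous_ofReal.tendsto 0).mono_left (nhdsWithin_le_nhds (s := Set.Ioi 0))
    simpa using this
  simpa using ENNReal.Tendsto.const_mul h0 (Or.inr hK)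

/-- Almost surely the first hitting point of a hyperplane avoids a given orthogonal hyperplane. -/
lemma IsBridge.measure_hit_mem_hyperplane (hμ : IsBridge x y t μ) (ht : 0 < t) {q r : ℝ}
    (hq : 0 < q) (hqr : q < r) (hr : r < 1) {e v : Ed d} (hv : v ≠ 0) (hev : ⟪e, v⟫ = 0)
    (c c' : ℝ) :
    μ {ω | ∃ τ ∈ Set.Ioc q r, (∀ u ∈ Set.Ico q τ, ⟪e, evalAt ω.1 u⟫ < c) ∧
      ⟪e, evalAt ω.1 τ⟫ = c ∧ ⟪v, evalAt ω.1 τ⟫ = c'} = 0 := by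
  have := hμ.prob
  obtain ⟨C, hC0, hC⟩ := hμ.exists_map_le_volume ht hq hr hv
  refine measure_eq_zero_of_modulus_bound v (K := ENNReal.ofReal (2 * C)) ENNReal.ofReal_ne_top
    fun ε hε N => ?_
  let S := {u : ℚ // (u : ℝ) ∈ Set.Ioo (0 : ℝ) 1}
  let g : ℕ → ℝ := fun i => q + i * ((r - q) / (N + 1))
  have hrq : 0 < (r - q) / (N + 1) := div_pos (by linarith) (by positivity)
  have hgm : StrictMono g := fun i j hij => by
    simp only [g]; gcongr
  have hg0 : g 0 = q := by simp [g]
  have hgN : g (N + 1) = r := by simp only [g]; push_cast; field_simp; ring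
  let F : Omega2 x y → S → ℝ := fun ω u => ⟪e, evalAt ω.1 (u.1 : ℝ)⟫
  have hF : Measurable F := measurable_pi_lambda _ fun u => measurable_inner_evalAt e _
  let T : ℕ → Set (S → ℝ) := fun i =>
    {f | ∃ k : ℕ, ∀ u : S, (u.1 : ℝ) ∈ Set.Icc q (g i) → f u ≤ c - 1 / (k + 1)}
  have hTm : ∀ i, MeasurableSet (T i) := by
    intro i
    have : T i = ⋃ k : ℕ, ⋂ u : S, ⋂ _ : (u.1 : ℝ) ∈ Set.Icc q (g i),
        {f | f u ≤ c - 1 / (k + 1)} := by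
      ext f; simp [T]
    rw [this]
    exact MeasurableSet.iUnion fun k => MeasurableSet.iInter fun u => MeasurableSet.iInter fun _ =>
      measurableSet_le (measurable_pi_apply u) measurable_const
  have hTa : Antitone T := fun i j hij f hf => by
    obtain ⟨k, hk⟩ := hf
    exact ⟨k, fun u hu => hk u ⟨hu.1, hu.2.trans (hgm.monotone hij)⟩⟩
  let B : Set ℝ := Metric.closedBall c' ε
  let E : ℕ → Set (Omega2 x y) := fun i => F ⁻¹' (T i \ T (i + 1))
  have hEm : ∀ i, MeasurableSet (E i) := fun i => hF ((hTm i).diff (hTm _))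
  have hEd : Pairwise (Function.onFun Disjoint E) := by
    have : ∀ i j, i < j → Disjoint (E i) (E j) := fun i j hij =>
      Set.disjoint_left.2 fun ω h1 h2 => h1.2 (hTa hij h2.1)
    intro i j hij
    rcases hij.lt_or_gt with h | h
    exacts [this i j h, (this j i h).symm]
  have hsub : {ω : Omega2 x y | ∃ τ ∈ Set.Ioc q r, (∀ u ∈ Set.Ico q τ, ⟪e, evalAt ω.1 u⟫ < c) ∧
      ⟪e, evalAt ω.1 τ⟫ = c ∧ ⟪v, evalAt ω.1 τ⟫ = c'} ∩ {ω | ∀ s ∈ Set.Icc (0 : ℝ) 1,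
      ∀ u ∈ Set.Icc (0 : ℝ) 1,
      |s - u| ≤ 1 / (N + 1) → |⟪v, evalAt ω.1 s⟫ - ⟪v, evalAt ω.1 u⟫| < ε} ⊆
      ⋃ i ∈ Finset.range (N + 1),
        E i ∩ (fun ω : Omega2 x y => ⟪v, evalAt ω.1 (g (i + 1))⟫) ⁻¹' B := by
    rintro ω ⟨⟨τ, hτ, h1, h2, h3⟩, hmod⟩
    have hex : ∃ i, τ ≤ g i := ⟨N + 1, by rw [hgN]; exact hτ.2⟩
    classical
    obtain ⟨i, hi⟩ : ∃ i, Nat.find hex = i + 1 := by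
      refine Nat.exists_eq_succ_of_ne_zero fun h0 => ?_
      have := Nat.find_spec hex
      rw [h0, hg0] at this
      exact absurd hτ.1 (not_lt.2 this)
    have hle : τ ≤ g (i + 1) := hi ▸ Nat.find_spec hex
    have hlt : g i < τ := not_le.1 (Nat.find_min hex (by omega))
    have hiN : i + 1 ≤ N + 1 := hi ▸ Nat.find_min' hex (by rw [hgN]; exact hτ.2)
    have hgr : g (i + 1) ≤ r := hgN ▸ hgm.monotone hiN
    have hqi : q ≤ g i := hg0 ▸ hgm.monotone (Nat.zero_le i)
    have hcont := continuous_inner_evalAt e ω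
    simp only [Set.mem_iUnion, Finset.mem_range]
    refine ⟨i, by omega, ⟨?_, ?_⟩, ?_⟩
    · obtain ⟨p, hp, hpm⟩ := isCompact_Icc.exists_isMaxOn (Set.nonempty_Icc.2 hqi)
        hcont.continuousOn
      have hpc := h1 p ⟨hp.1, hp.2.trans_lt hlt⟩
      obtain ⟨k, hk⟩ := exists_nat_one_div_lt (sub_pos.2 hpc)
      refine ⟨k, fun u hu => ?_⟩
      have : ⟪e, evalAt ω.1 (u.1 : ℝ)⟫ ≤ ⟪e, evalAt ω.1 p⟫ := hpm hu
      simp only [F]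
      linarith
    · rintro ⟨k, hk⟩
      have hk0 : (0 : ℝ) < 1 / (k + 1) := by positivity
      obtain ⟨u, hu, hu'⟩ := exists_rat_mem_Icc_lt hcont (q := q) (r := g (i + 1))
        (hqi.trans_lt (hlt.trans_le hle)) ⟨hτ.1.le, hle⟩ (c := c - 1 / (k + 1)) (by linarith)
      have := hk ⟨u, hq.trans_le hu.1, (hu.2.trans hgr).trans_lt hr⟩ hu
      simp only [F] at this
      linarith
    · have hgi : g (i + 1) = g i + (r - q) / (N + 1) := by simp only [g]; push_cast; ring
      have h4 : (r - q) / (N + 1) ≤ 1 / ((N : ℝ) + 1) := by gcongr; linarith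
      have := hmod (g (i + 1)) ⟨by linarith [hτ.1], by linarith⟩ τ
        ⟨by linarith [hτ.1], by linarith [hτ.2]⟩ (by rw [abs_le]; constructor <;> linarith)
      rw [h3] at this
      exact Metric.mem_closedBall.2 (by rw [Real.dist_eq]; exact this.le)
  have hBi : ∀ i ∈ Finset.range (N + 1),
      μ (E i ∩ (fun ω : Omega2 x y => ⟪v, evalAt ω.1 (g (i + 1))⟫) ⁻¹' B) ≤
        μ (E i) * (ENNReal.ofReal (2 * C) * ENNReal.ofReal ε) := by
    intro i hi
    have hgr : g (i + 1) ≤ r := hgN ▸ hgm.monotone (Nat.succ_le_of_lt (Finset.mem_range.1 hi))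
    have hqi : q ≤ g (i + 1) := hg0 ▸ hgm.monotone (Nat.zero_le _)
    have hind : ProbabilityTheory.IndepFun F
        (fun ω : Omega2 x y => ⟪v, evalAt ω.1 (g (i + 1))⟫) μ := by
      have := hμ.indepFun_residual (S := S) (u := fun u : S => (u.1 : ℝ)) (fun u => u.2)
        (w := g (i + 1)) ⟨hq.trans_le hqi, hgr.trans_lt hr⟩ (e := e) (v := v) (ρ := fun _ => 0)
        (fun u => by simp [hev])
      simpa [F] using this
    have hmeas := measurable_inner_evalAt (x := x) (y := y) v (g (i + 1))
    rw [hind.measure_inter_preimage_eq_mul _ _ ((hTm i).diff (hTm _))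
      Metric.isClosed_closedBall.measurableSet]
    gcongr
    have h5 := hC (g (i + 1)) ⟨hqi, hgr⟩ B
    rw [Measure.map_apply hmeas Metric.isClosed_closedBall.measurableSet] at h5
    refine h5.trans (le_of_eq ?_)
    rw [Real.volume_closedBall, ← ENNReal.ofReal_mul hC0, ← ENNReal.ofReal_mul (by positivity)]
    congr 1; ring
  calc _ ≤ _ := measure_mono hsub
    _ ≤ ∑ i ∈ Finset.range (N + 1), μ (E i ∩ _) := measure_biUnion_finset_le _ _
    _ ≤ ∑ i ∈ Finset.range (N + 1), μ (E i) * (ENNReal.ofReal (2 * C) * ENNReal.ofReal ε) :=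
        Finset.sum_le_sum hBi
    _ = μ (⋃ i ∈ Finset.range (N + 1), E i) * (ENNReal.ofReal (2 * C) * ENNReal.ofReal ε) := by
        rw [← Finset.sum_mul, measure_biUnion_finset (fun i _ j _ h => hEd h) fun i _ => hEm i]
    _ ≤ 1 * (ENNReal.ofReal (2 * C) * ENNReal.ofReal ε) := by
        gcongr; exact prob_le_one
    _ = _ := one_mul _

end AlmostSureRegularity

section Polytopes

variable {d : ℕ} {x y : Ed d} {t : ℝ} {μ : Measure (Omega2 x y)}

lemma exists_ne_zero_orthogonal {W : Submodule ℝ (Ed d)} (hW : Module.finrank ℝ W + 2 ≤ d)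
    (e : Ed d) : ∃ v : Ed d, v ≠ 0 ∧ ⟪e, v⟫ = 0 ∧ ∀ w ∈ W, ⟪v, w⟫ = 0 := by
  have hne : W ⊔ Submodule.span ℝ {e} ≠ ⊤ := by
    intro h
    have h1 := Submodule.finrank_add_le_finrank_add_finrank W (Submodule.span ℝ {e})
    rw [h, finrank_top, finrank_euclideanSpace_fin] at h1
    have h2 := finrank_span_le_card (R := ℝ) ({e} : Set (Ed d))
    simp only [Set.toFinset_singleton, Finset.card_singleton] at h2
    omega
  have hbot : (W ⊔ Submodule.span ℝ {e})ᗮ ≠ ⊥ := fun h =>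
    hne ((Submodule.orthogonal_eq_bot_iff).1 h)
  obtain ⟨v, hv, hv0⟩ := Submodule.exists_mem_ne_zero_of_ne_bot hbot
  rw [Submodule.mem_orthogonal] at hv
  refine ⟨v, hv0, hv e (Submodule.mem_sup_right (Submodule.mem_span_singleton_self e)),
    fun w hw => ?_⟩
  rw [real_inner_comm]
  exact hv w (Submodule.mem_sup_left hw)

lemma IsBridge.ae_regularPath (hμ : IsBridge x y t μ) (ht : 0 < t) {n : ℕ} {B : Type} [Finite B]
    {e : B → Ed d} (he : ∀ b, e b ≠ 0) {c : Fin n → B → ℝ} {A : Fin n → Set (Ed d)}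
    (hA : ∀ i, A i = {p | ∀ b, ⟪e b, p⟫ < c i b})
    (hfaces : ∀ i j : Fin n, i ≠ j →
      ∃ (k : ℕ) (S : Fin k → AffineSubspace ℝ (Ed d)),
        (∀ l, Module.finrank ℝ (S l).direction + 2 ≤ d) ∧
        frontier (A i) ∩ frontier (A j) ⊆ ⋃ l, (S l : Set (Ed d))) :
    ∀ᵐ ω ∂μ, RegularPath (evalAt ω.1) A := by
  choose k S hS hcov using hfaces
  have hmax : ∀ᵐ ω ∂μ, ∀ (i : Fin n) (b : B) (q r : ℚ), 0 < q → q < r → r < 1 →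
      ¬ ((∀ u ∈ Set.Icc (q : ℝ) r, ⟪e b, evalAt ω.1 u⟫ ≤ c i b) ∧
        ∃ τ ∈ Set.Icc (q : ℝ) r, ⟪e b, evalAt ω.1 τ⟫ = c i b) := by
    simp only [ae_all_iff]
    intro i b q r hq hqr hr
    exact measure_eq_zero_iff_ae_notMem.1 (hμ.measure_max_eq ht (by exact_mod_cast hq)
      (by exact_mod_cast hqr) (by exact_mod_cast hr) (he b) (c i b))
  have hhit : ∀ᵐ ω ∂μ, ∀ (i j : Fin n) (hij : i ≠ j) (l : Fin (k i j hij)) (b : B) (q r : ℚ),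
      0 < q → q < r → r < 1 →
      ¬ ∃ τ ∈ Set.Ioc (q : ℝ) r, (∀ u ∈ Set.Ico (q : ℝ) τ, ⟪e b, evalAt ω.1 u⟫ < c i b) ∧
        ⟪e b, evalAt ω.1 τ⟫ = c i b ∧ evalAt ω.1 τ ∈ S i j hij l := by
    simp only [ae_all_iff]
    intro i j hij l b q r hq hqr hr
    obtain ⟨v, hv0, hv1, hv2⟩ := exists_ne_zero_orthogonal (hS i j hij l) (e b)
    rcases (S i j hij l : Set (Ed d)).eq_empty_or_nonempty with h0 | ⟨p, hp⟩
    · refine Eventually.of_forall ?_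
      rintro ω ⟨τ, -, -, -, h⟩
      exact absurd (show evalAt ω.1 τ ∈ (S i j hij l : Set (Ed d)) from h) (by simp [h0])
    · filter_upwards [measure_eq_zero_iff_ae_notMem.1 (hμ.measure_hit_mem_hyperplane ht
        (q := q) (r := r) (by exact_mod_cast hq) (by exact_mod_cast hqr) (by exact_mod_cast hr)
        hv0 hv1 (c i b) ⟪v, p⟫)] with ω hω
      rintro ⟨τ, h1, h2, h3, h4⟩
      refine hω ⟨τ, h1, h2, h3, ?_⟩
      have := hv2 _ (AffineSubspace.vsub_mem_direction h4 hp)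
      rwa [vsub_eq_sub, inner_sub_right, sub_eq_zero] at this
  filter_upwards [hmax, hhit] with ω h1 h2
  intro i s τ hs hsτ hτ hin hout
  have hcont : ∀ v, Continuous fun u => ⟪v, evalAt ω.1 u⟫ := fun v => continuous_inner_evalAt v ω
  obtain ⟨b, hb⟩ : ∃ b, c i b ≤ ⟪e b, evalAt ω.1 τ⟫ := by
    rw [hA] at hout
    simpa using hout
  have hlt : ∀ u ∈ Set.Ico s τ, ⟪e b, evalAt ω.1 u⟫ < c i b := fun u hu => by
    have := hin u hu
    rw [hA] at this
    exact this b
  have hτcl : τ ∈ closure (Set.Ico s τ) := by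
    rw [closure_Ico hsτ.ne]; exact ⟨hsτ.le, le_rfl⟩
  have heq : ⟪e b, evalAt ω.1 τ⟫ = c i b := by
    refine le_antisymm ?_ hb
    exact closure_minimal (fun u hu => (hlt u hu).le)
      (isClosed_le (hcont (e b)) continuous_const) hτcl
  have hclos : evalAt ω.1 τ ∈ closure (A i) :=
    map_mem_closure (continuous_evalAt_uncurry.comp (continuous_const.prodMk continuous_id))
      hτcl hin
  have hopen : IsOpen (A i) := by
    rw [hA]
    have : {p : Ed d | ∀ b, ⟪e b, p⟫ < c i b} = ⋂ b, {p | ⟪e b, p⟫ < c i b} := by ext; simp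
    rw [this]
    exact isOpen_iInter_of_finite fun b =>
      isOpen_lt (continuous_const.inner continuous_id) continuous_const
  have hclsub : ∀ p ∈ closure (A i), ⟪e b, p⟫ ≤ c i b := fun p hp =>
    closure_minimal (t := {p | ⟪e b, p⟫ ≤ c i b})
      (fun p hp => by rw [hA] at hp; exact (hp b).le)
      (isClosed_le (continuous_const.inner continuous_id) continuous_const) hp
  obtain ⟨q, hsq, hqτ⟩ := exists_rat_btwn hsτ
  have hq0 : (0 : ℚ) < q := by exact_mod_cast hs.trans hsq
  constructor
  · intro ε hε
    by_contra! hcon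
    obtain ⟨r, hτr, hrε⟩ := exists_rat_btwn (lt_min hτ (lt_add_of_pos_right τ hε))
    have hr1 := hrε.trans_le (min_le_left _ _)
    have hr2 := hrε.trans_le (min_le_right _ _)
    refine h1 i b q r hq0 (by exact_mod_cast hqτ.trans hτr) (by exact_mod_cast hr1)
      ⟨fun u hu => ?_, τ, ⟨hqτ.le, hτr.le⟩, heq⟩
    rcases lt_trichotomy u τ with h | h | h
    · exact (hlt u ⟨hsq.le.trans hu.1, h⟩).le
    · rw [h, heq]
    · exact hclsub _ (hcon u ⟨h, hu.2.trans_lt hr2⟩)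
  · intro j hji hfr
    obtain ⟨l, hl⟩ := Set.mem_iUnion.1 (hcov i j hji.symm
      ⟨⟨hclos, by rwa [hopen.interior_eq]⟩, hfr⟩)
    obtain ⟨r, hτr, hr1⟩ := exists_rat_btwn hτ
    exact h2 i j hji.symm l b q r hq0 (by exact_mod_cast hqτ.trans hτr) (by exact_mod_cast hr1)
      ⟨τ, ⟨hqτ, hτr.le⟩, fun u hu => hlt u ⟨hsq.le.trans hu.1, hu.2⟩, heq, hl⟩

end Polytopes

section BoundaryNull

variable {d n : ℕ} {x y : Ed d}

lemma isOpen_box {lo hi : Fin d → ℝ} :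
    IsOpen {p : Ed d | ∀ j, p j ∈ Set.Ioo (lo j) (hi j)} := by
  have : {p : Ed d | ∀ j, p j ∈ Set.Ioo (lo j) (hi j)} =
      ⋂ j, (fun p : Ed d => p j) ⁻¹' Set.Ioo (lo j) (hi j) := by ext; simp
  rw [this]
  exact isOpen_iInter_of_finite fun j => isOpen_Ioo.preimage (by fun_prop)

lemma IsPinnedWienerFamily.preimage_frontier_null {Wt : ℝ → Measure (Omega2 x y)}
    (hWt : IsPinnedWienerFamily x y Wt) {t : ℝ} (ht : 0 < t) (hn : 2 ≤ n) {Q : Type}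
    [MetricSpace Q] {pr : Omega2 x y → Q} (hsurj : Function.Surjective pr)
    (hdist : ∀ ω ω' : Omega2 x y, dist (pr ω) (pr ω') = quotDist ω.1 ω'.1)
    {lo hi : Fin n → Fin d → ℝ} {A : Fin n → Set (Ed d)}
    (hA : ∀ i, A i = {p : Ed d | ∀ j, p j ∈ Set.Ioo (lo i j) (hi i j)})
    (hfaces : ∀ i j : Fin n, i ≠ j →
      ∃ (k : ℕ) (S : Fin k → AffineSubspace ℝ (Ed d)),
        (∀ l, Module.finrank ℝ (S l).direction + 2 ≤ d) ∧
        frontier (A i) ∩ frontier (A j) ⊆ ⋃ l, (S l : Set (Ed d)))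
    (hx : x ∈ A ⟨0, by omega⟩)
    (hy : y ∈ A ⟨n - 1, by omega⟩ \ closure (A ⟨n - 2, by omega⟩)) :
    Wt t (pr ⁻¹' frontier (closure (Zset pr A))) = 0 := by
  obtain ⟨-, hfin, hbr⟩ := isBridge_of_isPinnedWienerFamily hWt ht
  have hreg := hbr.ae_regularPath ht (B := Fin d × Bool) (A := A)
    (e := fun b => if b.2 then EuclideanSpace.single b.1 1 else -EuclideanSpace.single b.1 1)
    (fun b => by split_ifs <;> simp)
    (c := fun i b => if b.2 then hi i b.1 else -lo i b.1) (fun i => by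
      rw [hA]
      ext p
      simp only [Set.mem_ofPred_eq, Set.mem_Ioo, Prod.forall, Bool.forall_bool]
      simp [EuclideanSpace.inner_single_left]) hfaces
  have hopen : ∀ i, IsOpen (A i) := fun i => by rw [hA]; exact isOpen_box
  have hnull : ((Wt t univ)⁻¹ • Wt t) (pr ⁻¹' frontier (closure (Zset pr A))) = 0 := by
    refine measure_mono_null (fun ω hω => ?_) (ae_iff.1 hreg)
    exact not_regularPath_of_mem_frontier hsurj hdist hopen hn hx hy hω
  rw [Measure.smul_apply, smul_eq_mul, mul_eq_zero] at hnull
  exact hnull.resolve_left (ENNReal.inv_ne_zero.2 (measure_ne_top _ _))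

end BoundaryNull

section FourierInversion

variable {d : ℕ}

/-- Half of a period box for characters of the lattice `a ℤ^d`. -/
def halfBox (k₀ : Fin d) (a : ℝ) : Set (Ed d) :=
  {η | ∀ k, η k ∈ Set.Icc (-(if k = k₀ then π / (2 * a) else π / a))
    (if k = k₀ then π / (2 * a) else π / a)}

lemma measurableSet_halfBox (k₀ : Fin d) (a : ℝ) : MeasurableSet (halfBox k₀ a) := by
  have : halfBox k₀ a = ⋂ k, (fun η : Ed d => η k) ⁻¹'
      Set.Icc (-(if k = k₀ then π / (2 * a) else π / a))
        (if k = k₀ then π / (2 * a) else π / a) := by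
    ext; simp [halfBox]
  rw [this]
  exact MeasurableSet.iInter fun k => measurableSet_Icc.preimage (by fun_prop)

lemma setIntegral_Icc_cexp {b c : ℝ} (hb : 0 ≤ b) (h : ∃ n : ℤ, c * b = n * π) :
    ∫ u in Set.Icc (-b) b, Complex.exp (Complex.I * ((u * c : ℝ) : ℂ)) =
      if c = 0 then ((2 * b : ℝ) : ℂ) else 0 := by
  rw [integral_Icc_eq_integral_Ioc, ← intervalIntegral.integral_of_le (by linarith)]
  split_ifs with hc
  · subst hc
    simp
    ring
  · have h1 : ∀ u : ℝ, Complex.I * ((u * c : ℝ) : ℂ) = (Complex.I * c) * u := fun u => by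
      push_cast; ring
    simp_rw [h1]
    rw [integral_exp_mul_complex (by simp [hc]), div_eq_zero_iff]
    left
    rw [sub_eq_zero, Complex.exp_eq_exp_iff_exists_int]
    obtain ⟨n, hn⟩ := h
    refine ⟨n, ?_⟩
    have hn' : (c : ℂ) * b = n * π := by exact_mod_cast hn
    push_cast
    linear_combination 2 * Complex.I * hn'

lemma setIntegral_halfBox_cexp (k₀ : Fin d) {a : ℝ} (ha : 0 < a) (w : Fin d → ℤ)
    (hw : Even (∑ k, w k)) :
    ∫ η in halfBox k₀ a, Complex.exp (Complex.I * ((∑ k, η k * (a * w k) : ℝ) : ℂ)) =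
      if w = 0 then (((2 * π / a) ^ d / 2 : ℝ) : ℂ) else 0 := by
  let b : Fin d → ℝ := fun k => if k = k₀ then π / (2 * a) else π / a
  have hb : ∀ k, 0 ≤ b k := fun k => by simp only [b]; split_ifs <;> positivity
  have hmp := (EuclideanSpace.volume_preserving_symm_measurableEquiv_toLp (Fin d)).symm
  have h1 : ∫ η in halfBox k₀ a, Complex.exp (Complex.I * ((∑ k, η k * (a * w k) : ℝ) : ℂ)) =
      ∫ η : Fin d → ℝ in Set.pi Set.univ (fun k => Set.Icc (-b k) (b k)),
        ∏ k, Complex.exp (Complex.I * ((η k * (a * w k) : ℝ) : ℂ)) := by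
    rw [← hmp.setIntegral_preimage_emb (MeasurableEquiv.measurableEmbedding _)]
    have : (MeasurableEquiv.toLp 2 (Fin d → ℝ)).symm.symm ⁻¹' halfBox k₀ a =
        Set.pi Set.univ (fun k => Set.Icc (-b k) (b k)) := by
      ext η
      simp only [Set.mem_preimage, halfBox, Set.mem_ofPred_eq, Set.mem_pi, Set.mem_univ,
        true_implies, b]
      rfl
    rw [this]
    refine integral_congr_ae (Eventually.of_forall fun η => ?_)
    simp only [← Complex.exp_sum, ← Finset.mul_sum, ← Complex.ofReal_sum]
    rfl
  rw [h1, volume_pi, Measure.restrict_pi_pi, integral_fintype_prod_eq_prod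
    (f := fun k (u : ℝ) => Complex.exp (Complex.I * ((u * (a * w k) : ℝ) : ℂ)))]
  have hk : ∀ k, k ≠ k₀ → ∫ u in Set.Icc (-b k) (b k),
      Complex.exp (Complex.I * ((u * (a * w k) : ℝ) : ℂ)) =
      if a * w k = 0 then ((2 * b k : ℝ) : ℂ) else 0 := fun k hk =>
    setIntegral_Icc_cexp (hb k) ⟨w k, by simp only [b, if_neg hk]; field_simp⟩
  split_ifs with h0
  · subst h0
    have : ∀ k, ∫ u in Set.Icc (-b k) (b k),
      Complex.exp (Complex.I * ((u * (a * ((0 : Fin d → ℤ) k : ℤ)) : ℝ) : ℂ)) =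
        ((2 * π / a * (if k = k₀ then 1 / 2 else 1) : ℝ) : ℂ) := fun k => by
      rw [setIntegral_Icc_cexp (hb k) ⟨0, by simp⟩]
      simp only [Pi.zero_apply, Int.cast_zero, mul_zero, if_true, b]
      congr 1
      split_ifs <;> field_simp
    rw [Finset.prod_congr rfl fun k _ => this k, ← Complex.ofReal_prod, Finset.prod_mul_distrib]
    congr 1
    rw [Finset.prod_ite_eq' Finset.univ k₀]
    simp
    ring
  · by_cases h2 : ∃ k, k ≠ k₀ ∧ w k ≠ 0
    · obtain ⟨k, hk0, hwk⟩ := h2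
      refine Finset.prod_eq_zero (Finset.mem_univ k) ?_
      rw [hk k hk0, if_neg]
      simp [ha.ne', hwk]
    · push Not at h2
      have hsum : ∑ k, w k = w k₀ := Finset.sum_eq_single_of_mem k₀ (Finset.mem_univ _)
        fun k _ hk => h2 k hk
      rw [hsum] at hw
      have hwk : w k₀ ≠ 0 := fun h => h0 (funext fun k => by
        by_cases hk : k = k₀
        · rw [hk, h]; rfl
        · exact h2 k hk)
      refine Finset.prod_eq_zero (Finset.mem_univ k₀) ?_
      obtain ⟨r, hr⟩ := hw
      rw [setIntegral_Icc_cexp (hb k₀) ⟨r, by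
        simp only [b, if_true, hr]; push_cast; field_simp; ring⟩, if_neg]
      simp [ha.ne', hwk]

/-- The integer coordinates of a lattice step. -/
def stepInt (p : Fin d × Bool) : Fin d → ℤ := Pi.single p.1 (if p.2 then 1 else -1)

lemma stepVec_apply (a : ℝ) (p : Fin d × Bool) (k : Fin d) :
    stepVec a p k = a * stepInt p k := by
  rcases p with ⟨j, b⟩
  by_cases hk : k = j
  · subst hk
    cases b <;> simp [stepVec, stepInt]
  · cases b <;> simp [stepVec, stepInt, hk]

lemma sum_stepInt (p : Fin d × Bool) : ∑ k, stepInt p k = if p.2 then 1 else -1 := by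
  simp [stepInt]

/-- Fourier inversion for sums over lattice paths with prescribed end points. -/
lemma sum_paths_eq_setIntegral (k₀ : Fin d) {a : ℝ} (ha : 0 < a) {x y : Ed d} {z : Fin d → ℤ}
    (hz : ∀ k, (x - y) k = a * z k) {N : ℕ} (hN : Even (∑ k, z k + N))
    (g : Fin N → Fin d × Bool → ℂ) :
    ∑ s : {s : Fin N → Fin d × Bool // x + ∑ i, stepVec a (s i) = y}, ∏ i, g i (s.1 i) =
      ((2 * (a / (2 * π)) ^ d : ℝ) : ℂ) * ∫ η in halfBox k₀ a,
        Complex.exp (Complex.I * ((⟪η, x - y⟫ : ℝ) : ℂ)) *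
          ∏ i, ∑ p, g i p * Complex.exp (Complex.I * ((⟪η, stepVec a p⟫ : ℝ) : ℂ)) := by
  classical
  let w : (Fin N → Fin d × Bool) → Fin d → ℤ := fun s k => z k + ∑ i, stepInt (s i) k
  have hcoord : ∀ s k, (x + ∑ i, stepVec a (s i) - y) k = a * w s k := by
    intro s k
    have h2 : (∑ i, stepVec a (s i)) k = ∑ i, a * stepInt (s i) k := by
      rw [WithLp.ofLp_sum, Finset.sum_apply]
      exact Finset.sum_congr rfl fun i _ => stepVec_apply _ _ _
    have h3 : (x + ∑ i, stepVec a (s i) - y) k = (x - y) k + (∑ i, stepVec a (s i)) k := by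
      simp; ring
    rw [h3, hz, h2, ← Finset.mul_sum]
    simp only [w]
    push_cast
    ring
  have hiff : ∀ s, x + ∑ i, stepVec a (s i) = y ↔ w s = 0 := by
    intro s
    rw [← sub_eq_zero]
    constructor
    · intro h
      funext k
      have := hcoord s k
      rw [h] at this
      have h' : (w s k : ℝ) = 0 := by
        have h'' : a * (w s k : ℝ) = 0 := by rw [← this]; rfl
        exact (mul_eq_zero.1 h'').resolve_left ha.ne'
      exact_mod_cast h'
    · intro h
      ext k
      rw [hcoord, h]
      simp
  have heven : ∀ s, Even (∑ k, w s k) := by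
    intro s
    simp only [w, Finset.sum_add_distrib]
    rw [Finset.sum_comm]
    simp only [sum_stepInt]
    have : Even (∑ i : Fin N, (if (s i).2 then (1 : ℤ) else -1) - N) := by
      have h4 : ∑ i : Fin N, (if (s i).2 then (1 : ℤ) else -1) - N =
          ∑ i : Fin N, ((if (s i).2 then (1 : ℤ) else -1) - 1) := by
        simp
      rw [h4]
      refine Finset.even_sum _ fun i _ => ?_
      split_ifs <;> decide
    have h5 := hN.add this
    rwa [add_add_sub_cancel] at h5
  have hexp : ∀ η : Ed d, Complex.exp (Complex.I * ((⟪η, x - y⟫ : ℝ) : ℂ)) *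
      ∏ i, ∑ p, g i p * Complex.exp (Complex.I * ((⟪η, stepVec a p⟫ : ℝ) : ℂ)) =
      ∑ s : Fin N → Fin d × Bool, (∏ i, g i (s i)) *
        Complex.exp (Complex.I * ((∑ k, η k * (a * w s k) : ℝ) : ℂ)) := by
    intro η
    rw [Finset.prod_univ_sum, Fintype.piFinset_univ, Finset.mul_sum]
    refine Finset.sum_congr rfl fun s _ => ?_
    rw [Finset.prod_mul_distrib, ← Complex.exp_sum, mul_left_comm, ← Complex.exp_add]
    congr 2
    rw [← Finset.mul_sum, ← mul_add, ← Complex.ofReal_sum, ← Complex.ofReal_add]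
    congr 2
    rw [← inner_sum, ← inner_add_right, PiLp.inner_apply]
    refine Finset.sum_congr rfl fun k _ => ?_
    have h5 : x - y + ∑ i, stepVec a (s i) = x + ∑ i, stepVec a (s i) - y := by abel
    rw [h5, hcoord s k]
    simp [mul_comm]
  simp_rw [hexp]
  have hvol : volume (halfBox k₀ a) ≠ ⊤ := by
    refine (Bornology.IsBounded.measure_lt_top (μ := volume) ?_).ne
    refine (PiLp.antilipschitzWith_ofLp 2 (fun _ : Fin d => ℝ)).isBounded_preimage
      (s := Set.Icc (fun k => -(if k = k₀ then π / (2 * a) else π / a))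
        (fun k => if k = k₀ then π / (2 * a) else π / a)) (Metric.isBounded_Icc _ _) |>.subset ?_
    intro η hη
    exact ⟨fun k => (hη k).1, fun k => (hη k).2⟩
  rw [integral_finsetSum]
  · simp_rw [integral_const_mul, setIntegral_halfBox_cexp k₀ ha _ (heven _), mul_ite, mul_zero]
    rw [Finset.sum_ite, Finset.sum_const_zero, add_zero, ← Finset.sum_mul, mul_left_comm]
    have h6 : ((2 * (a / (2 * π)) ^ d : ℝ) : ℂ) * (((2 * π / a) ^ d / 2 : ℝ) : ℂ) = 1 := by
      rw [← Complex.ofReal_mul, ← Complex.ofReal_one]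
      congr 1
      have h7 : (a / (2 * π)) ^ d * (2 * π / a) ^ d = 1 := by
        rw [← mul_pow, div_mul_div_comm, mul_comm a, div_self (by positivity), one_pow]
      linear_combination h7
    rw [h6, mul_one]
    rw [← Finset.sum_subtype_eq_sum_filter, Finset.subtype_univ]
    refine Fintype.sum_equiv (Equiv.subtypeEquivRight hiff) _ _ fun s => rfl
  · intro s _
    refine Integrable.const_mul ?_ _
    have : IsFiniteMeasure (volume.restrict (halfBox k₀ a)) := ⟨by
      rw [Measure.restrict_apply_univ]; exact hvol.lt_top⟩
    refine Integrable.of_bound (C := 1) (by fun_prop) (Eventually.of_forall fun η => ?_)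
    rw [mul_comm, Complex.norm_exp_ofReal_mul_I]

end FourierInversion

section StepBounds

variable {d : ℕ}

lemma sq_div_le_one_sub_cos {u : ℝ} (hu : |u| ≤ 4 * π / 3) : u ^ 2 / (2 * π ^ 2) ≤ 1 - cos u := by
  have h1 : |u / 2| ≤ π := by
    rw [abs_div, abs_two]; linarith [Real.pi_pos]
  have h2 := Real.cos_le_one_sub_mul_cos_sq h1
  have h3 : -(1 / 2) ≤ cos (u / 2) := by
    rw [← Real.cos_abs, abs_div, abs_two]
    have h4 : cos (2 * π / 3) = -(1 / 2) := by
      rw [show 2 * π / 3 = π - π / 3 by ring, Real.cos_pi_sub, Real.cos_pi_div_three]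
    rw [← h4]
    exact Real.cos_le_cos_of_nonneg_of_le_pi (by positivity) (by linarith [Real.pi_pos])
      (by linarith)
  have h5 : 1 - cos u = 2 * (1 - cos (u / 2)) * (1 + cos (u / 2)) := by
    have := Real.cos_two_mul (u / 2)
    rw [show 2 * (u / 2) = u by ring] at this
    rw [this]; ring
  have h6 : 0 ≤ 2 / π ^ 2 * (u / 2) ^ 2 := by positivity
  have h7 : u ^ 2 / (2 * π ^ 2) = 2 * (2 / π ^ 2 * (u / 2) ^ 2) * (1 / 2) := by
    field_simp
  rw [h5, h7]
  exact mul_le_mul (by linarith) (by linarith) (by norm_num) (by linarith [Real.cos_le_one (u / 2)])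

/-- The Gaussian decay rate of the characteristic function of a lattice step. -/
def decay (d : ℕ) : ℝ := 1 / (4 * π ^ 2 * d ^ 2)

lemma decay_pos (hd : 0 < d) : 0 < decay d := by
  unfold decay; positivity

lemma abs_sum_cos_le {k₀ : Fin d} {θ : Fin d → ℝ} (h0 : |θ k₀| ≤ 2 * π / 3)
    (h : ∀ k, |θ k| ≤ 4 * π / 3) :
    |∑ k, cos (θ k)| ≤ d * Real.exp (-(decay d * ∑ k, θ k ^ 2)) := by
  have hd : 0 < d := Fin.pos k₀
  have hd' : (1 : ℝ) ≤ d := by exact_mod_cast hd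
  have hexp := Real.add_one_le_exp (-(decay d * ∑ k, θ k ^ 2))
  have hS0 : 0 ≤ ∑ k, θ k ^ 2 := Finset.sum_nonneg fun _ _ => sq_nonneg _
  have hS : ∑ k, θ k ^ 2 ≤ d * (2 * π ^ 2) := by
    calc ∑ k, θ k ^ 2 ≤ ∑ _k : Fin d, 2 * π ^ 2 := by
          refine Finset.sum_le_sum fun k _ => ?_
          rw [← sq_abs]
          calc |θ k| ^ 2 ≤ (4 * π / 3) ^ 2 := by gcongr; exact h k
            _ ≤ _ := by nlinarith [sq_nonneg π]
      _ = _ := by simp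
  suffices hmain : |∑ k, cos (θ k)| ≤ d * (1 - decay d * ∑ k, θ k ^ 2) from
    hmain.trans (by gcongr; linarith)
  rw [abs_le]
  have hdd : (d : ℝ) * decay d = 1 / (4 * π ^ 2 * d) := by
    unfold decay; field_simp
  constructor
  · have h1 : -(1 / 2) ≤ cos (θ k₀) := by
      rw [← Real.cos_abs]
      have h4 : cos (2 * π / 3) = -(1 / 2) := by
        rw [show 2 * π / 3 = π - π / 3 by ring, Real.cos_pi_sub, Real.cos_pi_div_three]
      rw [← h4]
      exact Real.cos_le_cos_of_nonneg_of_le_pi (by positivity) (by linarith [Real.pi_pos]) h0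
    have h2 : 1 / 2 ≤ ∑ k, (1 + cos (θ k)) := by
      refine le_trans ?_ (Finset.single_le_sum (f := fun k => 1 + cos (θ k))
        (fun k _ => by linarith [Real.neg_one_le_cos (θ k)]) (Finset.mem_univ k₀))
      linarith
    simp only [Finset.sum_add_distrib, Finset.sum_const, Finset.card_univ, Fintype.card_fin,
      nsmul_eq_mul, mul_one] at h2
    have h3 : (d : ℝ) * decay d * ∑ k, θ k ^ 2 ≤ 1 / 2 := by
      rw [hdd, div_mul_eq_mul_div, div_le_iff₀ (by positivity)]
      linarith
    linarith
  · have h2 : ∑ k, θ k ^ 2 / (2 * π ^ 2) ≤ ∑ k, (1 - cos (θ k)) :=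
      Finset.sum_le_sum fun k _ => sq_div_le_one_sub_cos (h k)
    rw [← Finset.sum_div] at h2
    simp only [Finset.sum_sub_distrib, Finset.sum_const, Finset.card_univ, Fintype.card_fin,
      nsmul_eq_mul, mul_one] at h2
    have h3 : (d : ℝ) * decay d * ∑ k, θ k ^ 2 ≤ (∑ k, θ k ^ 2) / (2 * π ^ 2) := by
      rw [hdd, div_mul_eq_mul_div, one_mul]
      exact div_le_div_of_nonneg_left hS0 (by positivity)
        (by nlinarith [sq_nonneg π, mul_le_mul_of_nonneg_left hd' (sq_nonneg π)])
    linarith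

lemma inner_stepVec (a : ℝ) (η : Ed d) (p : Fin d × Bool) :
    ⟪η, stepVec a p⟫ = (if p.2 then 1 else -1) * (a * η p.1) := by
  rw [stepVec, inner_smul_right, EuclideanSpace.inner_single_right]
  split_ifs <;> simp

lemma sum_cexp_stepVec (a : ℝ) (η : Ed d) :
    ∑ p, Complex.exp (Complex.I * ((⟪η, stepVec a p⟫ : ℝ) : ℂ)) =
      ((2 * ∑ k, cos (a * η k) : ℝ) : ℂ) := by
  rw [Fintype.sum_prod_type, Finset.mul_sum, Complex.ofReal_sum]
  refine Finset.sum_congr rfl fun k _ => ?_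
  simp only [inner_stepVec, Fintype.sum_bool, if_true]
  push_cast
  rw [Complex.cos]
  simp
  ring_nf

lemma norm_sum_cexp_stepVec_le {k₀ : Fin d} {a : ℝ} {η : Ed d}
    (h0 : |a * η k₀| ≤ 2 * π / 3) (h : ∀ k, |a * η k| ≤ 4 * π / 3) :
    ‖∑ p, Complex.exp (Complex.I * ((⟪η, stepVec a p⟫ : ℝ) : ℂ))‖ ≤
      (2 * d) * Real.exp (-(decay d * a ^ 2 * ‖η‖ ^ 2)) := by
  rw [sum_cexp_stepVec, Complex.norm_real, norm_mul, Real.norm_eq_abs, abs_two, mul_assoc,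
    Real.norm_eq_abs]
  have := abs_sum_cos_le (θ := fun k => a * η k) h0 h
  have h2 : ∑ k, (a * η k) ^ 2 = a ^ 2 * ‖η‖ ^ 2 := by
    rw [EuclideanSpace.norm_sq_eq, Finset.mul_sum]
    exact Finset.sum_congr rfl fun k _ => by rw [Real.norm_eq_abs, sq_abs]; ring
  rw [h2, ← mul_assoc] at this
  gcongr

lemma abs_mul_le_of_mem_halfBox {k₀ : Fin d} {a : ℝ} (ha : 0 < a) {η : Ed d}
    (hη : η ∈ halfBox k₀ a) : |a * η k₀| ≤ π / 2 ∧ ∀ k, |a * η k| ≤ π := by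
  have key : ∀ k, |a * η k| ≤ a * (if k = k₀ then π / (2 * a) else π / a) := fun k => by
    rw [abs_mul, abs_of_pos ha]
    gcongr
    exact abs_le.2 (hη k)
  refine ⟨(key k₀).trans_eq ?_, fun k => (key k).trans ?_⟩
  · rw [if_pos rfl]; field_simp
  · split_ifs
    · rw [mul_div_assoc', div_le_iff₀ (by positivity)]
      nlinarith [Real.pi_pos, mul_pos Real.pi_pos ha]
    · rw [mul_div_cancel₀ _ ha.ne']

lemma norm_sum_exp_mul_cexp_stepVec_le (a : ℝ) (v η : Ed d) :
    ‖∑ p, ((Real.exp ⟪v, stepVec a p⟫ : ℝ) : ℂ) *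
      Complex.exp (Complex.I * ((⟪η, stepVec a p⟫ : ℝ) : ℂ))‖ ≤
      (2 * d) * Real.exp (a ^ 2 * ‖v‖ ^ 2 / 2) := by
  refine (norm_sum_le _ _).trans ?_
  calc ∑ p, ‖((Real.exp ⟪v, stepVec a p⟫ : ℝ) : ℂ) *
      Complex.exp (Complex.I * ((⟪η, stepVec a p⟫ : ℝ) : ℂ))‖
      = ∑ p : Fin d × Bool, Real.exp ⟪v, stepVec a p⟫ := by
        refine Finset.sum_congr rfl fun p _ => ?_
        rw [norm_mul, mul_comm Complex.I, Complex.norm_exp_ofReal_mul_I, mul_one,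
          Complex.norm_real, Real.norm_of_nonneg (Real.exp_pos _).le]
    _ = ∑ k : Fin d, 2 * Real.cosh (a * v k) := by
        rw [Fintype.sum_prod_type]
        refine Finset.sum_congr rfl fun k _ => ?_
        simp only [inner_stepVec, Fintype.sum_bool, if_true]
        rw [Real.cosh_eq]
        simp
        ring
    _ ≤ ∑ _k : Fin d, 2 * Real.exp (a ^ 2 * ‖v‖ ^ 2 / 2) := by
        refine Finset.sum_le_sum fun k _ => ?_
        gcongr
        refine (Real.cosh_le_exp_half_sq _).trans (Real.exp_le_exp.2 ?_)
        have hk : (v k) ^ 2 ≤ ‖v‖ ^ 2 := by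
          rw [← sq_abs]
          exact pow_le_pow_left₀ (abs_nonneg _) (PiLp.norm_apply_le v k) 2
        rw [mul_pow]
        linarith [mul_le_mul_of_nonneg_left hk (sq_nonneg a)]
    _ = _ := by simp; ring

lemma even_of_path {a : ℝ} (ha : 0 < a) {x y : Ed d} {z : Fin d → ℤ}
    (hz : ∀ k, (x - y) k = a * z k) {N : ℕ} {s : Fin N → Fin d × Bool}
    (hs : x + ∑ i, stepVec a (s i) = y) : Even (∑ k, z k + N) := by
  have h1 : ∀ k, z k = -∑ i, stepInt (s i) k := by
    intro k
    have h2 : (∑ i, stepVec a (s i)) k = ∑ i, a * stepInt (s i) k := by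
      rw [WithLp.ofLp_sum, Finset.sum_apply]
      exact Finset.sum_congr rfl fun i _ => stepVec_apply _ _ _
    have h3 : (x - y) k = -(∑ i, stepVec a (s i)) k := by
      rw [← hs]; simp
    rw [hz, h2, ← Finset.mul_sum, ← mul_neg] at h3
    exact_mod_cast mul_left_cancel₀ ha.ne' h3
  have h4 : ∑ k, z k + N = ∑ i : Fin N, (1 - (if (s i).2 then (1 : ℤ) else -1)) := by
    simp only [h1, Finset.sum_neg_distrib]
    rw [Finset.sum_comm]
    simp only [sum_stepInt]
    rw [Finset.sum_sub_distrib]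
    simp
    ring
  rw [h4]
  refine Finset.even_sum _ fun i _ => ?_
  split_ifs <;> decide

/-- Exponential moments over lattice paths with prescribed end points. -/
lemma exists_sum_paths_exp_le (hd : 0 < d) : ∃ K : ℝ, 0 ≤ K ∧ ∀ (a : ℝ), 0 < a → ∀ (x y : Ed d)
    (z : Fin d → ℤ), (∀ k, (x - y) k = a * z k) → ∀ (N n : ℕ) (v : Fin N → Ed d), 0 < n →
    n ≤ (Finset.univ.filter fun i => v i = 0).card →
    a ^ (-(d : ℝ)) * ((2 * d : ℝ) ^ N)⁻¹ *
      ∑ s : {s : Fin N → Fin d × Bool // x + ∑ i, stepVec a (s i) = y},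
        ∏ i, Real.exp ⟪v i, stepVec a (s.1 i)⟫ ≤
      K * (a ^ 2 * n) ^ (-(d : ℝ) / 2) * Real.exp (a ^ 2 * (∑ i, ‖v i‖ ^ 2) / 2) := by
  have hdec := decay_pos hd
  refine ⟨2 * (1 / (2 * π)) ^ d * (π / decay d) ^ ((d : ℝ) / 2), by positivity,
    fun a ha x y z hz N n v hn hcard => ?_⟩
  by_cases hN : Even (∑ k, z k + N)
  swap
  · have : IsEmpty {s : Fin N → Fin d × Bool // x + ∑ i, stepVec a (s i) = y} :=
      ⟨fun s => hN (even_of_path ha hz s.2)⟩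
    rw [Fintype.sum_empty, mul_zero]
    positivity
  let k₀ : Fin d := ⟨0, hd⟩
  have hF := sum_paths_eq_setIntegral k₀ ha hz hN
    fun i p => ((Real.exp ⟪v i, stepVec a p⟫ : ℝ) : ℂ)
  have hnorm : ∑ s : {s : Fin N → Fin d × Bool // x + ∑ i, stepVec a (s i) = y},
        ∏ i, Real.exp ⟪v i, stepVec a (s.1 i)⟫ =
      ‖∑ s : {s : Fin N → Fin d × Bool // x + ∑ i, stepVec a (s i) = y},
        ∏ i, ((Real.exp ⟪v i, stepVec a (s.1 i)⟫ : ℝ) : ℂ)‖ := by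
    rw [← Real.norm_of_nonneg (Finset.sum_nonneg fun s _ => Finset.prod_nonneg fun i _ =>
      (Real.exp_pos _).le), ← Complex.norm_real]
    push_cast
    rfl
  let G : Ed d → ℝ := fun η => (2 * d : ℝ) ^ N * Real.exp (a ^ 2 * (∑ i, ‖v i‖ ^ 2) / 2) *
    Real.exp (-(decay d * a ^ 2 * n) * ‖η‖ ^ 2)
  have hpos : 0 < decay d * a ^ 2 * n := by positivity
  have hGauss : ∫ η : Ed d, Real.exp (-(decay d * a ^ 2 * n) * ‖η‖ ^ 2) =
      (π / (decay d * a ^ 2 * n)) ^ ((d : ℝ) / 2) := by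
    rw [GaussianFourier.integral_rexp_neg_mul_sq_norm hpos, finrank_euclideanSpace_fin]
  have hGi : Integrable (fun η : Ed d => Real.exp (-(decay d * a ^ 2 * n) * ‖η‖ ^ 2)) := by
    by_contra hcon
    have := integral_undef hcon
    rw [hGauss] at this
    have h2 : 0 < (π / (decay d * a ^ 2 * n)) ^ ((d : ℝ) / 2) := by positivity
    linarith
  have hbound : ∀ η ∈ halfBox k₀ a, ‖Complex.exp (Complex.I * ((⟪η, x - y⟫ : ℝ) : ℂ)) *
      ∏ i, ∑ p, ((Real.exp ⟪v i, stepVec a p⟫ : ℝ) : ℂ) *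
        Complex.exp (Complex.I * ((⟪η, stepVec a p⟫ : ℝ) : ℂ))‖ ≤ G η := by
    intro η hη
    have hη' := abs_mul_le_of_mem_halfBox ha hη
    have hstep : ∀ i : Fin N, ‖∑ p, ((Real.exp ⟪v i, stepVec a p⟫ : ℝ) : ℂ) *
        Complex.exp (Complex.I * ((⟪η, stepVec a p⟫ : ℝ) : ℂ))‖ ≤
        (2 * d) * (Real.exp (a ^ 2 * ‖v i‖ ^ 2 / 2) *
          if v i = 0 then Real.exp (-(decay d * a ^ 2 * ‖η‖ ^ 2)) else 1) := by
      intro i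
      split_ifs with hi
      · simp only [hi, inner_zero_left, Real.exp_zero, Complex.ofReal_one, one_mul, norm_zero]
        refine (norm_sum_cexp_stepVec_le (k₀ := k₀) (hη'.1.trans ?_)
          fun k => (hη'.2 k).trans ?_).trans_eq ?_
        · linarith [Real.pi_pos]
        · linarith [Real.pi_pos]
        · simp
      · rw [mul_one]
        exact norm_sum_exp_mul_cexp_stepVec_le a (v i) η
    rw [norm_mul, mul_comm Complex.I, Complex.norm_exp_ofReal_mul_I, one_mul, norm_prod]
    refine (Finset.prod_le_prod (fun i _ => norm_nonneg _) fun i _ => hstep i).trans ?_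
    rw [Finset.prod_mul_distrib, Finset.prod_const, Finset.prod_mul_distrib, ← Real.exp_sum,
      Finset.card_univ, Fintype.card_fin, ← Finset.prod_filter, Finset.prod_const,
      ← Finset.sum_div, ← Finset.mul_sum, ← mul_assoc]
    simp only [G]
    gcongr
    rw [← Real.exp_nat_mul, Real.exp_le_exp]
    have h3 : (n : ℝ) ≤ ((Finset.univ.filter fun i => v i = 0).card : ℝ) := by
      exact_mod_cast hcard
    have h4 : 0 ≤ decay d * a ^ 2 * ‖η‖ ^ 2 := by positivity
    nlinarith [mul_le_mul_of_nonneg_right h3 h4]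
  have hintegral : ‖∫ η in halfBox k₀ a, Complex.exp (Complex.I * ((⟪η, x - y⟫ : ℝ) : ℂ)) *
      ∏ i, ∑ p, ((Real.exp ⟪v i, stepVec a p⟫ : ℝ) : ℂ) *
        Complex.exp (Complex.I * ((⟪η, stepVec a p⟫ : ℝ) : ℂ))‖ ≤ ∫ η, G η := by
    refine (norm_integral_le_of_norm_le (hGi.const_mul _).integrableOn
      ((ae_restrict_iff' (measurableSet_halfBox k₀ a)).2 (Eventually.of_forall hbound))).trans ?_
    exact setIntegral_le_integral (hGi.const_mul _) (Eventually.of_forall fun η => by positivity)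
  have hG : ∫ η, G η = (2 * d : ℝ) ^ N * Real.exp (a ^ 2 * (∑ i, ‖v i‖ ^ 2) / 2) *
      (π / (decay d * a ^ 2 * n)) ^ ((d : ℝ) / 2) := by
    rw [← hGauss, ← integral_const_mul]
  rw [hnorm, hF, norm_mul, Complex.norm_real, Real.norm_of_nonneg (by positivity)]
  calc a ^ (-(d : ℝ)) * ((2 * d : ℝ) ^ N)⁻¹ * (2 * (a / (2 * π)) ^ d * _)
      ≤ a ^ (-(d : ℝ)) * ((2 * d : ℝ) ^ N)⁻¹ * (2 * (a / (2 * π)) ^ d * ∫ η, G η) := by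
        gcongr
    _ = _ := by
        rw [hG, Real.rpow_neg ha.le, Real.rpow_natCast, neg_div,
          Real.rpow_neg (by positivity : (0 : ℝ) ≤ a ^ 2 * n), div_pow, div_pow,
          show π / (decay d * a ^ 2 * n) = π / decay d / (a ^ 2 * n) by field_simp,
          Real.div_rpow (by positivity) (by positivity)]
        have : (0 : ℝ) < (a ^ 2 * n) ^ ((d : ℝ) / 2) := by positivity
        field_simp
        simp

end StepBounds

section LatticePaths

variable {d : ℕ} {x y : Ed d}

lemma clamp01_nonneg (r : ℝ) : 0 ≤ clamp01 r := le_min zero_le_one (le_max_left _ _)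

lemma clamp01_le_one (r : ℝ) : clamp01 r ≤ 1 := min_le_left _ _

lemma clamp01_mono : Monotone clamp01 := fun _ _ h => min_le_min le_rfl (max_le_max le_rfl h)

lemma clamp01_of_mem {r : ℝ} (h0 : 0 ≤ r) (h1 : r ≤ 1) : clamp01 r = r := by
  rw [clamp01, max_eq_right h0, min_eq_right h1]

lemma sum_clamp01_sub (N : ℕ) {r : ℝ} (hr : 0 ≤ r) :
    ∑ i ∈ Finset.range N, clamp01 (r - i) = min r N := by
  induction N with
  | zero => simp [hr]
  | succ N ih =>
    rw [Finset.sum_range_succ, ih]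
    push_cast
    rcases le_total r N with h | h
    · rw [clamp01_of_nonpos (by linarith), min_eq_left h, min_eq_left (by linarith), add_zero]
    · rcases le_total r (N + 1) with h' | h'
      · rw [clamp01_of_mem (by linarith) (by linarith), min_eq_right h, min_eq_left h']; ring
      · rw [clamp01_of_one_le (by linarith), min_eq_right h, min_eq_right h']

lemma sum_fin_clamp01 (N : ℕ) {τ : ℝ} (h0 : 0 ≤ τ) (h1 : τ ≤ 1) :
    ∑ i : Fin N, clamp01 (N * τ - (i : ℕ)) = N * τ := by
  rw [Fin.sum_univ_eq_sum_range (fun i => clamp01 (N * τ - (i : ℕ))) N,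
    sum_clamp01_sub N (by positivity)]
  exact min_eq_left (by nlinarith [(Nat.cast_nonneg N : (0 : ℝ) ≤ N)])

lemma sum_fin_clamp01_mul_one_sub_le (N : ℕ) {r : ℝ} (hr : 0 ≤ r) :
    ∑ i : Fin N, clamp01 (r - (i : ℕ)) * (1 - clamp01 (r - (i : ℕ))) ≤ 1 := by
  rw [Fin.sum_univ_eq_sum_range (fun i => clamp01 (r - (i : ℕ)) * (1 - clamp01 (r - (i : ℕ)))) N]
  calc _ ≤ ∑ i ∈ Finset.range N, if i = ⌊r⌋₊ then (1 : ℝ) else 0 := by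
        refine Finset.sum_le_sum fun i _ => ?_
        have hc0 := clamp01_nonneg (r - i)
        have hc1 := clamp01_le_one (r - i)
        split_ifs with h
        · nlinarith
        · rcases lt_or_gt_of_ne h with h | h
          · have h2 : ((i + 1 : ℕ) : ℝ) ≤ r := (Nat.le_floor_iff hr).1 h
            push_cast at h2
            rw [clamp01_of_one_le (by linarith)]; simp
          · have h2 := (Nat.floor_lt hr).1 h
            rw [clamp01_of_nonpos (by linarith)]; simp
    _ ≤ 1 := by
        rw [Finset.sum_ite_eq']
        split_ifs <;> norm_num

lemma abs_sum_clamp01_mul_sub_le (N : ℕ) {s t : ℝ} (hs0 : 0 ≤ s) (hs1 : s ≤ 1) (hst : s ≤ t) :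
    |∑ i : Fin N, clamp01 (N * s - (i : ℕ)) * clamp01 (N * t - (i : ℕ)) - N * s| ≤ 1 := by
  have hN : (0 : ℝ) ≤ N := Nat.cast_nonneg N
  rw [abs_sub_comm]
  nth_rw 1 [← sum_fin_clamp01 N hs0 hs1]
  rw [← Finset.sum_sub_distrib, abs_of_nonneg (Finset.sum_nonneg fun i _ => by
    nlinarith [clamp01_nonneg (N * s - (i : ℕ)), clamp01_le_one (N * t - (i : ℕ))])]
  refine le_trans (Finset.sum_le_sum fun i _ => ?_)
    (sum_fin_clamp01_mul_one_sub_le N (r := N * s) (by positivity))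
  have := clamp01_mono (show (N : ℝ) * s - (i : ℕ) ≤ N * t - (i : ℕ) by
    linarith [mul_le_mul_of_nonneg_left hst hN])
  nlinarith [clamp01_nonneg (N * s - (i : ℕ))]

lemma evalAt_pwLinE (x : Ed d) {N : ℕ} (v : Fin N → Ed d) {τ : ℝ} (h0 : 0 ≤ τ) (h1 : τ ≤ 1) :
    evalAt (pwLinE x N v) τ = x + ∑ i : Fin N, clamp01 (N * τ - (i : ℕ)) • v i := by
  have := evalAt_coe (pwLinE x N v) ⟨τ, h0, h1⟩
  exact this

lemma integrable_VxyaN {E : Type*} [NormedAddCommGroup E] (a : ℝ) (hd : 0 < d) (N : ℕ)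
    (f : Omega2 x y → E) : Integrable f (VxyaN x y a N) := by
  rw [VxyaN, Measure.sum_fintype, integrable_finsetSum_measure]
  refine fun s _ => (integrable_dirac (by simp)).smul_measure ?_
  refine ENNReal.mul_ne_top ENNReal.ofReal_ne_top (ENNReal.inv_ne_top.2 (pow_ne_zero _ ?_))
  exact_mod_cast (by omega : 2 * d ≠ 0)

lemma integral_VxyaN {E : Type*} [NormedAddCommGroup E] [NormedSpace ℝ E] [CompleteSpace E]
    {a : ℝ} (ha : 0 ≤ a) (hd : 0 < d) (N : ℕ) (f : Omega2 x y → E) :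
    ∫ ω, f ω ∂(VxyaN x y a N) = (a ^ (-(d : ℝ)) * ((2 * d : ℝ) ^ N)⁻¹) •
      ∑ s : {s : Fin N → Fin d × Bool // x + ∑ i, stepVec a (s i) = y},
        f (pwLin2 x y N (fun i => stepVec a (s.1 i)) s.2) := by
  have hc : ENNReal.ofReal (a ^ (-(d : ℝ))) * (((2 * d : ℕ) : ℝ≥0∞) ^ N)⁻¹ ≠ ∞ := by
    refine ENNReal.mul_ne_top ENNReal.ofReal_ne_top (ENNReal.inv_ne_top.2 (pow_ne_zero _ ?_))
    exact_mod_cast (by omega : 2 * d ≠ 0)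
  rw [VxyaN, Measure.sum_fintype, integral_finsetSum_measure
    fun s _ => (integrable_dirac (by simp)).smul_measure hc, Finset.smul_sum]
  refine Finset.sum_congr rfl fun s _ => ?_
  rw [integral_smul_measure, integral_dirac, ENNReal.toReal_mul, ENNReal.toReal_inv,
    ENNReal.toReal_pow, ENNReal.toReal_ofReal (by positivity)]
  simp

lemma isFiniteMeasure_VxyaN (a : ℝ) (hd : 0 < d) (N : ℕ) : IsFiniteMeasure (VxyaN x y a N) := by
  have := integrable_VxyaN (x := x) (y := y) a hd N (fun _ => (1 : ℝ))
  exact (integrable_const_iff.1 this).resolve_left one_ne_zero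

lemma card_le_of_halves (N : ℕ) {s t : ℝ} (hst : s ≤ t) (h : t ≤ 1 / 2 ∨ 1 / 2 ≤ s) :
    N / 2 ≤ (Finset.univ.filter fun i : Fin N =>
      clamp01 (N * t - (i : ℕ)) - clamp01 (N * s - (i : ℕ)) = 0).card := by
  have hN : (0 : ℝ) ≤ N := Nat.cast_nonneg N
  have hmul := mul_le_mul_of_nonneg_left hst hN
  rw [← Fintype.card_fin (N / 2), ← Finset.card_univ]
  rcases h with h | h
  · refine Finset.card_le_card_of_injOn (fun i : Fin (N / 2) => ⟨N - 1 - i, by omega⟩) ?_ ?_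
    · intro i _
      simp only [Finset.coe_filter, Finset.mem_univ, true_and, Set.mem_ofPred_eq]
      have h2 : N ≤ 2 * (N - 1 - (i : ℕ)) := by omega
      have h3 : (N : ℝ) ≤ 2 * ((N - 1 - (i : ℕ) : ℕ) : ℝ) := by exact_mod_cast h2
      have h4 := mul_le_mul_of_nonneg_left h hN
      rw [clamp01_of_nonpos (by linarith), clamp01_of_nonpos (by linarith), sub_zero]
    · intro i _ j _ hij
      have := congrArg Fin.val hij
      simp only at this
      exact Fin.ext (by omega)
  · refine Finset.card_le_card_of_injOn (fun i : Fin (N / 2) => ⟨i, by omega⟩) ?_ ?_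
    · intro i _
      simp only [Finset.coe_filter, Finset.mem_univ, true_and, Set.mem_ofPred_eq]
      have h2 : 2 * ((i : ℕ) + 1) ≤ N := by omega
      have h3 : 2 * (((i : ℕ) : ℝ) + 1) ≤ N := by exact_mod_cast h2
      have h4 := mul_le_mul_of_nonneg_left h hN
      rw [clamp01_of_one_le (by linarith), clamp01_of_one_le (by linarith), sub_self]
    · intro i _ j _ hij
      have := congrArg Fin.val hij
      exact Fin.ext this

lemma even_pow_le_factorial_mul (u : ℝ) (p : ℕ) :
    u ^ (2 * p) ≤ (2 * p).factorial * (Real.exp u + Real.exp (-u)) := by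
  have h := Real.pow_div_factorial_le_exp |u| (abs_nonneg u) (2 * p)
  rw [div_le_iff₀ (by positivity), (even_two_mul p).pow_abs, mul_comm (Real.exp _)] at h
  refine h.trans ?_
  gcongr
  rcases abs_cases u with ⟨h, _⟩ | ⟨h, _⟩ <;> rw [h] <;>
    linarith [Real.exp_pos u, Real.exp_pos (-u)]

/-- Moments of the increments of lattice bridges. -/
lemma exists_moment_le (hd : 0 < d) (p : ℕ) : ∃ K : ℝ, 0 ≤ K ∧ ∀ (a : ℝ), 0 < a → ∀ (x y : Ed d)
    (z : Fin d → ℤ), (∀ k, (x - y) k = a * z k) → ∀ (N : ℕ), 2 ≤ N → ∀ (s t : ℝ), 0 ≤ s → s < t →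
    t ≤ 1 → (t ≤ 1 / 2 ∨ 1 / 2 ≤ s) → ∀ k : Fin d,
    ∫ ω, ((evalAt ω.1 t - evalAt ω.1 s) k) ^ (2 * p) ∂(VxyaN x y a N) ≤
      K * (a ^ 2 * N) ^ (-(d : ℝ) / 2) * (a ^ 2 * N * (t - s)) ^ p := by
  obtain ⟨K, hK0, hK⟩ := exists_sum_paths_exp_le hd
  refine ⟨2 * (2 * p).factorial * K * Real.exp (1 / 2) * (1 / 3 : ℝ) ^ (-(d : ℝ) / 2),
    by positivity, fun a ha x y z hz N hN s t hs hst ht hhalf k => ?_⟩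
  have hN0 : (0 : ℝ) < N := by exact_mod_cast (by omega : 0 < N)
  have hts : 0 < t - s := by linarith
  set T : ℝ := a ^ 2 * N * (t - s) with hT
  have hTpos : 0 < T := by positivity
  set w : Fin N → ℝ := fun i => clamp01 (N * t - (i : ℕ)) - clamp01 (N * s - (i : ℕ)) with hw
  have hw0 : ∀ i, 0 ≤ w i := fun i => sub_nonneg.2 (clamp01_mono (by
    linarith [mul_le_mul_of_nonneg_left hst.le hN0.le]))
  have hw1 : ∀ i, w i ≤ 1 := fun i => by
    have := clamp01_le_one (N * t - (i : ℕ))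
    have := clamp01_nonneg (N * s - (i : ℕ))
    simp only [hw]; linarith
  have hwsum : ∑ i, w i = N * (t - s) := by
    simp only [hw, Finset.sum_sub_distrib]
    rw [sum_fin_clamp01 N (by linarith) ht, sum_fin_clamp01 N hs (by linarith)]; ring
  have hwsq : ∑ i, w i ^ 2 ≤ N * (t - s) := by
    rw [← hwsum]
    exact Finset.sum_le_sum fun i _ => by nlinarith [hw0 i, hw1 i]
  set lam : ℝ := (√T)⁻¹ with hlam
  have hlam2 : lam ^ 2 = T⁻¹ := by rw [hlam, inv_pow, Real.sq_sqrt hTpos.le]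
  set S := {s : Fin N → Fin d × Bool // x + ∑ i, stepVec a (s i) = y}
  have hexp : ∀ ε : ℝ, ε ^ 2 = 1 → a ^ (-(d : ℝ)) * ((2 * d : ℝ) ^ N)⁻¹ *
      ∑ q : S, Real.exp (ε * (lam * ∑ i, w i * (stepVec a (q.1 i)) k)) ≤
      K * Real.exp (1 / 2) * ((1 / 3 : ℝ) ^ (-(d : ℝ) / 2) * (a ^ 2 * N) ^ (-(d : ℝ) / 2)) := by
    intro ε hε
    have h1 := hK a ha x y z hz N (N / 2)
      (fun i => (ε * lam * w i) • EuclideanSpace.single k (1 : ℝ)) (by omega)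
      ((card_le_of_halves N hst.le hhalf).trans (Finset.card_le_card fun i hi => by
        simp only [Finset.mem_filter, Finset.mem_univ, true_and] at hi ⊢
        have : w i = 0 := hi
        rw [this]; simp))
    have h2 : ∀ q : S, ∏ i, Real.exp ⟪(ε * lam * w i) • EuclideanSpace.single k (1 : ℝ),
        stepVec a (q.1 i)⟫ = Real.exp (ε * (lam * ∑ i, w i * (stepVec a (q.1 i)) k)) := by
      intro q
      rw [← Real.exp_sum]
      congr 1
      rw [Finset.mul_sum, Finset.mul_sum]
      refine Finset.sum_congr rfl fun i _ => ?_
      rw [real_inner_smul_left, EuclideanSpace.inner_single_left]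
      simp
      ring
    simp only [h2] at h1
    refine h1.trans ?_
    have h3 : a ^ 2 * (∑ i, ‖(ε * lam * w i) • EuclideanSpace.single k (1 : ℝ)‖ ^ 2) / 2 ≤
        1 / 2 := by
      have h4 : ∀ i, ‖(ε * lam * w i) • (EuclideanSpace.single k (1 : ℝ) : Ed d)‖ ^ 2 =
          T⁻¹ * w i ^ 2 := fun i => by
        rw [norm_smul, PiLp.norm_single, Real.norm_eq_abs]
        simp only [norm_one, mul_one, sq_abs]
        rw [mul_pow, mul_pow, hε, hlam2, one_mul]
      simp only [h4]
      rw [← Finset.mul_sum]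
      have h5 : a ^ 2 * (T⁻¹ * ∑ i, w i ^ 2) ≤ a ^ 2 * (T⁻¹ * (N * (t - s))) := by gcongr
      have h6 : a ^ 2 * (T⁻¹ * (N * (t - s))) = 1 := by rw [hT]; field_simp
      linarith
    have h7 : (a ^ 2 * ((N / 2 : ℕ) : ℝ)) ^ (-(d : ℝ) / 2) ≤
        (1 / 3 : ℝ) ^ (-(d : ℝ) / 2) * (a ^ 2 * N) ^ (-(d : ℝ) / 2) := by
      rw [← Real.mul_rpow (by norm_num) (by positivity)]
      refine Real.rpow_le_rpow_of_nonpos (by positivity) ?_ (by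
        have : (0 : ℝ) ≤ d := Nat.cast_nonneg d
        linarith)
      have h8 : (N : ℝ) ≤ 3 * ((N / 2 : ℕ) : ℝ) := by exact_mod_cast (by omega : N ≤ 3 * (N / 2))
      nlinarith [mul_le_mul_of_nonneg_left h8 (sq_nonneg a)]
    calc _ ≤ K * ((1 / 3 : ℝ) ^ (-(d : ℝ) / 2) * (a ^ 2 * N) ^ (-(d : ℝ) / 2)) *
          Real.exp (1 / 2) := by gcongr
      _ = _ := by ring
  have hterm : ∀ q : S, ((evalAt (pwLin2 x y N (fun i => stepVec a (q.1 i)) q.2).1 t -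
      evalAt (pwLin2 x y N (fun i => stepVec a (q.1 i)) q.2).1 s) k) ^ (2 * p) ≤
      T ^ p * ((2 * p).factorial * (Real.exp (1 * (lam * ∑ i, w i * (stepVec a (q.1 i)) k)) +
        Real.exp (-1 * (lam * ∑ i, w i * (stepVec a (q.1 i)) k)))) := by
    intro q
    have h1 : (evalAt (pwLin2 x y N (fun i => stepVec a (q.1 i)) q.2).1 t -
      evalAt (pwLin2 x y N (fun i => stepVec a (q.1 i)) q.2).1 s) k =
        ∑ i, w i * (stepVec a (q.1 i)) k := by
      simp only [pwLin2]
      rw [evalAt_pwLinE _ _ (by linarith) ht, evalAt_pwLinE _ _ hs (by linarith)]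
      rw [add_sub_add_left_eq_sub, ← Finset.sum_sub_distrib]
      simp only [← sub_smul]
      rw [WithLp.ofLp_sum, Finset.sum_apply]
      rfl
    rw [h1]
    set u := ∑ i, w i * (stepVec a (q.1 i)) k
    have h2 := even_pow_le_factorial_mul (lam * u) p
    have h3 : u ^ (2 * p) = T ^ p * (lam * u) ^ (2 * p) := by
      rw [mul_pow lam, pow_mul lam, hlam2, ← mul_assoc, ← mul_pow, mul_inv_cancel₀ hTpos.ne',
        one_pow, one_mul]
    rw [h3, one_mul, neg_one_mul]
    gcongr
  rw [integral_VxyaN ha.le hd, smul_eq_mul]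
  have hc0 : 0 ≤ a ^ (-(d : ℝ)) * ((2 * d : ℝ) ^ N)⁻¹ := by positivity
  refine (mul_le_mul_of_nonneg_left (Finset.sum_le_sum fun q _ => hterm q) hc0).trans ?_
  rw [← Finset.mul_sum, ← Finset.mul_sum, Finset.sum_add_distrib]
  have e1 := hexp 1 (by norm_num)
  have e2 := hexp (-1) (by norm_num)
  set X := a ^ (-(d : ℝ)) * ((2 * d : ℝ) ^ N)⁻¹
  set S1 := ∑ q : S, Real.exp (1 * (lam * ∑ i, w i * (stepVec a (q.1 i)) k))
  set S2 := ∑ q : S, Real.exp (-1 * (lam * ∑ i, w i * (stepVec a (q.1 i)) k))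
  set R := K * Real.exp (1 / 2) * ((1 / 3 : ℝ) ^ (-(d : ℝ) / 2) * (a ^ 2 * N) ^ (-(d : ℝ) / 2))
    with hR
  calc X * (T ^ p * ((2 * p).factorial * (S1 + S2)))
      = T ^ p * (2 * p).factorial * (X * S1 + X * S2) := by ring
    _ ≤ T ^ p * (2 * p).factorial * (R + R) := by gcongr
    _ = _ := by rw [hR]; ring

end LatticePaths

section DyadicApproximation

variable {d : ℕ} {x y : Ed d}

/-- The ratio `2^{-1/4}` of the moduli of continuity at successive dyadic scales. -/
def dyadRatio : ℝ := (1 / 2 : ℝ) ^ (1 / 4 : ℝ)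

lemma dyadRatio_pos : 0 < dyadRatio := by unfold dyadRatio; positivity

lemma dyadRatio_lt_one : dyadRatio < 1 :=
  Real.rpow_lt_one (by norm_num) (by norm_num) (by norm_num)

lemma dyadRatio_pow_four : dyadRatio ^ 4 = 1 / 2 := by
  rw [dyadRatio, ← Real.rpow_natCast, ← Real.rpow_mul (by norm_num)]; norm_num

/-- A bound on the increments of a path over dyadic intervals of length `2^{-k}`. -/
def dyadBound (ω : PathSp d) (k : ℕ) : ℝ :=
  dyadRatio ^ k + ((dyadRatio ^ k) ^ 3)⁻¹ * ∑ j ∈ Finset.range (2 ^ k),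
    ‖evalAt ω ((j + 1 : ℕ) / 2 ^ k) - evalAt ω (j / 2 ^ k)‖ ^ 4

lemma dyadBound_nonneg (ω : PathSp d) (k : ℕ) : 0 ≤ dyadBound ω k := by
  have := dyadRatio_pos
  unfold dyadBound; positivity

lemma le_add_pow_four {u ε : ℝ} (hε : 0 < ε) : u ≤ ε + (ε ^ 3)⁻¹ * u ^ 4 := by
  rcases le_total u ε with h | h
  · have : 0 ≤ (ε ^ 3)⁻¹ * u ^ 4 := by positivity
    linarith
  · have h1 : ε ^ 3 * u ≤ u ^ 4 := by
      calc ε ^ 3 * u ≤ u ^ 3 * u := by gcongr; linarith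
        _ = u ^ 4 := by ring
    have h2 : u ≤ (ε ^ 3)⁻¹ * u ^ 4 := by
      rw [inv_mul_eq_div, le_div_iff₀ (by positivity)]; linarith
    linarith

lemma norm_incr_le_dyadBound (ω : PathSp d) {k j : ℕ} (hj : j < 2 ^ k) :
    ‖evalAt ω ((j + 1 : ℕ) / 2 ^ k) - evalAt ω (j / 2 ^ k)‖ ≤ dyadBound ω k := by
  have hr := pow_pos dyadRatio_pos k
  refine (le_add_pow_four hr).trans ?_
  unfold dyadBound
  gcongr
  exact Finset.single_le_sum (f := fun j : ℕ =>
    ‖evalAt ω ((j + 1 : ℕ) / 2 ^ k) - evalAt ω (j / 2 ^ k)‖ ^ 4)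
    (fun _ _ => by positivity) (Finset.mem_range.2 hj)

/-- The piecewise linear path from `x` to `y` through the points `vs`. -/
def interpPath (x y : Ed d) (M : ℕ) (vs : Fin M → Ed d) : Omega2 x y :=
  pwLin2 x y (M + 1) (fun i => pinPts x y vs ((i : ℕ) + 1) - pinPts x y vs (i : ℕ))
    (pin_telescope x y vs)

/-- The values of a path at the interior points of a regular grid. -/
def samplePath (M : ℕ) (ω : Omega2 x y) (j : Fin M) : Ed d :=
  evalAt ω.1 (((j : ℕ) + 1) / (M + 1))

lemma evalAt_zero (ω : Omega2 x y) : evalAt ω.1 0 = x := by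
  have := evalAt_coe ω.1 0
  rw [ω.2.1] at this; simpa using this

lemma evalAt_one (ω : Omega2 x y) : evalAt ω.1 1 = y := by
  have := evalAt_coe ω.1 1
  rw [ω.2.2] at this; simpa using this

lemma pinPts_samplePath (M : ℕ) (ω : Omega2 x y) {j : ℕ} (hj : j ≤ M + 1) :
    pinPts x y (samplePath M ω) j = evalAt ω.1 (j / (M + 1)) := by
  unfold pinPts
  split_ifs with h0 h1
  · subst h0
    rw [Nat.cast_zero, zero_div, evalAt_zero]
  · unfold samplePath
    obtain ⟨k, rfl⟩ := Nat.exists_eq_succ_of_ne_zero h0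
    simp
  · have : j = M + 1 := by omega
    subst this
    push_cast
    rw [div_self (by positivity), evalAt_one]

lemma continuous_pinPts (M j : ℕ) : Continuous fun vs : Fin M → Ed d => pinPts x y vs j := by
  unfold pinPts
  split_ifs
  · exact continuous_const
  · exact continuous_apply _
  · exact continuous_const

lemma continuous_interpPath (M : ℕ) : Continuous (interpPath x y M) := by
  refine Continuous.subtype_mk (ContinuousMap.continuous_of_continuous_uncurry _ ?_) _
  change Continuous fun p : (Fin M → Ed d) × unitInterval =>
    x + ∑ i : Fin (M + 1), clamp01 (((M + 1 : ℕ) : ℝ) * (p.2 : ℝ) - ((i : ℕ) : ℝ)) •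
      (pinPts x y p.1 ((i : ℕ) + 1) - pinPts x y p.1 (i : ℕ))
  refine continuous_const.add (continuous_finsetSum _ fun i _ => ?_)
  have h1 : Continuous fun p : (Fin M → Ed d) × unitInterval =>
      clamp01 (((M + 1 : ℕ) : ℝ) * (p.2 : ℝ) - ((i : ℕ) : ℝ)) :=
    clamp01_continuous.comp ((continuous_const.mul
      (continuous_subtype_val.comp continuous_snd)).sub continuous_const)
  have h2 : ∀ j, Continuous fun p : (Fin M → Ed d) × unitInterval => pinPts x y p.1 j :=
    fun j => (continuous_pinPts M j).comp continuous_fst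
  exact h1.smul ((h2 _).sub (h2 _))

lemma continuous_samplePath (M : ℕ) : Continuous (samplePath (x := x) (y := y) M) :=
  continuous_pi fun _ => continuous_evalAt_uncurry.comp
    (continuous_subtype_val.prodMk continuous_const)

lemma norm_sum_clamp01_smul_sub_le {g : ℕ → Ed d} {N : ℕ} {r B : ℝ} (hr : 0 ≤ r) (hrN : r ≤ N)
    (hB : 0 ≤ B) (hg : ∀ j < N, ‖g (j + 1) - g j‖ ≤ B) :
    ‖g 0 + ∑ i ∈ Finset.range N, clamp01 (r - i) • (g (i + 1) - g i) - g ⌊r⌋₊‖ ≤ B := by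
  have hq : ⌊r⌋₊ ≤ N := by
    have := Nat.floor_le_floor hrN
    rwa [Nat.floor_natCast] at this
  have h1 : g ⌊r⌋₊ - g 0 = ∑ i ∈ Finset.range N,
      (if i < ⌊r⌋₊ then (1 : ℝ) else 0) • (g (i + 1) - g i) := by
    rw [← Finset.sum_range_sub g]
    simp only [ite_smul, one_smul, zero_smul]
    rw [← Finset.sum_filter]
    refine Finset.sum_congr ?_ fun _ _ => rfl
    ext i
    simp only [Finset.mem_range, Finset.mem_filter]
    omega
  have h2 : g 0 + ∑ i ∈ Finset.range N, clamp01 (r - i) • (g (i + 1) - g i) - g ⌊r⌋₊ =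
      ∑ i ∈ Finset.range N, if i = ⌊r⌋₊ then clamp01 (r - i) • (g (i + 1) - g i) else 0 := by
    have : g ⌊r⌋₊ = g 0 + (g ⌊r⌋₊ - g 0) := by abel
    rw [this, h1, add_sub_add_left_eq_sub, ← Finset.sum_sub_distrib]
    refine Finset.sum_congr rfl fun i _ => ?_
    rw [← sub_smul]
    rcases lt_trichotomy i ⌊r⌋₊ with h | h | h
    · have h3 : ((i + 1 : ℕ) : ℝ) ≤ r := (Nat.le_floor_iff hr).1 h
      push_cast at h3
      rw [if_pos h, if_neg h.ne, clamp01_of_one_le (by linarith), sub_self, zero_smul]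
    · rw [if_neg h.not_lt, if_pos h, sub_zero]
    · have h3 := (Nat.floor_lt hr).1 h
      rw [if_neg h.not_gt, if_neg h.ne', clamp01_of_nonpos (by linarith), sub_self, zero_smul]
  rw [h2, Finset.sum_ite_eq']
  split_ifs with h
  · rw [norm_smul, Real.norm_of_nonneg (clamp01_nonneg _)]
    calc _ ≤ 1 * B := by
          gcongr
          · exact clamp01_le_one _
          · exact hg _ (Finset.mem_range.1 h)
      _ = B := one_mul B
  · simpa using hB

lemma edist_interpPath_le {M n : ℕ} (hM : M + 1 = 2 ^ n) (ω : Omega2 x y) :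
    edist (interpPath x y M (samplePath M ω)) ω ≤
      ∑' k, ENNReal.ofReal (dyadBound ω.1 (n + k)) := by
  have hMc : ((M : ℝ) + 1) = 2 ^ n := by exact_mod_cast hM
  rw [Subtype.edist_eq, ContinuousMap.edist_eq_iSup]
  refine iSup_le fun t => ?_
  have ht0 := t.2.1
  have ht1 := t.2.2
  let F : ℕ → Ed d := fun k => k.casesOn ((interpPath x y M (samplePath M ω)).1 t)
    fun k => evalAt ω.1 (⌊(2 : ℝ) ^ (n + k) * (t : ℝ)⌋₊ / 2 ^ (n + k))
  refine edist_le_tsum_of_edist_le_of_tendsto₀ (f := F) _ ?_ ?_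
  · intro k
    cases k with
    | zero =>
      simp only [F, add_zero]
      rw [edist_dist]
      refine ENNReal.ofReal_le_ofReal ?_
      rw [dist_eq_norm]
      let g : ℕ → Ed d := fun j => evalAt ω.1 (j / 2 ^ n)
      have h1 := norm_sum_clamp01_smul_sub_le (g := g) (N := 2 ^ n) (r := 2 ^ n * t)
        (by positivity) (by push_cast; nlinarith [pow_pos (two_pos : (0 : ℝ) < 2) n])
        (dyadBound_nonneg ω.1 n) fun j hj => norm_incr_le_dyadBound ω.1 hj
      have key : (interpPath x y M (samplePath M ω)).1 t = g 0 + ∑ i ∈ Finset.range (2 ^ n),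
          clamp01 (2 ^ n * (t : ℝ) - i) • (g (i + 1) - g i) := by
        change x + ∑ i : Fin (M + 1), clamp01 (((M + 1 : ℕ) : ℝ) * (t : ℝ) - ((i : ℕ) : ℝ)) •
          (pinPts x y (samplePath M ω) ((i : ℕ) + 1) - pinPts x y (samplePath M ω) (i : ℕ)) = _
        congr 1
        · simp [g, evalAt_zero]
        · rw [← hM, ← Fin.sum_univ_eq_sum_range
            (fun i => clamp01 (2 ^ n * (t : ℝ) - i) • (g (i + 1) - g i)) (M + 1)]
          refine Finset.sum_congr rfl fun i _ => ?_
          rw [pinPts_samplePath M ω (by omega), pinPts_samplePath M ω (by omega)]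
          simp only [g]
          push_cast
          rw [hMc]
      rw [← key] at h1
      exact h1
    | succ k =>
      simp only [F]
      rw [edist_comm, edist_dist]
      refine ENNReal.ofReal_le_ofReal ?_
      rw [dist_eq_norm, ← add_assoc]
      set l := n + k
      set q := ⌊(2 : ℝ) ^ l * (t : ℝ)⌋₊ with hq
      set q' := ⌊(2 : ℝ) ^ (l + 1) * (t : ℝ)⌋₊ with hq'
      have h0 : (0 : ℝ) ≤ 2 ^ l * (t : ℝ) := by positivity
      have h0' : (0 : ℝ) ≤ 2 ^ (l + 1) * (t : ℝ) := by positivity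
      have h1 : (q : ℝ) ≤ 2 ^ l * t := Nat.floor_le h0
      have h2 : (2 : ℝ) ^ l * t < q + 1 := Nat.lt_floor_add_one _
      have e : (2 : ℝ) ^ (l + 1) * (t : ℝ) = 2 * (2 ^ l * t) := by ring
      have h3 : 2 * q ≤ q' := (Nat.le_floor_iff h0').2 (by push_cast; rw [e]; linarith)
      have h4 : q' < 2 * q + 2 := (Nat.floor_lt h0').2 (by push_cast; rw [e]; linarith)
      have h5 : q' ≤ 2 ^ (l + 1) := by
        have h6 : (q' : ℝ) ≤ 2 ^ (l + 1) * t := Nat.floor_le h0'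
        have h7 : (q' : ℝ) ≤ 2 ^ (l + 1) := by
          nlinarith [pow_pos (two_pos : (0 : ℝ) < 2) (l + 1)]
        exact_mod_cast h7
      have e2 : (q : ℝ) / 2 ^ l = ((2 * q : ℕ) : ℝ) / 2 ^ (l + 1) := by
        push_cast
        rw [pow_succ']
        field_simp
      rw [e2]
      rcases (by omega : q' = 2 * q ∨ q' = 2 * q + 1) with h | h
      · rw [h, sub_self, norm_zero]
        exact dyadBound_nonneg _ _
      · rw [h]
        exact norm_incr_le_dyadBound ω.1 (by omega)
  · refine (tendsto_add_atTop_iff_nat 1).1 ?_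
    simp only [F]
    have h1 : Tendsto (fun k : ℕ => (⌊(2 : ℝ) ^ (n + k) * (t : ℝ)⌋₊ : ℝ) / 2 ^ (n + k)) atTop
        (𝓝 (t : ℝ)) := by
      have h2 := (tendsto_nat_floor_mul_div_atTop (R := ℝ) ht0).comp
        ((tendsto_pow_atTop_atTop_of_one_lt (one_lt_two : (1 : ℝ) < 2)).comp
          (tendsto_add_atTop_nat n))
      refine h2.congr fun k => ?_
      simp only [Function.comp]
      rw [mul_comm (t : ℝ), add_comm k n]
    have h2 := ((continuous_evalAt ω.1).tendsto (t : ℝ)).comp h1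
    rw [evalAt_coe] at h2
    exact h2

end DyadicApproximation

section LatticeTightness

variable {d : ℕ} {x y : Ed d}

/-- The masses of the lattice bridge measures are uniformly bounded. -/
lemma exists_mass_VxyaN_le (hd : 0 < d) (hxy : x ≠ y) : ∃ C : ℝ, 0 ≤ C ∧ ∀ a : ℝ, 0 < a →
    ∀ z : Fin d → ℤ, (∀ k, (x - y) k = a * z k) → ∀ N : ℕ, 2 ≤ N →
    (VxyaN x y a N).real univ ≤ C := by
  obtain ⟨K₀, hK₀, hm₀⟩ := exists_moment_le hd 0
  obtain ⟨K, hK, hm⟩ := exists_moment_le hd d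
  obtain ⟨k, hk⟩ : ∃ k, x k ≠ y k := by
    by_contra! h
    exact hxy (by ext k; exact h k)
  set ρ := |x k - y k| with hρ
  have hρ0 : 0 < ρ := abs_pos.2 (sub_ne_zero.2 hk)
  refine ⟨max K₀ ((2 / ρ) ^ (2 * d) * (2 * K)), by positivity, fun a ha z hz N hN => ?_⟩
  have hfin := isFiniteMeasure_VxyaN (x := x) (y := y) a hd N
  have hN0 : (0 : ℝ) < N := by exact_mod_cast (by omega : 0 < N)
  have hT : 0 < a ^ 2 * N := by positivity
  have hd0 : (0 : ℝ) ≤ d := Nat.cast_nonneg d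
  rcases le_total 1 (a ^ 2 * N) with h | h
  · refine le_max_of_le_left ?_
    have h1 := hm₀ a ha x y z hz N hN 0 (1 / 2) le_rfl (by norm_num) (by norm_num)
      (Or.inl le_rfl) k
    simp only [mul_zero, pow_zero, mul_one, integral_const, smul_eq_mul] at h1
    refine h1.trans (mul_le_of_le_one_right hK₀ ?_)
    exact Real.rpow_le_one_of_one_le_of_nonpos h (by linarith)
  · refine le_max_of_le_right ?_
    have h1 := hm a ha x y z hz N hN 0 (1 / 2) le_rfl (by norm_num) (by norm_num)
      (Or.inl le_rfl) k
    have h2 := hm a ha x y z hz N hN (1 / 2) 1 (by norm_num) (by norm_num) (by norm_num)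
      (Or.inr le_rfl) k
    have hR : K * (a ^ 2 * N) ^ (-(d : ℝ) / 2) * (a ^ 2 * N * (1 / 2)) ^ d ≤ K := by
      rw [mul_assoc]
      refine mul_le_of_le_one_right hK ?_
      calc (a ^ 2 * N) ^ (-(d : ℝ) / 2) * (a ^ 2 * N * (1 / 2)) ^ d
          ≤ (a ^ 2 * N) ^ (-(d : ℝ) / 2) * (a ^ 2 * N) ^ d := by
            refine mul_le_mul_of_nonneg_left (pow_le_pow_left₀ (by positivity) (by linarith) d)
              (by positivity)
        _ = (a ^ 2 * N) ^ ((d : ℝ) / 2) := by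
            rw [← Real.rpow_natCast (a ^ 2 * N) d, ← Real.rpow_add hT]
            congr 1; ring
        _ ≤ 1 := Real.rpow_le_one hT.le h (by positivity)
    rw [sub_zero] at h1
    rw [show (1 : ℝ) - 1 / 2 = 1 / 2 by norm_num] at h2
    have hpt : ∀ ω : Omega2 x y, 1 ≤ (2 / ρ) ^ (2 * d) *
        (((evalAt ω.1 (1 / 2) - evalAt ω.1 0) k) ^ (2 * d) +
          ((evalAt ω.1 1 - evalAt ω.1 (1 / 2)) k) ^ (2 * d)) := by
      intro ω
      rw [evalAt_zero, evalAt_one]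
      set w := evalAt ω.1 (1 / 2)
      have hb : ∀ u : ℝ, ρ / 2 ≤ |u| → 1 ≤ (2 / ρ) ^ (2 * d) * u ^ (2 * d) := by
        intro u hu
        rw [← (even_two_mul d).pow_abs u, ← mul_pow]
        refine one_le_pow₀ ?_
        calc (1 : ℝ) = 2 / ρ * (ρ / 2) := by field_simp
          _ ≤ _ := by gcongr
      have he : ∀ u : ℝ, 0 ≤ (2 / ρ) ^ (2 * d) * u ^ (2 * d) := fun u =>
        mul_nonneg (by positivity) ((even_two_mul d).pow_nonneg u)
      rw [mul_add]
      rcases le_total (ρ / 2) |(w - x) k| with h3 | h3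
      · linarith [hb _ h3, he ((y - w) k)]
      · have h4 : ρ / 2 ≤ |(y - w) k| := by
          have h5 : ρ ≤ |(w - x) k| + |(y - w) k| := by
            rw [hρ, abs_sub_comm]
            refine le_trans (le_of_eq ?_) (abs_add_le _ _)
            simp
          linarith
        linarith [hb _ h4, he ((w - x) k)]
    calc (VxyaN x y a N).real univ = ∫ _ω, (1 : ℝ) ∂(VxyaN x y a N) := by simp
      _ ≤ ∫ ω, (2 / ρ) ^ (2 * d) * (((evalAt ω.1 (1 / 2) - evalAt ω.1 0) k) ^ (2 * d) +
          ((evalAt ω.1 1 - evalAt ω.1 (1 / 2)) k) ^ (2 * d)) ∂(VxyaN x y a N) :=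
        integral_mono (integrable_VxyaN a hd N _) (integrable_VxyaN a hd N _) hpt
      _ ≤ _ := by
        rw [integral_const_mul, integral_add (integrable_VxyaN a hd N _)
          (integrable_VxyaN a hd N _)]
        gcongr
        linarith

lemma continuous_dyadBound (k : ℕ) : Continuous fun ω : Omega2 x y => dyadBound ω.1 k := by
  have h : ∀ t : ℝ, Continuous fun ω : Omega2 x y => evalAt ω.1 t := fun t =>
    continuous_evalAt_uncurry.comp (continuous_subtype_val.prodMk continuous_const)
  unfold dyadBound
  exact continuous_const.add (continuous_const.mul (continuous_finsetSum _ fun j _ =>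
    ((h _).sub (h _)).norm.pow 4))

lemma norm_pow_four_le (v : Ed d) : ‖v‖ ^ 4 ≤ d * ∑ k, (v k) ^ 4 := by
  have h1 : ‖v‖ ^ 2 = ∑ k, (v k) ^ 2 := by
    rw [EuclideanSpace.norm_sq_eq]; simp
  calc ‖v‖ ^ 4 = (∑ k, (v k) ^ 2) ^ 2 := by rw [← h1]; ring
    _ ≤ _ := by
      have := sq_sum_le_card_mul_sum_sq (s := (Finset.univ : Finset (Fin d)))
        (f := fun k => (v k) ^ 2)
      simp only [Finset.card_univ, Fintype.card_fin, ← pow_mul] at this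
      exact this

lemma integral_dyadBound_le (hd : 0 < d) (hxy : x ≠ y) {T₁ T₂ : ℝ} (hT₁ : 0 < T₁) :
    ∃ C : ℝ, 0 ≤ C ∧ ∀ a : ℝ, 0 < a → ∀ z : Fin d → ℤ, (∀ k, (x - y) k = a * z k) →
    ∀ N : ℕ, 2 ≤ N → T₁ ≤ a ^ 2 * N → a ^ 2 * N ≤ T₂ → ∀ k : ℕ, 1 ≤ k →
    ∫ ω, dyadBound ω.1 k ∂(VxyaN x y a N) ≤ C * dyadRatio ^ k := by
  obtain ⟨C₀, hC₀, hmass⟩ := exists_mass_VxyaN_le hd hxy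
  obtain ⟨K, hK, hm⟩ := exists_moment_le hd 2
  refine ⟨C₀ + d * (d * (K * T₁ ^ (-(d : ℝ) / 2) * T₂ ^ 2)), by positivity,
    fun a ha z hz N hN h1 h2 k hk => ?_⟩
  have hfin := isFiniteMeasure_VxyaN (x := x) (y := y) a hd N
  have hr := dyadRatio_pos
  have hT2 : 0 ≤ T₂ := hT₁.le.trans (h1.trans h2)
  have hp : (0 : ℝ) < 2 ^ k := by positivity
  have hincr : ∀ j ∈ Finset.range (2 ^ k),
      ∫ ω, ‖evalAt ω.1 ((j + 1 : ℕ) / 2 ^ k) - evalAt ω.1 (j / 2 ^ k)‖ ^ 4 ∂(VxyaN x y a N) ≤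
        d * (d * (K * T₁ ^ (-(d : ℝ) / 2) * T₂ ^ 2)) * ((1 / 2) ^ k) ^ 2 := by
    intro j hj
    have hj' : j + 1 ≤ 2 ^ k := Finset.mem_range.1 hj
    have hjc : (j : ℝ) + 1 ≤ 2 ^ k := by exact_mod_cast hj'
    have hdiff : ((j + 1 : ℕ) : ℝ) / 2 ^ k - j / 2 ^ k = (1 / 2) ^ k := by
      push_cast
      rw [← sub_div, add_sub_cancel_left, one_div_pow]
    have hhalf : ((j + 1 : ℕ) : ℝ) / 2 ^ k ≤ 1 / 2 ∨ 1 / 2 ≤ (j : ℝ) / 2 ^ k := by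
      obtain ⟨l, rfl⟩ := Nat.exists_eq_succ_of_ne_zero (by omega : k ≠ 0)
      rw [div_le_iff₀ hp, le_div_iff₀ hp, pow_succ]
      rcases lt_or_ge j (2 ^ l) with h | h
      · left
        have : ((j + 1 : ℕ) : ℝ) ≤ 2 ^ l := by exact_mod_cast h
        linarith
      · right
        have : (2 : ℝ) ^ l ≤ j := by exact_mod_cast h
        linarith
    have hcomp : ∀ c : Fin d, ∫ ω, ((evalAt ω.1 ((j + 1 : ℕ) / 2 ^ k) -
        evalAt ω.1 (j / 2 ^ k)) c) ^ 4 ∂(VxyaN x y a N) ≤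
        K * T₁ ^ (-(d : ℝ) / 2) * T₂ ^ 2 * ((1 / 2) ^ k) ^ 2 := by
      intro c
      refine (hm a ha x y z hz N hN (j / 2 ^ k) ((j + 1 : ℕ) / 2 ^ k) (by positivity) ?_ ?_
        hhalf c).trans ?_
      · have : (0 : ℝ) < (1 / 2) ^ k := by positivity
        linarith
      · rw [div_le_one hp]; push_cast; exact hjc
      · have hpow : (a ^ 2 * N) ^ (-(d : ℝ) / 2) ≤ T₁ ^ (-(d : ℝ) / 2) := by
          refine Real.rpow_le_rpow_of_nonpos hT₁ h1 ?_
          have : (0 : ℝ) ≤ d := Nat.cast_nonneg d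
          linarith
        rw [hdiff, mul_pow, ← mul_assoc]
        gcongr
    calc _ ≤ ∫ ω, d * ∑ c, ((evalAt ω.1 ((j + 1 : ℕ) / 2 ^ k) -
          evalAt ω.1 (j / 2 ^ k)) c) ^ 4 ∂(VxyaN x y a N) :=
          integral_mono (integrable_VxyaN a hd N _) (integrable_VxyaN a hd N _)
            fun ω => norm_pow_four_le _
      _ = d * ∑ c, ∫ ω, ((evalAt ω.1 ((j + 1 : ℕ) / 2 ^ k) -
          evalAt ω.1 (j / 2 ^ k)) c) ^ 4 ∂(VxyaN x y a N) := by
          rw [integral_const_mul, integral_finsetSum _ fun c _ => integrable_VxyaN a hd N _]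
      _ ≤ d * ∑ _c : Fin d, K * T₁ ^ (-(d : ℝ) / 2) * T₂ ^ 2 * ((1 / 2) ^ k) ^ 2 := by
          gcongr with c _
          exact hcomp c
      _ = _ := by simp; ring
  unfold dyadBound
  rw [integral_add (integrable_VxyaN a hd N _) (integrable_VxyaN a hd N _), integral_const_mul,
    integral_finsetSum _ fun c _ => integrable_VxyaN a hd N _, integral_const, smul_eq_mul]
  have hsum := Finset.sum_le_sum hincr
  rw [Finset.sum_const, Finset.card_range, nsmul_eq_mul] at hsum
  have hmass' := hmass a ha z hz N hN
  set D := (d : ℝ) * (d * (K * T₁ ^ (-(d : ℝ) / 2) * T₂ ^ 2))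
  have hkey : ((dyadRatio ^ k) ^ 3)⁻¹ * (((2 ^ k : ℕ) : ℝ) * (D * ((1 / 2) ^ k) ^ 2)) =
      D * dyadRatio ^ k := by
    have h3 : (1 / 2 : ℝ) ^ k = (dyadRatio ^ k) ^ 4 := by
      rw [← dyadRatio_pow_four, ← pow_mul, ← pow_mul, mul_comm]
    have h4 : ((2 ^ k : ℕ) : ℝ) * (1 / 2) ^ k = 1 := by
      push_cast
      rw [← mul_pow]; norm_num
    calc _ = ((dyadRatio ^ k) ^ 3)⁻¹ * (D * (1 / 2) ^ k) * (((2 ^ k : ℕ) : ℝ) * (1 / 2) ^ k) := by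
          ring
      _ = _ := by
          rw [h4, h3]
          have := (pow_pos hr k).ne'
          field_simp
  calc _ ≤ C₀ * dyadRatio ^ k +
        ((dyadRatio ^ k) ^ 3)⁻¹ * (((2 ^ k : ℕ) : ℝ) * (D * ((1 / 2) ^ k) ^ 2)) := by gcongr
    _ = _ := by rw [hkey]; ring

/-- Dyadic interpolation approximates lattice bridges uniformly in the lattice spacing. -/
lemma exists_lintegral_edist_interpPath_le (hd : 0 < d) (hxy : x ≠ y) {T₁ T₂ : ℝ} (hT₁ : 0 < T₁) :
    ∃ C : ℝ, 0 ≤ C ∧ ∀ a : ℝ, 0 < a → ∀ z : Fin d → ℤ, (∀ k, (x - y) k = a * z k) →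
    ∀ N : ℕ, 2 ≤ N → T₁ ≤ a ^ 2 * N → a ^ 2 * N ≤ T₂ → ∀ M n : ℕ, 1 ≤ n → M + 1 = 2 ^ n →
    ∫⁻ ω, edist (interpPath x y M (samplePath M ω)) ω ∂(VxyaN x y a N) ≤
      ENNReal.ofReal (C * dyadRatio ^ n) := by
  obtain ⟨C, hC, hb⟩ := integral_dyadBound_le hd hxy (T₂ := T₂) hT₁
  have hr := dyadRatio_pos
  have hgeo := summable_geometric_of_lt_one hr.le dyadRatio_lt_one
  refine ⟨C * ∑' k : ℕ, dyadRatio ^ k, by positivity, fun a ha z hz N hN h1 h2 M n hn hM => ?_⟩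
  calc _ ≤ ∫⁻ ω : Omega2 x y, ∑' k, ENNReal.ofReal (dyadBound ω.1 (n + k)) ∂(VxyaN x y a N) :=
        lintegral_mono fun ω => edist_interpPath_le hM ω
    _ = ∑' k, ∫⁻ ω : Omega2 x y, ENNReal.ofReal (dyadBound ω.1 (n + k)) ∂(VxyaN x y a N) :=
        lintegral_tsum fun k =>
          (continuous_dyadBound (n + k)).measurable.ennreal_ofReal.aemeasurable
    _ ≤ ∑' k, ENNReal.ofReal (C * dyadRatio ^ (n + k)) := by
        refine ENNReal.tsum_le_tsum fun k => ?_
        rw [← ofReal_integral_eq_lintegral_ofReal (integrable_VxyaN a hd N _)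
          (Eventually.of_forall fun ω => dyadBound_nonneg _ _)]
        exact ENNReal.ofReal_le_ofReal (hb a ha z hz N hN h1 h2 (n + k) (by omega))
    _ = _ := by
        have e : ∀ k, C * dyadRatio ^ (n + k) = C * dyadRatio ^ n * dyadRatio ^ k := fun k => by
          rw [pow_add]; ring
        simp only [e]
        rw [← ENNReal.ofReal_tsum_of_nonneg (fun k => by positivity) (hgeo.mul_left _),
          tsum_mul_left]
        congr 1; ring

end LatticeTightness

section StepCharacteristic

variable {d : ℕ} {x y : Ed d}

/-- The characteristic function of a lattice step of length `a`. -/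
def stepChar (a : ℝ) (θ : Ed d) : ℝ := (∑ k, cos (a * θ k)) / d

lemma continuous_stepChar (a : ℝ) : Continuous (stepChar (d := d) a) := by
  unfold stepChar
  fun_prop

lemma abs_stepChar_le_one (a : ℝ) (θ : Ed d) : |stepChar a θ| ≤ 1 := by
  rw [stepChar, abs_div, Nat.abs_cast]
  refine div_le_one_of_le₀ ?_ (Nat.cast_nonneg d)
  refine (Finset.abs_sum_le_sum_abs _ _).trans ?_
  refine (Finset.sum_le_sum fun k _ => Real.abs_cos_le_one _).trans_eq ?_
  simp

lemma abs_stepChar_le (hd : 0 < d) {k₀ : Fin d} {a : ℝ} {θ : Ed d}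
    (h0 : |a * θ k₀| ≤ 2 * π / 3) (h : ∀ k, |a * θ k| ≤ 4 * π / 3) :
    |stepChar a θ| ≤ Real.exp (-(decay d * a ^ 2 * ‖θ‖ ^ 2)) := by
  have h1 := abs_sum_cos_le (θ := fun k => a * θ k) h0 h
  have h2 : ∑ k, (a * θ k) ^ 2 = a ^ 2 * ‖θ‖ ^ 2 := by
    rw [EuclideanSpace.norm_sq_eq, Finset.mul_sum]
    exact Finset.sum_congr rfl fun k _ => by rw [Real.norm_eq_abs, sq_abs]; ring
  rw [h2, ← mul_assoc] at h1
  rw [stepChar, abs_div, Nat.abs_cast, div_le_iff₀ (by positivity), mul_comm]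
  exact h1

lemma abs_stepChar_sub_exp_le (hd : 0 < d) {a : ℝ} {θ : Ed d} (h : |a| * ‖θ‖ ≤ 1) :
    |stepChar a θ - Real.exp (-(a ^ 2 * ‖θ‖ ^ 2 / (2 * d)))| ≤ 2 * (|a| * ‖θ‖) ^ 4 := by
  have hd' : (1 : ℝ) ≤ d := by exact_mod_cast hd
  set b := |a| * ‖θ‖ with hb
  have hb0 : 0 ≤ b := by positivity
  have hb2 : a ^ 2 * ‖θ‖ ^ 2 = b ^ 2 := by rw [hb, mul_pow, sq_abs]
  have hk : ∀ k, |a * θ k| ≤ b := fun k => by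
    rw [abs_mul]; exact mul_le_mul_of_nonneg_left (PiLp.norm_apply_le θ k) (abs_nonneg a)
  have hsum : ∑ k, (a * θ k) ^ 2 = b ^ 2 := by
    rw [← hb2, EuclideanSpace.norm_sq_eq, Finset.mul_sum]
    exact Finset.sum_congr rfl fun k _ => by rw [Real.norm_eq_abs, sq_abs]; ring
  have h1 : |stepChar a θ - (1 - b ^ 2 / (2 * d))| ≤ b ^ 4 := by
    have e : stepChar a θ - (1 - b ^ 2 / (2 * d)) =
        (∑ k, (cos (a * θ k) - (1 - (a * θ k) ^ 2 / 2))) / d := by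
      rw [Finset.sum_sub_distrib, Finset.sum_sub_distrib, ← Finset.sum_div, hsum, stepChar]
      simp only [Finset.sum_const, Finset.card_univ, Fintype.card_fin, nsmul_eq_mul, mul_one]
      field_simp
    rw [e, abs_div, Nat.abs_cast, div_le_iff₀ (by positivity)]
    refine (Finset.abs_sum_le_sum_abs _ _).trans ?_
    calc _ ≤ ∑ _k : Fin d, b ^ 4 := by
          refine Finset.sum_le_sum fun k _ => ?_
          refine (Real.cos_bound ((hk k).trans h)).trans ?_
          have := pow_le_pow_left₀ (abs_nonneg _) (hk k) 4
          have h4 : 0 ≤ |a * θ k| ^ 4 := by positivity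
          linarith
      _ = _ := by simp [mul_comm]
  set w := b ^ 2 / (2 * d) with hw
  have hw0 : 0 ≤ w := by positivity
  have hwb : w ≤ b ^ 2 := div_le_self (by positivity) (by linarith)
  have hw1 : w ≤ 1 := hwb.trans (pow_le_one₀ hb0 h)
  have h2 := Real.abs_exp_sub_one_sub_id_le (x := -w) (by rwa [abs_neg, abs_of_nonneg hw0])
  have h3 : (-w) ^ 2 ≤ b ^ 4 := by
    rw [neg_sq, show b ^ 4 = (b ^ 2) ^ 2 by ring]
    exact pow_le_pow_left₀ hw0 hwb 2
  rw [hb2]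
  calc _ = |(stepChar a θ - (1 - w)) - (Real.exp (-w) - 1 - -w)| := by congr 1; ring
    _ ≤ |stepChar a θ - (1 - w)| + |Real.exp (-w) - 1 - -w| := abs_sub _ _
    _ ≤ _ := by linarith

lemma abs_prod_sub_prod_le {ι : Type*} (s : Finset ι) {f g : ι → ℝ} (hf : ∀ i ∈ s, |f i| ≤ 1)
    (hg : ∀ i ∈ s, |g i| ≤ 1) : |∏ i ∈ s, f i - ∏ i ∈ s, g i| ≤ ∑ i ∈ s, |f i - g i| := by
  classical
  induction s using Finset.induction_on with
  | empty => simp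
  | insert i s hi ih =>
    rw [Finset.prod_insert hi, Finset.prod_insert hi, Finset.sum_insert hi]
    have h1 := ih (fun j hj => hf j (Finset.mem_insert_of_mem hj))
      (fun j hj => hg j (Finset.mem_insert_of_mem hj))
    have h2 : |∏ i ∈ s, f i| ≤ 1 := by
      rw [Finset.abs_prod]
      exact Finset.prod_le_one (fun _ _ => abs_nonneg _)
        fun j hj => hf j (Finset.mem_insert_of_mem hj)
    calc _ = |(f i - g i) * ∏ i ∈ s, f i + g i * (∏ i ∈ s, f i - ∏ i ∈ s, g i)| := by
          congr 1; ring
      _ ≤ |f i - g i| * |∏ i ∈ s, f i| + |g i| * |∏ i ∈ s, f i - ∏ i ∈ s, g i| := by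
          rw [← abs_mul, ← abs_mul]; exact abs_add_le _ _
      _ ≤ |f i - g i| * 1 + 1 * ∑ i ∈ s, |f i - g i| := by
          gcongr
          exact hg i (Finset.mem_insert_self i s)
      _ = _ := by ring

lemma integral_cexp_VxyaN (k₀ : Fin d) {a : ℝ} (ha : 0 < a) {z : Fin d → ℤ}
    (hz : ∀ k, (x - y) k = a * z k) {N : ℕ} (hN : Even (∑ k, z k + N)) {ι : Type} [Fintype ι]
    {u : ι → ℝ} (hu : ∀ j, u j ∈ Set.Ioo (0 : ℝ) 1) (ξ : ι → Ed d) :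
    ∫ ω : Omega2 x y, Complex.exp (Complex.I * ((∑ j, ⟪ξ j, evalAt ω.1 (u j)⟫ : ℝ) : ℂ))
        ∂(VxyaN x y a N) =
      ((2 * (1 / (2 * π)) ^ d : ℝ) : ℂ) *
        Complex.exp (Complex.I * ((∑ j, ⟪ξ j, x⟫ : ℝ) : ℂ)) *
        ∫ η in halfBox k₀ a, Complex.exp (Complex.I * ((⟪η, x - y⟫ : ℝ) : ℂ)) *
          ((∏ i : Fin N, stepChar a (η + ∑ j, clamp01 (N * u j - (i : ℕ)) • ξ j) : ℝ) : ℂ) := by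
  have hd : 0 < d := Fin.pos k₀
  set ζ : Fin N → Ed d := fun i => ∑ j, clamp01 (N * u j - (i : ℕ)) • ξ j with hζ
  have h1 : ∀ s : {s : Fin N → Fin d × Bool // x + ∑ i, stepVec a (s i) = y},
      Complex.exp (Complex.I * ((∑ j, ⟪ξ j,
        evalAt (pwLin2 x y N (fun i => stepVec a (s.1 i)) s.2).1 (u j)⟫ : ℝ) : ℂ)) =
      Complex.exp (Complex.I * ((∑ j, ⟪ξ j, x⟫ : ℝ) : ℂ)) *
        ∏ i, Complex.exp (Complex.I * ((⟪ζ i, stepVec a (s.1 i)⟫ : ℝ) : ℂ)) := by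
    intro s
    rw [← Complex.exp_sum, ← Complex.exp_add, ← Finset.mul_sum, ← mul_add, ← Complex.ofReal_sum,
      ← Complex.ofReal_add]
    congr 3
    have : ∀ j, ⟪ξ j, evalAt (pwLin2 x y N (fun i => stepVec a (s.1 i)) s.2).1 (u j)⟫ =
        ⟪ξ j, x⟫ + ∑ i : Fin N, clamp01 (N * u j - (i : ℕ)) * ⟪ξ j, stepVec a (s.1 i)⟫ := by
      intro j
      simp only [pwLin2]
      rw [evalAt_pwLinE _ _ (hu j).1.le (hu j).2.le, inner_add_right, inner_sum]
      simp only [real_inner_smul_right]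
    simp only [this, Finset.sum_add_distrib, hζ]
    congr 1
    rw [Finset.sum_comm]
    refine Finset.sum_congr rfl fun i _ => ?_
    rw [sum_inner]
    simp only [real_inner_smul_left]
  rw [integral_VxyaN ha.le hd]
  simp only [h1]
  rw [← Finset.mul_sum, sum_paths_eq_setIntegral k₀ ha hz hN
    fun i p => Complex.exp (Complex.I * ((⟪ζ i, stepVec a p⟫ : ℝ) : ℂ))]
  have h2 : ∀ η : Ed d, ∏ i : Fin N, ∑ p, Complex.exp (Complex.I * ((⟪ζ i, stepVec a p⟫ : ℝ) : ℂ)) *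
      Complex.exp (Complex.I * ((⟪η, stepVec a p⟫ : ℝ) : ℂ)) =
      (((2 * d : ℝ) ^ N : ℝ) : ℂ) * ((∏ i : Fin N, stepChar a (η + ζ i) : ℝ) : ℂ) := by
    intro η
    rw [← Complex.ofReal_mul]
    have h3 : (2 * d : ℝ) ^ N = ∏ _i : Fin N, (2 * d : ℝ) := by simp
    rw [h3, ← Finset.prod_mul_distrib, Complex.ofReal_prod]
    refine Finset.prod_congr rfl fun i _ => ?_
    have h4 : (2 * d : ℝ) * stepChar a (η + ζ i) = 2 * ∑ k, cos (a * (η + ζ i) k) := by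
      rw [stepChar]; field_simp
    rw [h4, ← sum_cexp_stepVec]
    refine Finset.sum_congr rfl fun p _ => ?_
    rw [← Complex.exp_add, inner_add_left]
    push_cast
    ring_nf
  simp only [h2]
  rw [Complex.real_smul]
  have h5 : ∀ η : Ed d, Complex.exp (Complex.I * ((⟪η, x - y⟫ : ℝ) : ℂ)) *
      ((((2 * d : ℝ) ^ N : ℝ) : ℂ) * ((∏ i : Fin N, stepChar a (η + ζ i) : ℝ) : ℂ)) =
      (((2 * d : ℝ) ^ N : ℝ) : ℂ) * (Complex.exp (Complex.I * ((⟪η, x - y⟫ : ℝ) : ℂ)) *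
      ((∏ i : Fin N, stepChar a (η + ζ i) : ℝ) : ℂ)) := fun η => by ring
  simp only [h5]
  rw [integral_const_mul]
  have h6 : a ^ (-(d : ℝ)) * ((2 * d : ℝ) ^ N)⁻¹ * (2 * (a / (2 * π)) ^ d) * (2 * d : ℝ) ^ N =
      2 * (1 / (2 * π)) ^ d := by
    rw [Real.rpow_neg ha.le, Real.rpow_natCast, div_pow, div_pow]
    field_simp
    simp
  rw [← h6]
  push_cast
  ring

lemma integral_gaussian_shift {t : ℝ} (ht : 0 < t) (w μ : Ed d) :
    ∫ η : Ed d, Complex.exp (Complex.I * ((⟪η, w⟫ : ℝ) : ℂ)) *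
      ((Real.exp (-(t / 2) * ‖η + μ‖ ^ 2) : ℝ) : ℂ) =
      (((2 * π / t) ^ ((d : ℝ) / 2) * Real.exp (-‖w‖ ^ 2 / (2 * t)) : ℝ) : ℂ) *
        Complex.exp (-(Complex.I * ((⟪μ, w⟫ : ℝ) : ℂ))) := by
  have h1 := integral_add_right_eq_self (μ := (volume : Measure (Ed d)))
    (fun η : Ed d => Complex.exp (-(Complex.I * ((⟪μ, w⟫ : ℝ) : ℂ))) *
      (Complex.exp (Complex.I * ((⟪η, w⟫ : ℝ) : ℂ)) *
      ((Real.exp (-(t / 2) * ‖η‖ ^ 2) : ℝ) : ℂ))) μ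
  have h2 : ∀ η : Ed d, Complex.exp (-(Complex.I * ((⟪μ, w⟫ : ℝ) : ℂ))) *
      (Complex.exp (Complex.I * ((⟪η + μ, w⟫ : ℝ) : ℂ)) *
      ((Real.exp (-(t / 2) * ‖η + μ‖ ^ 2) : ℝ) : ℂ)) =
      Complex.exp (Complex.I * ((⟪η, w⟫ : ℝ) : ℂ)) *
      ((Real.exp (-(t / 2) * ‖η + μ‖ ^ 2) : ℝ) : ℂ) := by
    intro η
    rw [← mul_assoc, ← Complex.exp_add, inner_add_left]
    congr 2
    push_cast; ring
  simp only [h2] at h1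
  rw [h1, integral_const_mul, mul_comm]
  congr 1
  have h3 := GaussianFourier.integral_cexp_neg_mul_sq_norm_add (V := Ed d) (b := ((t / 2 : ℝ) : ℂ))
    (by simpa using ht) Complex.I w
  have h4 : ∀ η : Ed d, Complex.exp (-((t / 2 : ℝ) : ℂ) * ‖η‖ ^ 2 + Complex.I * ⟪w, η⟫) =
      Complex.exp (Complex.I * ((⟪η, w⟫ : ℝ) : ℂ)) *
      ((Real.exp (-(t / 2) * ‖η‖ ^ 2) : ℝ) : ℂ) := by
    intro η
    rw [Complex.ofReal_exp, ← Complex.exp_add, real_inner_comm, add_comm]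
    push_cast
    rfl
  simp only [h4] at h3
  rw [h3, finrank_euclideanSpace_fin]
  rw [Complex.ofReal_mul, Complex.ofReal_cpow (by positivity), Complex.ofReal_exp]
  have ht' : (t : ℂ) ≠ 0 := by exact_mod_cast ht.ne'
  congr 1
  · push_cast
    congr 1
    field_simp
  · congr 1
    rw [Complex.I_sq]
    push_cast
    field_simp
    norm_num

end StepCharacteristic

section CharFunLimit

variable {d : ℕ} {x y : Ed d} {ι : Type} [Fintype ι]

lemma norm_sum_clamp01_smul_le (N : ℕ) (u : ι → ℝ) (ξ : ι → Ed d) (i : Fin N) :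
    ‖∑ j, clamp01 (N * u j - (i : ℕ)) • ξ j‖ ≤ ∑ j, ‖ξ j‖ := by
  refine (norm_sum_le _ _).trans (Finset.sum_le_sum fun j _ => ?_)
  rw [norm_smul, Real.norm_eq_abs, abs_of_nonneg (clamp01_nonneg _)]
  exact mul_le_of_le_one_left (norm_nonneg _) (clamp01_le_one _)

lemma abs_sum_clamp01_mul_clamp01_sub_le (N : ℕ) {s t : ℝ} (hs : s ∈ Set.Ioo (0 : ℝ) 1)
    (ht : t ∈ Set.Ioo (0 : ℝ) 1) :
    |∑ i : Fin N, clamp01 (N * s - (i : ℕ)) * clamp01 (N * t - (i : ℕ)) - N * min s t| ≤ 1 := by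
  rcases le_total s t with h | h
  · rw [min_eq_left h]
    exact abs_sum_clamp01_mul_sub_le N hs.1.le hs.2.le h
  · rw [min_eq_right h]
    simp only [mul_comm (clamp01 (N * s - _))]
    exact abs_sum_clamp01_mul_sub_le N ht.1.le ht.2.le h

lemma abs_sum_norm_sq_sub_le (N : ℕ) {u : ι → ℝ} (hu : ∀ j, u j ∈ Set.Ioo (0 : ℝ) 1)
    (ξ : ι → Ed d) (η : Ed d) :
    |∑ i : Fin N, ‖η + ∑ j, clamp01 (N * u j - (i : ℕ)) • ξ j‖ ^ 2 -
      N * (‖η‖ ^ 2 + 2 * ⟪η, ∑ j, u j • ξ j⟫ + ∑ j, ∑ l, min (u j) (u l) * ⟪ξ j, ξ l⟫)| ≤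
      ∑ j, ∑ l, |⟪ξ j, ξ l⟫| := by
  have h1 : ∑ i : Fin N, ⟪η, ∑ j, clamp01 (N * u j - (i : ℕ)) • ξ j⟫ =
      N * ⟪η, ∑ j, u j • ξ j⟫ := by
    rw [← inner_sum, Finset.sum_comm]
    simp only [← Finset.sum_smul, sum_fin_clamp01 N (hu _).1.le (hu _).2.le]
    simp only [mul_smul, ← Finset.smul_sum, real_inner_smul_right]
  have h2 : ∑ i : Fin N, ‖∑ j, clamp01 (N * u j - (i : ℕ)) • ξ j‖ ^ 2 =
      ∑ j, ∑ l, (∑ i : Fin N, clamp01 (N * u j - (i : ℕ)) * clamp01 (N * u l - (i : ℕ))) *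
        ⟪ξ j, ξ l⟫ := by
    simp only [← real_inner_self_eq_norm_sq, sum_inner, inner_sum, real_inner_smul_left,
      real_inner_smul_right, Finset.sum_mul]
    rw [Finset.sum_comm]
    refine Finset.sum_congr rfl fun j _ => ?_
    rw [Finset.sum_comm]
    exact Finset.sum_congr rfl fun l _ => Finset.sum_congr rfl fun i _ => by
      rw [real_inner_comm]; ring
  have h3 : ∑ i : Fin N, ‖η + ∑ j, clamp01 (N * u j - (i : ℕ)) • ξ j‖ ^ 2 -
      N * (‖η‖ ^ 2 + 2 * ⟪η, ∑ j, u j • ξ j⟫ + ∑ j, ∑ l, min (u j) (u l) * ⟪ξ j, ξ l⟫) =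
      ∑ j, ∑ l, (∑ i : Fin N, clamp01 (N * u j - (i : ℕ)) * clamp01 (N * u l - (i : ℕ)) -
        N * min (u j) (u l)) * ⟪ξ j, ξ l⟫ := by
    simp only [norm_add_sq_real, Finset.sum_add_distrib, ← Finset.mul_sum, h1, h2, sub_mul,
      Finset.sum_sub_distrib, mul_assoc]
    simp
    ring
  rw [h3]
  refine (Finset.abs_sum_le_sum_abs _ _).trans (Finset.sum_le_sum fun j _ => ?_)
  refine (Finset.abs_sum_le_sum_abs _ _).trans (Finset.sum_le_sum fun l _ => ?_)
  rw [abs_mul]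
  exact mul_le_of_le_one_left (abs_nonneg _) (abs_sum_clamp01_mul_clamp01_sub_le N (hu j) (hu l))

variable {a : ℕ → ℝ} {N : ℕ → ℕ} {t : ℝ}

lemma tendsto_prod_stepChar (hd : 0 < d) (ha0 : Tendsto a atTop (𝓝 0))
    (hN : Tendsto (fun k => a k ^ 2 * N k / d) atTop (𝓝 t))
    {u : ι → ℝ} (hu : ∀ j, u j ∈ Set.Ioo (0 : ℝ) 1) (ξ : ι → Ed d) (η : Ed d) :
    Tendsto (fun k => ∏ i : Fin (N k),
      stepChar (a k) (η + ∑ j, clamp01 (N k * u j - (i : ℕ)) • ξ j)) atTop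
      (𝓝 (Real.exp (-(t / 2) * (‖η‖ ^ 2 + 2 * ⟪η, ∑ j, u j • ξ j⟫ +
        ∑ j, ∑ l, min (u j) (u l) * ⟪ξ j, ξ l⟫)))) := by
  have hd' : (0 : ℝ) < d := by exact_mod_cast hd
  set Q := ‖η‖ ^ 2 + 2 * ⟪η, ∑ j, u j • ξ j⟫ + ∑ j, ∑ l, min (u j) (u l) * ⟪ξ j, ξ l⟫ with hQ
  set R := ‖η‖ + ∑ j, ‖ξ j‖ with hR
  set Z : ∀ k, Fin (N k) → Ed d := fun k i => η + ∑ j, clamp01 (N k * u j - (i : ℕ)) • ξ j with hZ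
  have hR0 : 0 ≤ R := by positivity
  have hZR : ∀ k i, ‖Z k i‖ ≤ R := fun k i =>
    (norm_add_le _ _).trans (add_le_add_right (norm_sum_clamp01_smul_le _ _ _ _) _)
  have hmain : Tendsto (fun k => Real.exp (-(a k ^ 2 / (2 * d) * ∑ i, ‖Z k i‖ ^ 2))) atTop
      (𝓝 (Real.exp (-(t / 2) * Q))) := by
    refine (Real.continuous_exp.tendsto _).comp ?_
    rw [neg_mul]
    refine Tendsto.neg ?_
    have h1 : Tendsto (fun k => a k ^ 2 / (2 * d) * (∑ i, ‖Z k i‖ ^ 2 - N k * Q)) atTop (𝓝 0) := by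
      refine squeeze_zero_norm (a := fun k => a k ^ 2 / (2 * d) * ∑ j, ∑ l, |⟪ξ j, ξ l⟫|)
        (fun k => ?_) ?_
      · rw [norm_mul, Real.norm_eq_abs, Real.norm_eq_abs, abs_of_nonneg (by positivity)]
        exact mul_le_mul_of_nonneg_left (abs_sum_norm_sq_sub_le (N k) hu ξ η) (by positivity)
      · have := ((ha0.pow 2).div_const (2 * (d : ℝ))).mul_const (∑ j, ∑ l, |⟪ξ j, ξ l⟫|)
        simpa using this
    have h2 := h1.add ((hN.div_const 2).mul_const Q)
    rw [zero_add] at h2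
    refine h2.congr fun k => ?_
    field_simp
    ring
  have hdiff : Tendsto (fun k => ∏ i, stepChar (a k) (Z k i) -
      Real.exp (-(a k ^ 2 / (2 * d) * ∑ i, ‖Z k i‖ ^ 2))) atTop (𝓝 0) := by
    have hsmall : ∀ᶠ k in atTop, |a k| * R ≤ 1 := by
      have : Tendsto (fun k => |a k| * R) atTop (𝓝 0) := by
        simpa using ha0.abs.mul_const R
      exact (this.eventually_lt_const one_pos).mono fun _ h => h.le
    refine squeeze_zero_norm' (a := fun k => 2 * (a k ^ 2 * N k / d * d) * (a k ^ 2 * R ^ 4)) ?_ ?_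
    · filter_upwards [hsmall] with k hk
      have hexp : Real.exp (-(a k ^ 2 / (2 * d) * ∑ i, ‖Z k i‖ ^ 2)) =
          ∏ i, Real.exp (-(a k ^ 2 * ‖Z k i‖ ^ 2 / (2 * d))) := by
        rw [← Real.exp_sum, Finset.sum_neg_distrib, Finset.mul_sum]
        congr 2
        exact Finset.sum_congr rfl fun i _ => by ring
      rw [hexp, Real.norm_eq_abs]
      refine (abs_prod_sub_prod_le _ (fun i _ => abs_stepChar_le_one _ _) fun i _ => ?_).trans ?_
      · rw [Real.abs_exp, Real.exp_le_one_iff, neg_nonpos]; positivity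
      have hi : ∀ i ∈ Finset.univ, |stepChar (a k) (Z k i) -
          Real.exp (-(a k ^ 2 * ‖Z k i‖ ^ 2 / (2 * d)))| ≤ 2 * (|a k| * R) ^ 4 := fun i _ => by
        have hle : |a k| * ‖Z k i‖ ≤ |a k| * R :=
          mul_le_mul_of_nonneg_left (hZR k i) (abs_nonneg _)
        refine (abs_stepChar_sub_exp_le hd (hle.trans hk)).trans ?_
        have := pow_le_pow_left₀ (by positivity) hle 4
        linarith
      refine (Finset.sum_le_sum hi).trans_eq ?_
      have h4 : |a k| ^ 4 = a k ^ 4 := by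
        rw [show 4 = 2 * 2 by norm_num, pow_mul, pow_mul, sq_abs]
      rw [Finset.sum_const, Finset.card_univ, Fintype.card_fin, nsmul_eq_mul, mul_pow, h4]
      field_simp
    · have := ((hN.mul_const (d : ℝ)).const_mul 2).mul ((ha0.pow 2).mul_const (R ^ 4))
      simpa using this
  have := hdiff.add hmain
  simpa using this

end CharFunLimit

section MarginalLimit

variable {d : ℕ} {x y : Ed d} {ι : Type} [Fintype ι] {a : ℕ → ℝ} {N : ℕ → ℕ} {t : ℝ}

lemma integrable_exp_neg_mul_norm_sq {b : ℝ} (hb : 0 < b) :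
    Integrable (fun η : Ed d => Real.exp (-b * ‖η‖ ^ 2)) := by
  by_contra hcon
  have h1 := integral_undef hcon
  rw [GaussianFourier.integral_rexp_neg_mul_sq_norm hb] at h1
  have : 0 < (π / b) ^ ((Module.finrank ℝ (Ed d) : ℝ) / 2) := by positivity
  exact this.ne' h1

lemma eventually_mem_halfBox (k₀ : Fin d) (ha : ∀ k, 0 < a k) (ha0 : Tendsto a atTop (𝓝 0))
    (η : Ed d) : ∀ᶠ k in atTop, η ∈ halfBox k₀ (a k) := by
  have h1 : Tendsto (fun k => a k * ‖η‖) atTop (𝓝 0) := by simpa using ha0.mul_const ‖η‖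
  filter_upwards [h1.eventually_lt_const (show (0 : ℝ) < π / 2 by positivity)] with k hk
  intro j
  have h2 : |η j| ≤ π / (2 * a k) := by
    rw [le_div_iff₀ (by linarith [ha k])]
    have := mul_le_mul_of_nonneg_left (PiLp.norm_apply_le η j) (ha k).le
    rw [Real.norm_eq_abs] at this
    linarith
  have h3 : π / (2 * a k) ≤ π / a k :=
    div_le_div_of_nonneg_left pi_pos.le (ha k) (by linarith [ha k])
  rw [Set.mem_Icc, ← abs_le]
  split_ifs
  · exact h2
  · exact h2.trans h3

lemma abs_prod_stepChar_le (hd : 0 < d) {k₀ : Fin d} {b : ℝ} (hb : 0 < b) {n : ℕ} {R : ℝ}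
    (hbR : b * R ≤ π / 6) {ζ : Fin n → Ed d} (hζ : ∀ i, ‖ζ i‖ ≤ R) {η : Ed d}
    (hη : η ∈ halfBox k₀ b) :
    |∏ i, stepChar b (η + ζ i)| ≤
      Real.exp (decay d * (b ^ 2 * n) * R ^ 2 - decay d * (b ^ 2 * n) / 2 * ‖η‖ ^ 2) := by
  have hdec := decay_pos hd
  obtain ⟨h0, h1⟩ := abs_mul_le_of_mem_halfBox hb hη
  have hcoord : ∀ i k, |b * ζ i k| ≤ π / 6 := fun i k => by
    rw [abs_mul, abs_of_pos hb]
    exact (mul_le_mul_of_nonneg_left ((PiLp.norm_apply_le (ζ i) k).trans (hζ i)) hb.le).trans hbR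
  have hadd : ∀ i k, |b * (η + ζ i) k| ≤ |b * η k| + π / 6 := fun i k => by
    rw [PiLp.add_apply, mul_add]
    exact (abs_add_le _ _).trans (add_le_add_right (hcoord i k) _)
  have hstep : ∀ i ∈ Finset.univ, |stepChar b (η + ζ i)| ≤
      Real.exp (decay d * b ^ 2 * (R ^ 2 - ‖η‖ ^ 2 / 2)) := fun i _ => by
    refine (abs_stepChar_le hd (k₀ := k₀) ?_ fun k => ?_).trans (Real.exp_le_exp.2 ?_)
    · linarith [hadd i k₀]
    · linarith [hadd i k, h1 k, pi_pos]
    · have h2 : ‖η‖ ≤ ‖η + ζ i‖ + R := by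
        have := norm_sub_le (η + ζ i) (ζ i)
        rw [add_sub_cancel_right] at this
        linarith [hζ i]
      have h3 : ‖η‖ ^ 2 / 2 - R ^ 2 ≤ ‖η + ζ i‖ ^ 2 := by
        have := pow_le_pow_left₀ (norm_nonneg _) h2 2
        nlinarith [sq_nonneg (‖η + ζ i‖ - R)]
      have := mul_le_mul_of_nonneg_left h3 (by positivity : 0 ≤ decay d * b ^ 2)
      linarith
  rw [Finset.abs_prod]
  refine (Finset.prod_le_prod (fun _ _ => abs_nonneg _) hstep).trans_eq ?_
  rw [Finset.prod_const, Finset.card_univ, Fintype.card_fin, ← Real.exp_nat_mul]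
  congr 1
  ring

lemma tendsto_setIntegral_stepChar (k₀ : Fin d) (ha : ∀ k, 0 < a k)
    (ha0 : Tendsto a atTop (𝓝 0)) (ht : 0 < t)
    (hN : Tendsto (fun k => a k ^ 2 * N k / d) atTop (𝓝 t))
    {u : ι → ℝ} (hu : ∀ j, u j ∈ Set.Ioo (0 : ℝ) 1) (ξ : ι → Ed d) (w : Ed d) :
    Tendsto (fun k => ∫ η in halfBox k₀ (a k), Complex.exp (Complex.I * ((⟪η, w⟫ : ℝ) : ℂ)) *
        ((∏ i : Fin (N k), stepChar (a k)
          (η + ∑ j, clamp01 (N k * u j - (i : ℕ)) • ξ j) : ℝ) : ℂ)) atTop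
      (𝓝 (∫ η : Ed d, Complex.exp (Complex.I * ((⟪η, w⟫ : ℝ) : ℂ)) *
        ((Real.exp (-(t / 2) * (‖η‖ ^ 2 + 2 * ⟪η, ∑ j, u j • ξ j⟫ +
          ∑ j, ∑ l, min (u j) (u l) * ⟪ξ j, ξ l⟫)) : ℝ) : ℂ))) := by
  have hd : 0 < d := Fin.pos k₀
  have hd' : (0 : ℝ) < d := by exact_mod_cast hd
  have hdec := decay_pos hd
  set R := ∑ j, ‖ξ j‖ with hR
  simp_rw [← integral_indicator (measurableSet_halfBox k₀ _)]
  have hsmall : ∀ᶠ k in atTop, a k * R ≤ π / 6 := by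
    have : Tendsto (fun k => a k * R) atTop (𝓝 0) := by simpa using ha0.mul_const R
    exact (this.eventually_lt_const (by positivity)).mono fun _ h => h.le
  refine tendsto_integral_filter_of_dominated_convergence
    (fun η => Real.exp (decay d * (2 * t * d) * R ^ 2) *
      Real.exp (-(decay d * (t / 2 * d) / 2) * ‖η‖ ^ 2)) ?_ ?_ ?_ ?_
  · refine Eventually.of_forall fun k => ?_
    refine (Continuous.aestronglyMeasurable ?_).indicator (measurableSet_halfBox k₀ _)
    refine Continuous.mul (by fun_prop) (Complex.continuous_ofReal.comp ?_)
    exact continuous_finsetProd _ fun i _ => (continuous_stepChar _).comp (by fun_prop)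
  · filter_upwards [hsmall, hN.eventually_lt_const (show t < 2 * t by linarith),
      hN.eventually_const_lt (show t / 2 < t by linarith)] with k hk h2 h1
    rw [div_lt_iff₀ hd'] at h2
    rw [lt_div_iff₀ hd'] at h1
    refine Eventually.of_forall fun η => ?_
    by_cases hη : η ∈ halfBox k₀ (a k)
    · rw [Set.indicator_of_mem hη, norm_mul, mul_comm Complex.I, Complex.norm_exp_ofReal_mul_I,
        one_mul, Complex.norm_real, Real.norm_eq_abs, ← Real.exp_add]
      refine (abs_prod_stepChar_le hd (ha k) hk
        (norm_sum_clamp01_smul_le (N k) u ξ) hη).trans (Real.exp_le_exp.2 ?_)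
      have e1 := mul_le_mul_of_nonneg_right h2.le (by positivity : 0 ≤ decay d * R ^ 2)
      have e2 := mul_le_mul_of_nonneg_right h1.le (by positivity : 0 ≤ decay d / 2 * ‖η‖ ^ 2)
      linarith
    · rw [Set.indicator_of_notMem hη, norm_zero]; positivity
  · exact (integrable_exp_neg_mul_norm_sq (by positivity)).const_mul _
  · refine Eventually.of_forall fun η => ?_
    have h1 := ((Complex.continuous_ofReal.tendsto _).comp
      (tendsto_prod_stepChar hd ha0 hN hu ξ η)).const_mul
        (Complex.exp (Complex.I * ((⟪η, w⟫ : ℝ) : ℂ)))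
    refine h1.congr' ?_
    filter_upwards [eventually_mem_halfBox k₀ ha ha0 η] with k hk
    rw [Set.indicator_of_mem hk]
    rfl

lemma tendsto_integral_cexp_VxyaN (hd : 0 < d) (ha : ∀ k, 0 < a k) (ha0 : Tendsto a atTop (𝓝 0))
    {z : ℕ → Fin d → ℤ} (hz : ∀ k j, (x - y) j = a k * z k j)
    (hpar : ∀ k, Even (∑ j, z k j + N k)) (ht : 0 < t)
    (hN : Tendsto (fun k => a k ^ 2 * N k / d) atTop (𝓝 t))
    {u : ι → ℝ} (hu : ∀ j, u j ∈ Set.Ioo (0 : ℝ) 1) (ξ : ι → Ed d) :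
    Tendsto (fun k => ∫ ω : Omega2 x y,
        Complex.exp (Complex.I * ((∑ j, ⟪ξ j, evalAt ω.1 (u j)⟫ : ℝ) : ℂ))
        ∂(VxyaN x y (a k) (N k))) atTop
      (𝓝 (((2 * ((2 * π * t) ^ (-(d : ℝ) / 2) * Real.exp (-‖x - y‖ ^ 2 / (2 * t))) : ℝ) : ℂ) *
        Complex.exp (((-(t / 2) * ∑ j, ∑ l, (min (u j) (u l) - u j * u l) * ⟪ξ j, ξ l⟫ : ℝ) : ℂ) +
        Complex.I * ((∑ j, ⟪ξ j, (1 - u j) • x + u j • y⟫ : ℝ) : ℂ)))) := by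
  let k₀ : Fin d := ⟨0, hd⟩
  simp_rw [fun k => integral_cexp_VxyaN k₀ (ha k) (hz k) (hpar k) hu ξ]
  have h1 := (tendsto_setIntegral_stepChar k₀ ha ha0 ht hN hu ξ (x - y)).const_mul
    (((2 * (1 / (2 * π)) ^ d : ℝ) : ℂ) * Complex.exp (Complex.I * ((∑ j, ⟪ξ j, x⟫ : ℝ) : ℂ)))
  convert h1 using 2
  set mm := ∑ j, u j • ξ j with hmm
  have hsq : ‖mm‖ ^ 2 = ∑ j, ∑ l, u j * u l * ⟪ξ j, ξ l⟫ := by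
    rw [← real_inner_self_eq_norm_sq, hmm, sum_inner]
    refine Finset.sum_congr rfl fun j _ => ?_
    rw [inner_sum]
    exact Finset.sum_congr rfl fun l _ => by
      rw [real_inner_smul_left, real_inner_smul_right]; ring
  have hQ : ∀ η : Ed d, Complex.exp (Complex.I * ((⟪η, x - y⟫ : ℝ) : ℂ)) *
        ((Real.exp (-(t / 2) * (‖η‖ ^ 2 + 2 * ⟪η, mm⟫ +
          ∑ j, ∑ l, min (u j) (u l) * ⟪ξ j, ξ l⟫)) : ℝ) : ℂ) =
      ((Real.exp (-(t / 2) * ∑ j, ∑ l, (min (u j) (u l) - u j * u l) * ⟪ξ j, ξ l⟫) : ℝ) : ℂ) *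
      (Complex.exp (Complex.I * ((⟪η, x - y⟫ : ℝ) : ℂ)) *
        ((Real.exp (-(t / 2) * ‖η + mm‖ ^ 2) : ℝ) : ℂ)) := fun η => by
    rw [mul_left_comm, ← Complex.ofReal_mul, ← Real.exp_add]
    congr 3
    simp only [sub_mul, Finset.sum_sub_distrib, ← hsq, norm_add_sq_real]
    ring
  simp_rw [hQ]
  rw [integral_const_mul, integral_gaussian_shift ht]
  have hphase : ∑ j, ⟪ξ j, (1 - u j) • x + u j • y⟫ = ∑ j, ⟪ξ j, x⟫ - ⟪mm, x - y⟫ := by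
    rw [hmm, sum_inner, ← Finset.sum_sub_distrib]
    refine Finset.sum_congr rfl fun j _ => ?_
    rw [real_inner_smul_left, inner_add_right, real_inner_smul_right, real_inner_smul_right,
      inner_sub_right]
    ring
  have hconst : (2 * (1 / (2 * π)) ^ d : ℝ) * (2 * π / t) ^ ((d : ℝ) / 2) =
      2 * (2 * π * t) ^ (-(d : ℝ) / 2) := by
    have hp : (0 : ℝ) < 2 * π := by positivity
    rw [mul_assoc]
    congr 1
    rw [← Real.rpow_natCast, one_div, Real.inv_rpow hp.le, ← Real.rpow_neg hp.le,
      Real.div_rpow hp.le ht.le, Real.mul_rpow hp.le ht.le, div_eq_mul_inv, ← Real.rpow_neg ht.le,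
      ← mul_assoc, ← Real.rpow_add hp]
    congr 2 <;> ring
  have hsplit : Complex.I * ((∑ j, ⟪ξ j, x⟫ - ⟪mm, x - y⟫ : ℝ) : ℂ) =
      Complex.I * ((∑ j, ⟪ξ j, x⟫ : ℝ) : ℂ) + -(Complex.I * ((⟪mm, x - y⟫ : ℝ) : ℂ)) := by
    push_cast; ring
  rw [hphase, Complex.exp_add, hsplit, Complex.exp_add, ← mul_assoc (2 : ℝ), ← hconst,
    ← Complex.ofReal_exp]
  generalize Complex.exp (Complex.I * ((∑ j, ⟪ξ j, x⟫ : ℝ) : ℂ)) = E₁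
  generalize Complex.exp (-(Complex.I * ((⟪mm, x - y⟫ : ℝ) : ℂ))) = E₂
  generalize Real.exp (-(t / 2) * _) = E₃
  simp only [Complex.ofReal_mul]
  ring

end MarginalLimit

section WeakLimit

variable {d : ℕ} {x y : Ed d}

lemma interpPath_samplePath_apply (M : ℕ) (ω : Omega2 x y) (t : unitInterval) :
    (interpPath x y M (samplePath M ω)).1 t = evalAt ω.1 ((0 : ℕ) / (M + 1)) +
      ∑ i ∈ Finset.range (M + 1), clamp01 ((M + 1 : ℝ) * t - i) •
        (evalAt ω.1 ((i + 1 : ℕ) / (M + 1)) - evalAt ω.1 ((i : ℕ) / (M + 1))) := by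
  change x + ∑ i : Fin (M + 1), clamp01 (((M + 1 : ℕ) : ℝ) * (t : ℝ) - ((i : ℕ) : ℝ)) •
    (pinPts x y (samplePath M ω) ((i : ℕ) + 1) - pinPts x y (samplePath M ω) (i : ℕ)) = _
  congr 1
  · simp [evalAt_zero]
  · rw [← Fin.sum_univ_eq_sum_range (fun i => clamp01 ((M + 1 : ℝ) * (t : ℝ) - i) •
      (evalAt ω.1 ((i + 1 : ℕ) / (M + 1)) - evalAt ω.1 ((i : ℕ) / (M + 1)))) (M + 1)]
    refine Finset.sum_congr rfl fun i _ => ?_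
    rw [pinPts_samplePath M ω (by omega), pinPts_samplePath M ω (by omega)]
    push_cast
    rfl

lemma tendsto_interpPath_samplePath (ω : Omega2 x y) :
    Tendsto (fun M => interpPath x y M (samplePath M ω)) atTop (𝓝 ω) := by
  have huc : UniformContinuous (evalAt ω.1) :=
    (CompactSpace.uniformContinuous_of_continuous ω.1.continuous).comp
      (LipschitzWith.projIcc zero_le_one).uniformContinuous
  rw [Metric.tendsto_atTop]
  intro ε hε
  obtain ⟨δ, hδ, hδε⟩ := Metric.uniformContinuous_iff.1 huc (ε / 3) (by positivity)
  obtain ⟨M₀, hM₀⟩ := exists_nat_one_div_lt hδ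
  refine ⟨M₀, fun M hM => ?_⟩
  have hM0 : (0 : ℝ) < M + 1 := by positivity
  have hMδ : 1 / ((M : ℝ) + 1) < δ := by
    refine lt_of_le_of_lt ?_ hM₀
    have : (M₀ : ℝ) ≤ M := by exact_mod_cast hM
    exact one_div_le_one_div_of_le (by positivity) (by linarith)
  rw [Subtype.dist_eq]
  refine lt_of_le_of_lt ((ContinuousMap.dist_le (by positivity : 0 ≤ 2 * (ε / 3))).2 fun t => ?_)
    (by linarith)
  have ht0 := t.2.1
  have ht1 := t.2.2
  rw [dist_eq_norm, interpPath_samplePath_apply]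
  have h1 := norm_sum_clamp01_smul_sub_le (g := fun j => evalAt ω.1 ((j : ℕ) / (M + 1)))
    (N := M + 1) (r := (M + 1) * t) (B := ε / 3) (by positivity)
    (by push_cast; nlinarith) (by positivity) fun j _ => by
      rw [← dist_eq_norm]
      refine (hδε ?_).le
      rw [Real.dist_eq, ← sub_div]
      push_cast
      rw [add_sub_cancel_left, abs_of_pos (by positivity)]
      exact hMδ
  have h2 : ‖evalAt ω.1 ((⌊((M : ℝ) + 1) * t⌋₊ : ℕ) / (M + 1)) - ω.1 t‖ ≤ ε / 3 := by
    rw [← evalAt_coe, ← dist_eq_norm]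
    refine (hδε ?_).le
    have e1 := Nat.floor_le (show 0 ≤ ((M : ℝ) + 1) * t by positivity)
    have e2 := Nat.lt_floor_add_one (((M : ℝ) + 1) * t)
    refine lt_of_le_of_lt ?_ hMδ
    rw [Real.dist_eq, abs_le]
    have e3 : (⌊((M : ℝ) + 1) * t⌋₊ : ℝ) / (M + 1) - t =
        (⌊((M : ℝ) + 1) * t⌋₊ - (M + 1) * t) / (M + 1) := by field_simp
    rw [e3, ← neg_div, div_le_div_iff_of_pos_right hM0, div_le_div_iff_of_pos_right hM0]
    constructor <;> linarith
  have h3 := norm_add_le_of_le h1 h2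
  rw [sub_add_sub_cancel] at h3
  linarith

lemma charFun_map_samplePath (M : ℕ) (μ : Measure (Omega2 x y)) (ξ : PiLp 2 fun _ : Fin M => Ed d) :
    charFun (μ.map fun ω => WithLp.toLp 2 (samplePath M ω)) ξ =
      ∫ ω : Omega2 x y, Complex.exp (Complex.I *
        ((∑ j : Fin M, ⟪ξ j, evalAt ω.1 (((j : ℕ) + 1) / (M + 1))⟫ : ℝ) : ℂ)) ∂μ := by
  have hc : Continuous fun ω : Omega2 x y => WithLp.toLp 2 (samplePath M ω) :=
    (PiLp.continuous_toLp 2 _).comp (continuous_samplePath M)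
  rw [charFun_apply, integral_map hc.measurable.aemeasurable (by fun_prop)]
  refine integral_congr_ae (Eventually.of_forall fun ω => ?_)
  simp only [PiLp.inner_apply]
  rw [mul_comm]
  congr 3
  refine Finset.sum_congr rfl fun j _ => ?_
  exact Finset.sum_congr rfl fun i _ => real_inner_comm _ _

lemma tendsto_integral_comp_samplePath {P : ℕ → ProbabilityMeasure (Omega2 x y)}
    {μ : ProbabilityMeasure (Omega2 x y)}
    (h : ∀ (M : ℕ) (u : Fin M → ℝ), (∀ j, u j ∈ Set.Ioo (0 : ℝ) 1) → ∀ ξ : Fin M → Ed d,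
      Tendsto (fun k => ∫ ω : Omega2 x y,
        Complex.exp (Complex.I * ((∑ j, ⟪ξ j, evalAt ω.1 (u j)⟫ : ℝ) : ℂ)) ∂(P k : Measure _)) atTop
      (𝓝 (∫ ω : Omega2 x y,
        Complex.exp (Complex.I * ((∑ j, ⟪ξ j, evalAt ω.1 (u j)⟫ : ℝ) : ℂ)) ∂(μ : Measure _))))
    (M : ℕ) {g : (Fin M → Ed d) → ℝ} (hg : Continuous g) {C : ℝ} (hC : ∀ v, |g v| ≤ C) :
    Tendsto (fun k => ∫ ω, g (samplePath M ω) ∂(P k : Measure (Omega2 x y))) atTop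
      (𝓝 (∫ ω, g (samplePath M ω) ∂(μ : Measure (Omega2 x y)))) := by
  have hc : Continuous fun ω : Omega2 x y => WithLp.toLp 2 (samplePath M ω) :=
    (PiLp.continuous_toLp 2 _).comp (continuous_samplePath M)
  have hlevy : Tendsto (fun k => (P k).map (f := fun ω => WithLp.toLp 2 (samplePath M ω))
      hc.measurable.aemeasurable) atTop (𝓝 (μ.map hc.measurable.aemeasurable)) := by
    refine ProbabilityMeasure.tendsto_of_tendsto_charFun fun ξ => ?_
    simp only [ProbabilityMeasure.toMeasure_map, charFun_map_samplePath]
    refine h M _ (fun j => ⟨by positivity, ?_⟩) _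
    rw [div_lt_one (by positivity)]
    exact_mod_cast Nat.succ_lt_succ j.2
  have hgc : Continuous fun v : PiLp 2 fun _ : Fin M => Ed d => g (WithLp.ofLp v) :=
    hg.comp (PiLp.continuous_ofLp 2 _)
  have := (ProbabilityMeasure.tendsto_iff_forall_integral_tendsto.1 hlevy)
    (BoundedContinuousFunction.ofNormedAddCommGroup _ hgc C fun v => hC _)
  simp only [ProbabilityMeasure.toMeasure_map] at this
  simpa only [BoundedContinuousFunction.coe_ofNormedAddCommGroup,
    integral_map hc.measurable.aemeasurable hgc.aestronglyMeasurable] using this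

lemma tendsto_of_tendsto_charFun_of_lintegral_edist_le
    {P : ℕ → ProbabilityMeasure (Omega2 x y)} {μ : ProbabilityMeasure (Omega2 x y)}
    (h : ∀ (M : ℕ) (u : Fin M → ℝ), (∀ j, u j ∈ Set.Ioo (0 : ℝ) 1) → ∀ ξ : Fin M → Ed d,
      Tendsto (fun k => ∫ ω : Omega2 x y,
        Complex.exp (Complex.I * ((∑ j, ⟪ξ j, evalAt ω.1 (u j)⟫ : ℝ) : ℂ)) ∂(P k : Measure _)) atTop
      (𝓝 (∫ ω : Omega2 x y,
        Complex.exp (Complex.I * ((∑ j, ⟪ξ j, evalAt ω.1 (u j)⟫ : ℝ) : ℂ)) ∂(μ : Measure _))))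
    {C : ℝ} (hC : 0 ≤ C) (hE : ∀ k M n : ℕ, 1 ≤ n → M + 1 = 2 ^ n →
      ∫⁻ ω, edist (interpPath x y M (samplePath M ω)) ω ∂(P k : Measure (Omega2 x y)) ≤
        ENNReal.ofReal (C * dyadRatio ^ n)) :
    Tendsto P atTop (𝓝 μ) := by
  rw [tendsto_iff_forall_lipschitz_integral_tendsto]
  rintro f ⟨B, hB⟩ ⟨L, hL⟩
  have hcont := hL.continuous
  let ω₀ : Omega2 x y := interpPath x y 0 fun _ => x
  have hf : ∀ ω, |f ω| ≤ |f ω₀| + B := fun ω => by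
    have h1 := hB ω ω₀
    rw [Real.dist_eq] at h1
    have h2 := abs_sub_abs_le_abs_sub (f ω) (f ω₀)
    linarith
  have hr0 := dyadRatio_pos
  have hr1 := dyadRatio_lt_one
  let M : ℕ → ℕ := fun n => 2 ^ n - 1
  have hM : ∀ n, M n + 1 = 2 ^ n := fun n => Nat.sub_add_cancel Nat.one_le_two_pow
  have hMtop : Tendsto M atTop atTop := by
    refine tendsto_atTop_mono (fun n => ?_) tendsto_id
    have h1 := hM n
    have h2 : n < 2 ^ n := Nat.lt_two_pow_self
    simp only [id]
    omega
  have hGc : ∀ n, Continuous fun ω : Omega2 x y => f (interpPath x y (M n) (samplePath (M n) ω)) :=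
    fun n => hcont.comp ((continuous_interpPath _).comp (continuous_samplePath _))
  have hintegral : ∀ (ν : ProbabilityMeasure (Omega2 x y)) {g : Omega2 x y → ℝ}, Continuous g →
      (∀ ω, |g ω| ≤ |f ω₀| + B) → Integrable g (ν : Measure (Omega2 x y)) := fun ν g hg hgb =>
    Integrable.of_bound hg.aestronglyMeasurable (|f ω₀| + B) (Eventually.of_forall hgb)
  have hμ : Tendsto (fun n => ∫ ω, f (interpPath x y (M n) (samplePath (M n) ω))
      ∂(μ : Measure (Omega2 x y))) atTop (𝓝 (∫ ω, f ω ∂(μ : Measure (Omega2 x y)))) := by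
    refine tendsto_integral_of_dominated_convergence (fun _ => |f ω₀| + B)
      (fun n => (hGc n).aestronglyMeasurable) (integrable_const _)
      (fun n => Eventually.of_forall fun ω => hf _) (Eventually.of_forall fun ω => ?_)
    exact (hcont.tendsto ω).comp ((tendsto_interpPath_samplePath ω).comp hMtop)
  have hLC : Tendsto (fun n => (L : ℝ) * (C * dyadRatio ^ n)) atTop (𝓝 0) := by
    have := ((tendsto_pow_atTop_nhds_zero_of_lt_one hr0.le hr1).const_mul C).const_mul (L : ℝ)
    simpa using this
  have hdiff : ∀ k n, 1 ≤ n → |∫ ω, f (interpPath x y (M n) (samplePath (M n) ω))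
      ∂(P k : Measure (Omega2 x y)) - ∫ ω, f ω ∂(P k : Measure (Omega2 x y))| ≤
      L * (C * dyadRatio ^ n) := fun k n hn => by
    rw [← integral_sub (hintegral _ (hGc n) fun ω => hf _) (hintegral _ hcont hf),
      ← Real.norm_eq_abs,
      ← ENNReal.ofReal_le_ofReal_iff (by positivity), ofReal_norm]
    refine (enorm_integral_le_lintegral_enorm _).trans ?_
    rw [ENNReal.ofReal_mul (NNReal.coe_nonneg L)]
    refine le_trans ?_ (mul_le_mul_right (hE k (M n) n hn (hM n)) _)
    rw [← lintegral_const_mul' _ _ ENNReal.ofReal_ne_top]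
    refine lintegral_mono fun ω => ?_
    rw [← edist_eq_enorm_sub, ENNReal.ofReal_coe_nnreal]
    exact hL _ _
  rw [Metric.tendsto_atTop]
  intro ε hε
  obtain ⟨n, hn1, hn2, hn3⟩ := ((eventually_ge_atTop 1).and
    ((Metric.tendsto_nhds.1 hμ (ε / 3) (by positivity)).and
      (hLC.eventually_lt_const (show 0 < ε / 3 by positivity)))).exists
  obtain ⟨K, hK⟩ := Metric.tendsto_atTop.1 (tendsto_integral_comp_samplePath h (M n)
    (hcont.comp (continuous_interpPath (M n))) (C := |f ω₀| + B) fun v => hf _) (ε / 3)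
    (by positivity)
  refine ⟨K, fun k hk => ?_⟩
  have h1 := hK k hk
  have h2 := hdiff k n hn1
  simp only [Function.comp_apply, Real.dist_eq] at h1 hn2 ⊢
  rw [abs_lt] at h1 hn2 ⊢
  rw [abs_le] at h2
  constructor <;> linarith

end WeakLimit

section SetLimit

variable {d : ℕ} {x y : Ed d} {a : ℕ → ℝ} {N : ℕ → ℕ} {t : ℝ} {z : ℕ → Fin d → ℤ}

lemma tendsto_VxyaN_real_univ (hd : 0 < d) (ha : ∀ k, 0 < a k) (ha0 : Tendsto a atTop (𝓝 0))
    (hz : ∀ k j, (x - y) j = a k * z k j) (hpar : ∀ k, Even (∑ j, z k j + N k)) (ht : 0 < t)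
    (hN : Tendsto (fun k => a k ^ 2 * N k / d) atTop (𝓝 t)) :
    Tendsto (fun k => (VxyaN x y (a k) (N k)).real univ) atTop
      (𝓝 (2 * ((2 * π * t) ^ (-(d : ℝ) / 2) * Real.exp (-‖x - y‖ ^ 2 / (2 * t))))) := by
  have h := tendsto_integral_cexp_VxyaN hd ha ha0 hz hpar ht hN (ι := Fin 0) (u := fun _ => 0)
    (fun j => j.elim0) fun _ => 0
  generalize 2 * ((2 * π * t) ^ (-(d : ℝ) / 2) * Real.exp (-‖x - y‖ ^ 2 / (2 * t))) = q at h ⊢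
  have h' := (Complex.continuous_re.tendsto _).comp h
  simpa [Function.comp_def] using h'

lemma tendsto_VxyaN_of_bounds (hd : 0 < d) (hxy : x ≠ y) (ha : ∀ k, 0 < a k)
    (ha0 : Tendsto a atTop (𝓝 0))
    (hz : ∀ k j, (x - y) j = a k * z k j) (hpar : ∀ k, Even (∑ j, z k j + N k)) (ht : 0 < t)
    (hN : Tendsto (fun k => a k ^ 2 * N k / d) atTop (𝓝 t))
    {Wt : ℝ → Measure (Omega2 x y)} (hWt : IsPinnedWienerFamily x y Wt)
    {F : Set (Omega2 x y)} (hF : Wt t (frontier F) = 0)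
    {c T₁ T₂ : ℝ} (hc : 0 < c) (hT₁ : 0 < T₁) (hcV : ∀ k, c ≤ (VxyaN x y (a k) (N k)).real univ)
    (hN2 : ∀ k, 2 ≤ N k) (h1 : ∀ k, T₁ ≤ a k ^ 2 * N k) (h2 : ∀ k, a k ^ 2 * N k ≤ T₂) :
    Tendsto (fun k => VxyaN x y (a k) (N k) F) atTop (𝓝 (2 * Wt t F)) := by
  obtain ⟨hmass, hfin, hbr⟩ := isBridge_of_isPinnedWienerFamily hWt ht
  have hVm := tendsto_VxyaN_real_univ hd ha ha0 hz hpar ht hN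
  set q := (2 * π * t) ^ (-(d : ℝ) / 2) * Real.exp (-‖x - y‖ ^ 2 / (2 * t)) with hq
  have hq0 : 0 < q := by positivity
  set V : ℕ → Measure (Omega2 x y) := fun k => VxyaN x y (a k) (N k) with hV
  have hVfin : ∀ k, IsFiniteMeasure (V k) := fun k => isFiniteMeasure_VxyaN (a k) hd (N k)
  have hVne : ∀ k, V k univ ≠ 0 := fun k h0 => by
    have := hcV k
    rw [measureReal_def, h0, ENNReal.toReal_zero] at this
    linarith
  have hVtop : ∀ k, V k univ ≠ ∞ := fun k => measure_ne_top _ _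
  let P : ℕ → ProbabilityMeasure (Omega2 x y) := fun k => ⟨(V k univ)⁻¹ • V k, ⟨by
    rw [Measure.smul_apply, smul_eq_mul, ENNReal.inv_mul_cancel (hVne k) (hVtop k)]⟩⟩
  let μ : ProbabilityMeasure (Omega2 x y) := ⟨(Wt t univ)⁻¹ • Wt t, hbr.prob⟩
  obtain ⟨C, hC, hE⟩ := exists_lintegral_edist_interpPath_le hd hxy (T₂ := T₂) hT₁
  have hlim : Tendsto P atTop (𝓝 μ) := by
    refine tendsto_of_tendsto_charFun_of_lintegral_edist_le (C := c⁻¹ * C) ?_ (by positivity) ?_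
    · intro M u hu ξ
      have e1 := tendsto_integral_cexp_VxyaN hd ha ha0 hz hpar ht hN hu ξ
      have e2 : Tendsto (fun k => (((V k).real univ : ℝ) : ℂ)⁻¹) atTop (𝓝 (((2 * q : ℝ) : ℂ)⁻¹)) :=
        ((Complex.continuous_ofReal.tendsto _).comp hVm).inv₀ (by
          exact_mod_cast (by positivity : (2 * q : ℝ) ≠ 0))
      have e3 := e2.mul e1
      rw [inv_mul_cancel_left₀ (by exact_mod_cast (by positivity : (2 * q : ℝ) ≠ 0)),
        ← hbr.charFun _ u hu ξ] at e3
      refine e3.congr fun k => ?_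
      change _ = ∫ ω : Omega2 x y, Complex.exp (Complex.I *
        ((∑ j, ⟪ξ j, evalAt ω.1 (u j)⟫ : ℝ) : ℂ)) ∂((V k univ)⁻¹ • V k)
      rw [integral_smul_measure, ENNReal.toReal_inv, measureReal_def, Complex.real_smul,
        Complex.ofReal_inv]
    · intro k M n hn hM
      change ∫⁻ ω, edist (interpPath x y M (samplePath M ω)) ω ∂((V k univ)⁻¹ • V k) ≤ _
      rw [lintegral_smul_measure, smul_eq_mul, mul_assoc, ENNReal.ofReal_mul (by positivity)]
      refine mul_le_mul' ?_ (hE (a k) (ha k) (z k) (hz k) (N k) (hN2 k) (h1 k) (h2 k) M n hn hM)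
      rw [ENNReal.ofReal_inv_of_pos hc, ENNReal.inv_le_inv]
      exact ENNReal.ofReal_le_of_le_toReal (hcV k)
  have hset := ProbabilityMeasure.tendsto_measure_of_null_frontier_of_tendsto' hlim (E := F) (by
    change ((Wt t univ)⁻¹ • Wt t) (frontier F) = 0
    rw [Measure.smul_apply, hF, smul_zero])
  have hVm' : Tendsto (fun k => V k univ) atTop (𝓝 (ENNReal.ofReal (2 * q))) := by
    refine (ENNReal.tendsto_ofReal hVm).congr fun k => ?_
    exact ENNReal.ofReal_toReal (hVtop k)
  have hWu : Wt t univ = ENNReal.ofReal q := by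
    rw [← hmass, measureReal_def, ENNReal.ofReal_toReal (measure_ne_top _ _)]
  have hmul := ENNReal.Tendsto.mul hVm' (Or.inr (measure_ne_top _ _)) hset
    (Or.inr ENNReal.ofReal_ne_top)
  have hq' : ENNReal.ofReal q ≠ 0 := by simpa using hq0
  convert hmul using 2
  · rename_i k
    change V k F = V k univ * ((V k univ)⁻¹ • V k) F
    rw [Measure.smul_apply, smul_eq_mul, ← mul_assoc, ENNReal.mul_inv_cancel (hVne k) (hVtop k),
      one_mul]
  · change 2 * Wt t F = _ * ((Wt t univ)⁻¹ • Wt t) F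
    rw [Measure.smul_apply, smul_eq_mul, hWu, ENNReal.ofReal_mul zero_le_two, mul_assoc,
      ← mul_assoc _ (_⁻¹), ENNReal.mul_inv_cancel hq' ENNReal.ofReal_ne_top, one_mul,
      ENNReal.ofReal_ofNat]

/-- Away from the boundary of a set, the lattice measures of `N`-step paths converge to twice the
pinned Wiener measure (the factor two being due to parity). -/
lemma tendsto_VxyaN (hd : 0 < d) (hxy : x ≠ y) (ha : ∀ k, 0 < a k)
    (ha0 : Tendsto a atTop (𝓝 0))
    (hz : ∀ k j, (x - y) j = a k * z k j) (hpar : ∀ k, Even (∑ j, z k j + N k)) (ht : 0 < t)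
    (hN : Tendsto (fun k => a k ^ 2 * N k / d) atTop (𝓝 t))
    {Wt : ℝ → Measure (Omega2 x y)} (hWt : IsPinnedWienerFamily x y Wt)
    {F : Set (Omega2 x y)} (hF : Wt t (frontier F) = 0) :
    Tendsto (fun k => VxyaN x y (a k) (N k) F) atTop (𝓝 (2 * Wt t F)) := by
  have hd' : (0 : ℝ) < d := by exact_mod_cast hd
  have hVm := tendsto_VxyaN_real_univ hd ha ha0 hz hpar ht hN
  set q := (2 * π * t) ^ (-(d : ℝ) / 2) * Real.exp (-‖x - y‖ ^ 2 / (2 * t)) with hq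
  have hq0 : 0 < q := by positivity
  have ha2 : Tendsto (fun k => a k ^ 2 / d) atTop (𝓝 0) := by
    simpa using (ha0.pow 2).div_const (d : ℝ)
  obtain ⟨K, hK⟩ := eventually_atTop.1 ((hVm.eventually_const_lt (show q < 2 * q by linarith)).and
    ((hN.eventually_lt_const (show t < 2 * t by linarith)).and
      ((hN.eventually_const_lt (show t / 2 < t by linarith)).and
        (ha2.eventually_lt_const (show 0 < t / 2 by linarith)))))
  have hlow : ∀ k, t / 2 * d < a (k + K) ^ 2 * N (k + K) := fun k =>
    (lt_div_iff₀ hd').1 (hK (k + K) (by omega)).2.2.1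
  refine (tendsto_add_atTop_iff_nat K).1 (tendsto_VxyaN_of_bounds (a := fun k => a (k + K))
    (N := fun k => N (k + K)) (z := fun k => z (k + K)) (c := q) (T₁ := t / 2 * d)
    (T₂ := 2 * t * d) hd hxy (fun k => ha _)
    (ha0.comp (tendsto_add_atTop_nat K)) (fun k => hz _) (fun k => hpar _) ht
    (hN.comp (tendsto_add_atTop_nat K)) hWt hF hq0 (by positivity)
    (fun k => (hK (k + K) (by omega)).1.le) (fun k => ?_) (fun k => (hlow k).le)
    (fun k => ((div_lt_iff₀ hd').1 (hK (k + K) (by omega)).2.1).le))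
  by_contra! hlt
  have h1 := (div_lt_iff₀ hd').1 (hK (k + K) (by omega)).2.2.2
  have h2 : (N (k + K) : ℝ) ≤ 1 := by exact_mod_cast Nat.le_of_lt_succ hlt
  have h3 := hlow k
  nlinarith [sq_nonneg (a (k + K))]

end SetLimit

section TimeIntegral

variable {d : ℕ} {x y : Ed d}

lemma iUnion_Ico_nat_mul {τ : ℝ} (hτ : 0 < τ) :
    ⋃ n : ℕ, Set.Ico ((n : ℝ) * τ) ((n + 1) * τ) = Set.Ici 0 := by
  ext t
  simp only [Set.mem_iUnion, Set.mem_Ico, Set.mem_Ici]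
  refine ⟨fun ⟨n, h, _⟩ => le_trans (by positivity) h, fun h => ⟨⌊t / τ⌋₊, ?_, ?_⟩⟩
  · exact (le_div_iff₀ hτ).1 (Nat.floor_le (by positivity))
  · exact (div_lt_iff₀ hτ).1 (Nat.lt_floor_add_one _)

lemma floor_div_of_mem_Ico {τ t : ℝ} (hτ : 0 < τ) {n : ℕ}
    (h : t ∈ Set.Ico ((n : ℝ) * τ) ((n + 1) * τ)) : ⌊t / τ⌋₊ = n := by
  have h0 : 0 ≤ t := le_trans (by positivity) h.1
  rw [Nat.floor_eq_iff (by positivity)]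
  exact ⟨(le_div_iff₀ hτ).2 h.1, (div_lt_iff₀ hτ).2 h.2⟩

lemma lintegral_floor_div {τ : ℝ} (hτ : 0 < τ) (G : ℕ → ℝ≥0∞) :
    ∫⁻ t in Set.Ioi (0 : ℝ), G ⌊t / τ⌋₊ = ENNReal.ofReal τ * ∑' n, G n := by
  rw [setLIntegral_congr Ioi_ae_eq_Ici, ← iUnion_Ico_nat_mul hτ,
    lintegral_iUnion (fun n => measurableSet_Ico), ← ENNReal.tsum_mul_left]
  · refine tsum_congr fun n => ?_
    rw [setLIntegral_congr_fun (g := fun _ => G n) measurableSet_Ico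
      (fun t ht => by simp only [floor_div_of_mem_Ico hτ ht]), setLIntegral_const,
      Real.volume_Ico, mul_comm]
    congr 2
    ring
  · intro i j hij
    refine Set.disjoint_left.2 fun t hi hj => hij ?_
    rw [← floor_div_of_mem_Ico hτ hi, ← floor_div_of_mem_Ico hτ hj]

lemma VxyaN_eq_zero_of_odd {a : ℝ} (ha : 0 < a) {z : Fin d → ℤ}
    (hz : ∀ k, (x - y) k = a * z k) {N : ℕ} (hN : ¬Even (∑ k, z k + N)) : VxyaN x y a N = 0 := by
  have : IsEmpty {s : Fin N → Fin d × Bool // x + ∑ i, stepVec a (s i) = y} :=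
    ⟨fun s => hN (even_of_path ha hz s.2)⟩
  rw [VxyaN, Measure.sum_of_isEmpty]

lemma VxyaN_one_eq_zero {a : ℝ} (ha : 0 < a) (hxy : a < ‖x - y‖) : VxyaN x y a 1 = 0 := by
  have : IsEmpty {s : Fin 1 → Fin d × Bool // x + ∑ i, stepVec a (s i) = y} := by
    refine ⟨fun s => hxy.ne' ?_⟩
    have h := s.2
    rw [Fin.sum_univ_one] at h
    rw [← h, sub_add_cancel_left, norm_neg, stepVec, norm_smul, PiLp.norm_single, norm_one, mul_one]
    split_ifs <;> simp [abs_of_pos ha]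
  rw [VxyaN, Measure.sum_of_isEmpty]

open scoped Classical in
/-- The smallest positive number of steps of the same parity as the lattice paths from `x` to `y`,
given the coordinates `z` of `x - y`. -/
def stepParity (z : Fin d → ℤ) : ℕ := if Even (∑ k, z k) then 2 else 1

lemma stepParity_eq (z : Fin d → ℤ) : stepParity z = 1 ∨ stepParity z = 2 := by
  unfold stepParity; split_ifs <;> simp

lemma even_add_stepParity (z : Fin d → ℤ) (M : ℕ) :
    Even (∑ k, z k + ((2 * M + stepParity z : ℕ) : ℤ)) := by
  unfold stepParity
  split_ifs with h <;> push_cast <;> simp [Int.even_add, h, parity_simps]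

lemma Vxya_apply_eq_tsum {m a : ℝ} (ha : 0 < a) {z : Fin d → ℤ}
    (hz : ∀ k, (x - y) k = a * z k) {F : Set (Omega2 x y)} (hF : MeasurableSet F) :
    Vxya x y m a F = ENNReal.ofReal (1 - Real.exp (-(m ^ 2 / 2 * (a ^ 2 / d)))) *
      ∑' M : ℕ, ENNReal.ofReal (Real.exp (-(m ^ 2 / 2 *
        (a ^ 2 * (2 * M + stepParity z : ℕ) / d)))) * VxyaN x y a (2 * M + stepParity z) F := by
  rw [Vxya, Measure.smul_apply, Measure.sum_apply _ hF, smul_eq_mul]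
  congr 1
  · congr 3; ring
  simp only [Measure.smul_apply, smul_eq_mul]
  rw [← tsum_even_add_odd ENNReal.summable ENNReal.summable, ← ENNReal.tsum_add]
  refine tsum_congr fun M => ?_
  have hodd : ∀ N : ℕ, ¬Even (∑ k, z k + (N : ℤ)) → VxyaN x y a N F = 0 := fun N hN => by
    rw [VxyaN_eq_zero_of_odd ha hz hN]; rfl
  have hp := even_add_stepParity z M
  rcases stepParity_eq z with h | h
  · rw [h] at hp ⊢
    have hodd' : ¬ Even (∑ k, z k + ((2 * M + 1 + 1 : ℕ) : ℤ)) := by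
      push_cast at hp ⊢
      rw [← add_assoc, Int.even_add_one]
      simpa [add_assoc] using hp
    rw [hodd _ hodd', mul_zero, add_zero]
    congr 3
    push_cast; ring
  · rw [h] at hp ⊢
    rw [hodd (2 * M + 1) (by
      push_cast at hp ⊢
      intro h'
      have := hp.sub h'
      rw [show (∑ k, z k + (2 * (M : ℤ) + 2)) - (∑ k, z k + (2 * M + 1)) = 1 by ring] at this
      exact absurd this (by decide)), mul_zero, zero_add]
    congr 3
    push_cast; ring

end TimeIntegral

section LatticeTimeIntegral

variable {d : ℕ} {x y : Ed d}

/-- The step count nearest to time `t` on the lattice of spacing `a`, of the parity compatible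
with the lattice displacement `z`. -/
def latticeSteps (a : ℝ) (z : Fin d → ℤ) (t : ℝ) : ℕ :=
  2 * ⌊t / (2 * (a ^ 2 / d))⌋₊ + stepParity z

/-- The density in time of the lattice measure `Vxya x y m a` evaluated on `F`. -/
def latticeDensity (x y : Ed d) (m a : ℝ) (z : Fin d → ℤ) (F : Set (Omega2 x y)) (t : ℝ) : ℝ≥0∞ :=
  ENNReal.ofReal ((1 - Real.exp (-(m ^ 2 / 2 * (a ^ 2 / d)))) / (2 * (a ^ 2 / d))) *
    (ENNReal.ofReal (Real.exp (-(m ^ 2 / 2 * (a ^ 2 * latticeSteps a z t / d)))) *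
      VxyaN x y a (latticeSteps a z t) F)

lemma Vxya_apply_eq_lintegral (hd : 0 < d) {m a : ℝ} (ha : 0 < a) {z : Fin d → ℤ}
    (hz : ∀ k, (x - y) k = a * z k) {F : Set (Omega2 x y)} (hF : MeasurableSet F) :
    Vxya x y m a F = ∫⁻ t in Set.Ioi (0 : ℝ), latticeDensity x y m a z F t := by
  have hd' : (0 : ℝ) < d := by exact_mod_cast hd
  have hs : 0 < 2 * (a ^ 2 / d) := by positivity
  rw [Vxya_apply_eq_tsum ha hz hF]
  simp only [latticeDensity, latticeSteps]
  rw [lintegral_floor_div hs (fun M => ENNReal.ofReal ((1 - Real.exp (-(m ^ 2 / 2 * (a ^ 2 / d)))) /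
    (2 * (a ^ 2 / d))) * (ENNReal.ofReal (Real.exp (-(m ^ 2 / 2 *
      (a ^ 2 * (2 * M + stepParity z : ℕ) / d)))) * VxyaN x y a (2 * M + stepParity z) F)),
    ENNReal.tsum_mul_left, ← mul_assoc, ← ENNReal.ofReal_mul hs.le, mul_div_cancel₀ _ hs.ne']

lemma measurable_latticeDensity (m a : ℝ) (z : Fin d → ℤ) (F : Set (Omega2 x y)) :
    Measurable (latticeDensity x y m a z F) := by
  have h : Measurable fun t : ℝ => ⌊t / (2 * (a ^ 2 / d))⌋₊ :=
    Nat.measurable_floor.comp (measurable_id.div_const _)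
  exact (measurable_from_nat (f := fun M : ℕ =>
    ENNReal.ofReal ((1 - Real.exp (-(m ^ 2 / 2 * (a ^ 2 / d)))) / (2 * (a ^ 2 / d))) *
    (ENNReal.ofReal (Real.exp (-(m ^ 2 / 2 * (a ^ 2 * (2 * M + stepParity z : ℕ) / d)))) *
      VxyaN x y a (2 * M + stepParity z) F))).comp h

lemma abs_latticeSteps_sub_le (hd : 0 < d) {a t : ℝ} (ha : 0 < a) (z : Fin d → ℤ) (ht : 0 ≤ t) :
    |a ^ 2 * latticeSteps a z t / d - t| ≤ 2 * (a ^ 2 / d) := by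
  have hd' : (0 : ℝ) < d := by exact_mod_cast hd
  have hs : 0 < 2 * (a ^ 2 / d) := by positivity
  have h1 := Nat.floor_le (div_nonneg ht hs.le)
  have h2 := Nat.lt_floor_add_one (t / (2 * (a ^ 2 / d)))
  rw [le_div_iff₀ hs] at h1
  rw [div_lt_iff₀ hs] at h2
  have e : a ^ 2 * latticeSteps a z t / d =
      (⌊t / (2 * (a ^ 2 / d))⌋₊ : ℝ) * (2 * (a ^ 2 / d)) + a ^ 2 / d * stepParity z := by
    rw [latticeSteps]; push_cast; ring
  rw [e, abs_le]
  rcases stepParity_eq z with h | h <;> rw [h] <;> push_cast <;> constructor <;> linarith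

lemma one_sub_exp_div_le {c s : ℝ} (hs : 0 < s) :
    (1 - Real.exp (-(c * s))) / (2 * s) ≤ c / 2 := by
  rw [div_le_iff₀ (by positivity)]
  linarith [Real.add_one_le_exp (-(c * s))]

lemma tendsto_one_sub_exp_div (c : ℝ) {s : ℕ → ℝ} (hs : ∀ k, 0 < s k)
    (hs0 : Tendsto s atTop (𝓝 0)) :
    Tendsto (fun k => (1 - Real.exp (-(c * s k))) / (2 * s k)) atTop (𝓝 (c / 2)) := by
  have h : HasDerivAt (fun u : ℝ => Real.exp (-(c * u))) (-c) 0 := by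
    have := ((hasDerivAt_id (0 : ℝ)).const_mul c).neg.exp
    simpa using this
  have h2 := (hasDerivAt_iff_tendsto_slope_zero.mp h).comp
    (tendsto_nhdsWithin_iff.mpr ⟨hs0, .of_forall fun k => (hs k).ne'⟩)
  refine (h2.mul_const (-1 / 2)).congr' (.of_forall fun k => ?_) |>.trans (by
    rw [show -c * (-1 / 2) = c / 2 by ring])
  have := (hs k).ne'
  simp
  field_simp
  ring

lemma latticeDensity_le (hd : 0 < d) (m : ℝ) {C : ℝ}
    (hC : ∀ a : ℝ, 0 < a → ∀ z : Fin d → ℤ, (∀ k, (x - y) k = a * z k) → ∀ N : ℕ, 2 ≤ N →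
      (VxyaN x y a N).real univ ≤ C)
    {a t : ℝ} (ha : 0 < a) (hxy : a < ‖x - y‖) (ha1 : a ^ 2 / d ≤ 1) {z : Fin d → ℤ}
    (hz : ∀ k, (x - y) k = a * z k) (F : Set (Omega2 x y)) (ht : 0 ≤ t) :
    latticeDensity x y m a z F t ≤ ENNReal.ofReal (m ^ 2 / 4) *
      (ENNReal.ofReal (Real.exp (-(m ^ 2 / 2 * (t - 2)))) * ENNReal.ofReal C) := by
  have hd' : (0 : ℝ) < d := by exact_mod_cast hd
  have hs : 0 < a ^ 2 / d := by positivity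
  rw [latticeDensity]
  refine mul_le_mul' (ENNReal.ofReal_le_ofReal ((one_sub_exp_div_le hs).trans_eq (by ring)))
    (mul_le_mul' (ENNReal.ofReal_le_ofReal (Real.exp_le_exp.mpr (neg_le_neg ?_))) ?_)
  · gcongr
    have := (abs_le.mp (abs_latticeSteps_sub_le hd ha z ht)).1
    linarith
  · have := isFiniteMeasure_VxyaN (x := x) (y := y) a hd (latticeSteps a z t)
    rcases (show latticeSteps a z t = 1 ∨ 2 ≤ latticeSteps a z t by
      rw [latticeSteps]; rcases stepParity_eq z with h | h <;> omega) with h | h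
    · rw [h, VxyaN_one_eq_zero ha hxy]; simp
    · refine (measure_mono (subset_univ F)).trans ?_
      rw [← ofReal_measureReal]
      exact ENNReal.ofReal_le_ofReal (hC a ha z hz _ h)

variable {a : ℕ → ℝ} {z : ℕ → Fin d → ℤ}

lemma tendsto_latticeDensity (hd : 0 < d) (hxy : x ≠ y) (m : ℝ) (ha : ∀ k, 0 < a k)
    (ha0 : Tendsto a atTop (𝓝 0)) (hz : ∀ k j, (x - y) j = a k * z k j)
    {Wt : ℝ → Measure (Omega2 x y)} (hWt : IsPinnedWienerFamily x y Wt)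
    {F : Set (Omega2 x y)} {t : ℝ} (ht : 0 < t) (hF : Wt t (frontier F) = 0) :
    Tendsto (fun k => latticeDensity x y m (a k) (z k) F t) atTop
      (𝓝 (ENNReal.ofReal (m ^ 2 / 2 * Real.exp (-m ^ 2 * t / 2)) * Wt t F)) := by
  have hd' : (0 : ℝ) < d := by exact_mod_cast hd
  have hs0 : Tendsto (fun k => a k ^ 2 / d) atTop (𝓝 0) := by
    simpa using (ha0.pow 2).div_const (d : ℝ)
  have hs : ∀ k, 0 < a k ^ 2 / d := fun k => by have := ha k; positivity
  have hN : Tendsto (fun k => a k ^ 2 * latticeSteps (a k) (z k) t / d) atTop (𝓝 t) := by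
    rw [tendsto_iff_norm_sub_tendsto_zero]
    exact squeeze_zero (fun _ => norm_nonneg _)
      (fun k => abs_latticeSteps_sub_le hd (ha k) (z k) ht.le) (by simpa using hs0.const_mul 2)
  have hV := tendsto_VxyaN hd hxy ha ha0 hz (fun k => even_add_stepParity (z k) _) ht hN hWt hF
  have hE : Tendsto (fun k => Real.exp (-(m ^ 2 / 2 * (a k ^ 2 * latticeSteps (a k) (z k) t / d))))
      atTop (𝓝 (Real.exp (-(m ^ 2 / 2 * t)))) :=
    (Real.continuous_exp.tendsto _).comp (hN.const_mul _).neg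
  have := (hWt t ht).1
  have hne : 2 * Wt t F ≠ ∞ := ENNReal.mul_ne_top (by simp) (measure_ne_top _ _)
  have hlim := ENNReal.Tendsto.mul
    (ENNReal.tendsto_ofReal (tendsto_one_sub_exp_div (m ^ 2 / 2) hs hs0))
    (Or.inr (ENNReal.mul_ne_top ENNReal.ofReal_ne_top hne))
    (ENNReal.Tendsto.mul (ENNReal.tendsto_ofReal hE) (Or.inr hne) hV
      (Or.inr ENNReal.ofReal_ne_top))
    (Or.inr ENNReal.ofReal_ne_top)
  rw [show ENNReal.ofReal (m ^ 2 / 2 * Real.exp (-m ^ 2 * t / 2)) * Wt t F =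
    ENNReal.ofReal (m ^ 2 / 2 / 2) * (ENNReal.ofReal (Real.exp (-(m ^ 2 / 2 * t))) *
      (2 * Wt t F)) from ?_]
  · exact hlim
  rw [← mul_assoc, ← mul_assoc, ← ENNReal.ofReal_mul (by positivity)]
  congr 1
  rw [← ENNReal.ofReal_ofNat 2, ← ENNReal.ofReal_mul (by positivity)]
  congr 1
  rw [show -m ^ 2 * t / 2 = -(m ^ 2 / 2 * t) by ring]
  ring

/-- The lattice measures of a set with Wiener-null boundary converge to its resolvent measure. -/
lemma tendsto_Vxya (hd : 0 < d) (hxy : x ≠ y) {m : ℝ} (hm : 0 < m) (ha : ∀ k, 0 < a k)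
    (ha0 : Tendsto a atTop (𝓝 0)) (hz : ∀ k j, (x - y) j = a k * z k j)
    {Wt : ℝ → Measure (Omega2 x y)} (hWt : IsPinnedWienerFamily x y Wt)
    {F : Set (Omega2 x y)} (hFm : MeasurableSet F) (hF : ∀ t, 0 < t → Wt t (frontier F) = 0) :
    Tendsto (fun k => (Vxya x y m (a k) F).toReal) atTop
      (𝓝 (m ^ 2 / 2 * ∫ t in Set.Ioi (0 : ℝ), Real.exp (-m ^ 2 * t / 2) * (Wt t F).toReal)) := by
  obtain ⟨C, hC0, hC⟩ := exists_mass_VxyaN_le hd hxy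
  have hlim : ∀ᵐ t ∂volume.restrict (Ioi (0 : ℝ)),
      Tendsto (fun k => latticeDensity x y m (a k) (z k) F t) atTop
        (𝓝 (ENNReal.ofReal (m ^ 2 / 2 * Real.exp (-m ^ 2 * t / 2)) * Wt t F)) :=
    ae_restrict_of_forall_mem measurableSet_Ioi fun t ht =>
      tendsto_latticeDensity hd hxy m ha ha0 hz hWt ht (hF t ht)
  have hs0 : Tendsto (fun k => a k ^ 2 / d) atTop (𝓝 0) := by
    simpa using (ha0.pow 2).div_const (d : ℝ)
  have hbound : ∀ᶠ k in atTop, ∀ᵐ t ∂volume.restrict (Ioi (0 : ℝ)),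
      latticeDensity x y m (a k) (z k) F t ≤ ENNReal.ofReal (m ^ 2 / 4) *
        (ENNReal.ofReal (Real.exp (-(m ^ 2 / 2 * (t - 2)))) * ENNReal.ofReal C) := by
    filter_upwards [hs0.eventually_le_const one_pos,
      ha0.eventually_lt_const (norm_pos_iff.mpr (sub_ne_zero.mpr hxy))] with k h1 h2
    exact ae_restrict_of_forall_mem measurableSet_Ioi fun t ht =>
      latticeDensity_le hd m hC (ha k) h2 h1 (hz k) F (le_of_lt ht)
  have hfin : ∫⁻ t in Ioi (0 : ℝ), ENNReal.ofReal (m ^ 2 / 4) *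
      (ENNReal.ofReal (Real.exp (-(m ^ 2 / 2 * (t - 2)))) * ENNReal.ofReal C) ≠ ∞ := by
    have hi : IntegrableOn (fun t : ℝ => Real.exp (-(m ^ 2 / 2 * (t - 2)))) (Ioi 0) := by
      refine ((integrableOn_exp_mul_Ioi (a := -(m ^ 2 / 2)) (by nlinarith [sq_pos_of_pos hm])
        0).const_mul (Real.exp (m ^ 2))).congr (.of_forall fun t => ?_)
      simp only [← Real.exp_add]
      congr 1; ring
    rw [lintegral_const_mul' _ _ ENNReal.ofReal_ne_top,
      lintegral_mul_const' _ _ ENNReal.ofReal_ne_top]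
    exact ENNReal.mul_ne_top ENNReal.ofReal_ne_top
      (ENNReal.mul_ne_top hi.lintegral_lt_top.ne ENNReal.ofReal_ne_top)
  have hmeas : AEMeasurable (fun t : ℝ => ENNReal.ofReal (m ^ 2 / 2 * Real.exp (-m ^ 2 * t / 2)) *
      Wt t F) (volume.restrict (Ioi 0)) :=
    aemeasurable_of_tendsto_metrizable_ae' (fun k =>
      (measurable_latticeDensity m (a k) (z k) F).aemeasurable) hlim
  have hle : ∀ᵐ t ∂volume.restrict (Ioi (0 : ℝ)),
      ENNReal.ofReal (m ^ 2 / 2 * Real.exp (-m ^ 2 * t / 2)) * Wt t F ≤ ENNReal.ofReal (m ^ 2 / 4) *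
        (ENNReal.ofReal (Real.exp (-(m ^ 2 / 2 * (t - 2)))) * ENNReal.ofReal C) := by
    obtain ⟨K, hK⟩ := eventually_atTop.mp hbound
    filter_upwards [hlim, ae_all_iff.mpr fun k => hK (K + k) (Nat.le_add_right _ _)] with t h1 h2
    refine le_of_tendsto h1 (eventually_atTop.mpr ⟨K, fun k hk => ?_⟩)
    obtain ⟨j, rfl⟩ := Nat.exists_eq_add_of_le hk
    exact h2 j
  have hconv := tendsto_lintegral_filter_of_dominated_convergence _
    (.of_forall fun k => (measurable_latticeDensity m (a k) (z k) F)) hbound hfin hlim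
  have hlim_ne := ((lintegral_mono_ae hle).trans_lt hfin.lt_top).ne
  have hreal : m ^ 2 / 2 * ∫ t in Set.Ioi (0 : ℝ), Real.exp (-m ^ 2 * t / 2) * (Wt t F).toReal =
      (∫⁻ t in Ioi (0 : ℝ), ENNReal.ofReal (m ^ 2 / 2 * Real.exp (-m ^ 2 * t / 2)) *
        Wt t F).toReal := by
    rw [← integral_const_mul, ← integral_toReal hmeas (ae_lt_top' hmeas hlim_ne)]
    refine integral_congr_ae (.of_forall fun t => ?_)
    simp only [ENNReal.toReal_mul]
    rw [ENNReal.toReal_ofReal (by positivity), mul_assoc]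
  rw [hreal]
  simp only [Vxya_apply_eq_lintegral hd (ha _) (hz _) hFm]
  exact (ENNReal.tendsto_toReal hlim_ne).comp hconv

end LatticeTimeIntegral

/-- **Convergence of lattice approximations on cylinder sets.**
For open boxes `A_1, …, A_n` whose bounding faces never overlap (distinct boundaries
meet in a finite union of affine subspaces of dimension `≤ d-2`), with `x ∈ A_1` and
`y ∈ A_n ∖ closure(A_{n-1})`: the boundary in `Ω̄(x,y)` of `Z̄(A_1,…,A_n)` has
`V_{x,y}`-measure zero, and consequently
`V_{x,y,a}(Z̄(A_1,…,A_n)) → (m²/2) V_{x,y}(Z̄(A_1,…,A_n))` as `a → 0⁺` along values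
of `a` with `x - y ∈ aℤ^d`.  Here `V_{x,y} = π_* V'_{x,y}` with
`V'_{x,y}(·) = ∫_0^∞ e^{-m²t/2} W^t_{x,y}(·) dt`, and `Ω̄(x,y)` is realized as any
metric space `Q` with a surjection `pr : Ω(x,y) → Q` inducing the reparametrization
pseudo-distance `d̄`. -/
theorem Zbar_boundary_null_and_lattice_tendsto (d n : ℕ) (hd : 1 ≤ d) (hn : 2 ≤ n)
    (m : ℝ) (hm : 0 < m) (x y : Ed d) (hxy : x ≠ y)
    (Q : Type) [MetricSpace Q] [MeasurableSpace Q] [BorelSpace Q]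
    (pr : Omega2 x y → Q) (hsurj : Function.Surjective pr)
    (hdist : ∀ ω ω' : Omega2 x y, dist (pr ω) (pr ω') = quotDist ω.1 ω'.1)
    (Wt : ℝ → Measure (Omega2 x y)) (hWt : IsPinnedWienerFamily x y Wt)
    (lo hi : Fin n → Fin d → ℝ) (hlh : ∀ i j, lo i j < hi i j)
    (A : Fin n → Set (Ed d))
    (hA : ∀ i, A i = {p : Ed d | ∀ j, p j ∈ Set.Ioo (lo i j) (hi i j)})
    (hfaces : ∀ i j : Fin n, i ≠ j →
      ∃ (k : ℕ) (S : Fin k → AffineSubspace ℝ (Ed d)),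
        (∀ l, Module.finrank ℝ (S l).direction + 2 ≤ d) ∧
        frontier (A i) ∩ frontier (A j) ⊆ ⋃ l, (S l : Set (Ed d)))
    (hx : x ∈ A ⟨0, by omega⟩)
    (hy : y ∈ A ⟨n - 1, by omega⟩ \ closure (A ⟨n - 2, by omega⟩)) :
    (∫⁻ t in Set.Ioi (0 : ℝ), ENNReal.ofReal (Real.exp (-m ^ 2 * t / 2)) *
        Wt t (pr ⁻¹' frontier (closure (Zset pr A))) = 0)
    ∧ Tendsto
        (fun a : ℝ => (Measure.map pr (Vxya x y m a) (closure (Zset pr A))).toReal)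
        ((nhdsWithin 0 (Set.Ioi 0)) ⊓
          Filter.principal {a : ℝ | ∃ z : Fin d → ℤ, ∀ j, (x - y) j = a * (z j)})
        (nhds ((m ^ 2 / 2) * ∫ t in Set.Ioi (0 : ℝ),
          Real.exp (-m ^ 2 * t / 2) *
            (Wt t (pr ⁻¹' closure (Zset pr A))).toReal)) := by
  have hd0 : 0 < d := hd
  have hcont : Continuous pr := (lipschitzWith_pr hdist).continuous
  have hnull : ∀ t, 0 < t → Wt t (pr ⁻¹' frontier (closure (Zset pr A))) = 0 := fun t ht =>
    hWt.preimage_frontier_null ht hn hsurj hdist hA hfaces hx hy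
  constructor
  · rw [setLIntegral_congr_fun (g := fun _ => 0) measurableSet_Ioi
      (fun t ht => by simp [hnull t ht])]
    simp
  refine tendsto_of_seq_tendsto fun u hu => ?_
  rw [tendsto_inf, tendsto_principal, tendsto_nhdsWithin_iff] at hu
  obtain ⟨K, hK⟩ := eventually_atTop.mp (hu.1.2.and hu.2)
  rw [← tendsto_add_atTop_iff_nat K]
  choose hpos z hz using fun k => hK (k + K) (Nat.le_add_left _ _)
  have hclosed : IsClosed (pr ⁻¹' closure (Zset pr A)) := isClosed_closure.preimage hcont
  simp only [Measure.map_apply hcont.measurable isClosed_closure.measurableSet]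
  exact tendsto_Vxya hd0 hxy hm hpos (hu.1.1.comp (tendsto_add_atTop_nat K)) hz hWt
    hclosed.measurableSet
    fun t ht => measure_mono_null (hcont.frontier_preimage_subset _) (hnull t ht)

end
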